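/- There exist universal constants c, C > 0 and a positive function f(p,α) with the following property. Let 2 ≤ p < 4, q := p/(p−1), and let K ⊂ ℝⁿ be a p-convex body with constant α which is isotropic with isotropic constant L_K. Then there exists T ∈ SL(n,ℝ) such that: (1) the operator norm satisfies ‖T‖_op ≤ C n^{1/(2q)} α^{−1/(2p)} L_K^{−1/2} min(f(p,α), log(1+n))^{1/2}; (2) (Var^q_{T(K)}(|x|²))^{1/q} ≤ C n^{1/4 + 1/q} α^{−1/p} L_K min(f(p,α), log(1+n)); and (3) setting ρ² := n^{−1} ∫_{T(K)} |x|² dx, for every t > 0, vol{x ∈ T(K) : | |x|/√n − ρ | ≥ tρ} ≤ 2 exp(−c L_K^{1/2} α^{1/(2p)} n^{3/8 − 1/(2q)} t^{1/2} / min(f(p,α), log(1+n))^{1/2}). -/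

import Mathlib

open MeasureTheory Real Set
open scoped ENNReal RealInnerProductSpace Pointwise

noncomputable section

namespace GM

abbrev E (n : ℕ) := EuclideanSpace ℝ (Fin n)

variable {n : ℕ}

/-- A centrally-symmetric convex body. -/
def IsConvexBody (K : Set (E n)) : Prop :=
  IsCompact K ∧ Convex ℝ K ∧ (interior K).Nonempty ∧ K = -K

/-- The Euclidean unit sphere in `E n`. -/
def usphere (n : ℕ) : Set (E n) := Metric.sphere 0 1

/-- Haar probability measure on the unit sphere, realized as the normalized
`(n-1)`-dimensional Hausdorff measure restricted to the sphere. -/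
def sphMeasure (n : ℕ) : Measure (E n) :=
  (μH[(n : ℝ) - 1] (usphere n))⁻¹ • (μH[(n : ℝ) - 1]).restrict (usphere n)

/-- The marginal density `g_θ(s) = vol_{n-1}(K ∩ {sθ + θ^⊥})`. -/
def gdens (K : Set (E n)) (θ : E n) (s : ℝ) : ℝ :=
  (μH[(n : ℝ) - 1] (K ∩ {x : E n | ⟪x, θ⟫ = s})).toReal

/-- The centered Gaussian density with variance `ρ²`. -/
def gauss (ρ s : ℝ) : ℝ :=
  (Real.sqrt (2 * π) * ρ)⁻¹ * Real.exp (-(s ^ 2) / (2 * ρ ^ 2))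

/-- Kolmogorov-type distance between even densities. -/
def dKol (f₁ f₂ : ℝ → ℝ) : ℝ :=
  sSup {d | ∃ t > (0 : ℝ), d = |(∫ s in (-t)..t, f₁ s) - ∫ s in (-t)..t, f₂ s|}

/-- Linnik-type distance between densities. -/
def dLin (T : ℝ) (f₁ f₂ : ℝ → ℝ) : ℝ :=
  sSup {d | ∃ s : ℝ, 0 ≤ s ∧ s ≤ T ∧ d = |f₁ s / f₂ s - 1|}

/-- `ρ_θ = (∫_K ⟨x,θ⟩² dx)^{1/2}`. -/
def rhoDir (K : Set (E n)) (θ : E n) : ℝ :=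
  Real.sqrt (∫ x in K, ⟪x, θ⟫ ^ 2)

def rhoMax (K : Set (E n)) : ℝ := sSup (rhoDir K '' usphere n)

def rhoAvg (K : Set (E n)) : ℝ := ∫ θ, rhoDir K θ ∂(sphMeasure n)

/-- `C_iso(K) = ρ_max / ρ_avg`. -/
def Ciso (K : Set (E n)) : ℝ := rhoMax K / rhoAvg K

/-- Concentration hypothesis (⋆) with parameters `(ρ, A, B, ν, τ)`. -/
def ConcHyp (K : Set (E n)) (ρ A B ν τ : ℝ) : Prop :=
  ∀ t : ℝ, 0 ≤ t → t ≤ 1 →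
    volume {x : E n | x ∈ K ∧ t * ρ ≤ |‖x‖ / Real.sqrt n - ρ|} ≤
      ENNReal.ofReal (A * Real.exp (-B * (n : ℝ) ^ ν * t ^ τ))

/-- The modulus of convexity of `K` (w.r.t. the gauge norm of `K`). -/
def modConv (K : Set (E n)) (ε : ℝ) : ℝ :=
  sInf {d | ∃ x y : E n, gauge K x ≤ 1 ∧ gauge K y ≤ 1 ∧ ε ≤ gauge K (x - y) ∧
    d = 1 - gauge K ((2⁻¹ : ℝ) • (x + y))}

/-- `K` is a `p`-convex body with constant `α`. -/
def IsPConvexBody (K : Set (E n)) (p α : ℝ) : Prop :=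
  IsConvexBody K ∧ ∀ ε : ℝ, 0 < ε → ε ≤ 2 → α * ε ^ p ≤ modConv K ε

/-- Löwner's minimal diameter position. -/
def IsLowner (K : Set (E n)) : Prop :=
  ∀ T : E n →ₗ[ℝ] E n, |LinearMap.det T| = 1 →
    Metric.diam K ≤ Metric.diam (T '' K)

/-- The type-`s` constant of `X_K = (ℝⁿ, ‖·‖_K)`. -/
def typeConst (K : Set (E n)) (s : ℝ) : ℝ :=
  sInf {T : ℝ | 0 < T ∧ ∀ m : ℕ, ∀ x : Fin m → E n,
    Real.sqrt (((2 : ℝ) ^ m)⁻¹ * ∑ ε : Fin m → Bool,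
      gauge K (∑ i, (if ε i then (1 : ℝ) else -1) • x i) ^ 2) ≤
      T * (∑ i, gauge K (x i) ^ s) ^ (1 / s)}

/-- `X_K` is (isometric to) a subspace of a quotient of `L_p([0,1])`:
there is a closed submodule `N` of `L_p([0,1])` and a linear isometric embedding of
`(ℝⁿ, ‖·‖_K)` into the quotient `L_p([0,1]) ⧸ N` (with the quotient norm). -/
def IsSubspaceOfQuotientOfLp (K : Set (E n)) (p : ℝ) (hp : 1 ≤ p) : Prop :=
  letI : Fact ((1 : ℝ≥0∞) ≤ ENNReal.ofReal p) := ⟨ENNReal.one_le_ofReal.mpr hp⟩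
  ∃ N : Submodule ℝ (MeasureTheory.Lp ℝ (ENNReal.ofReal p) (volume.restrict (Icc (0 : ℝ) 1))),
    IsClosed (N : Set (MeasureTheory.Lp ℝ (ENNReal.ofReal p) (volume.restrict (Icc (0 : ℝ) 1)))) ∧
    ∃ J : E n →ₗ[ℝ]
      (MeasureTheory.Lp ℝ (ENNReal.ofReal p) (volume.restrict (Icc (0 : ℝ) 1)) ⧸ N),
      ∀ x : E n, gauge K x = ‖J x‖

/-- `K` is isotropic with isotropic constant `L`. -/
def IsIsotropic (K : Set (E n)) (L : ℝ) : Prop :=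
  volume K = 1 ∧ ∀ θ : E n, ‖θ‖ = 1 → (∫ x in K, ⟪x, θ⟫ ^ 2) = L ^ 2

/-- Entropy of `g` over `K`. -/
def entK (K : Set (E n)) (g : E n → ℝ) : ℝ :=
  (∫ x in K, g x * Real.log (g x)) - (∫ x in K, g x) * Real.log (∫ x in K, g x)

/-- `Var^q_K(f) = ∫_K |f - ∫_K f|^q`. -/
def varq (K : Set (E n)) (q : ℝ) (f : E n → ℝ) : ℝ :=
  ∫ x in K, |f x - ∫ y in K, f y| ^ q

/-- The dual gauge `‖y‖_K^* = sup_{x ∈ K} ⟨x,y⟩`. -/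
def dualGauge (K : Set (E n)) (y : E n) : ℝ :=
  sSup ((fun x : E n => ⟪x, y⟫) '' K)

/-- Half the mean width `M*(K)`. -/
def Mstar (K : Set (E n)) : ℝ := ∫ θ, dualGauge K θ ∂(sphMeasure n)

/-- Minimal mean-width position. -/
def IsMinMeanWidth (K : Set (E n)) : Prop :=
  ∀ T : E n →ₗ[ℝ] E n, |LinearMap.det T| = 1 → Mstar K ≤ Mstar (T '' K)

/-- Positive definite symmetric linear map. -/
def IsPosDef (T : E n →ₗ[ℝ] E n) : Prop :=
  LinearMap.IsSymmetric T ∧ ∀ x : E n, x ≠ 0 → 0 < ⟪T x, x⟫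

/-- Operator norm (w.r.t. the Euclidean norm). -/
def opNorm (T : E n →ₗ[ℝ] E n) : ℝ := ‖LinearMap.toContinuousLinearMap T‖



/-- one-dimensional Brunn-Minkowski -/
theorem bm_one (A B C : Set ℝ) (hA : MeasurableSet A) (hB : MeasurableSet B)
    (hAn : A.Nonempty) (hBn : B.Nonempty) (hC : ∀ a ∈ A, ∀ b ∈ B, a + b ∈ C) :
    volume A + volume B ≤ volume C := by
  obtain ⟨a0, ha0⟩ := hAn
  obtain ⟨b0, hb0⟩ := hBn
  have tr : ∀ (c : ℝ) (S : Set ℝ), volume ((fun x => c + x) '' S) = volume S := by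
    intro c S
    rw [image_add_left]
    exact measure_preimage_add volume (-c) S
  have hcomp : ∀ A' ⊆ A, IsCompact A' → ∀ B' ⊆ B, IsCompact B' →
      volume A' + volume B' ≤ volume C := by
    intro A' hA' hcA B' hB' hcB
    rcases A'.eq_empty_or_nonempty with h | hne
    · subst h
      rw [measure_empty, zero_add, ← tr a0 B']
      apply measure_mono
      rintro _ ⟨x, hx, rfl⟩
      exact hC a0 ha0 x (hB' hx)
    rcases B'.eq_empty_or_nonempty with h | hne'
    · subst h
      rw [measure_empty, add_zero, ← tr b0 A']
      apply measure_mono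
      rintro _ ⟨x, hx, rfl⟩
      simp only [add_comm b0 x]
      exact hC x (hA' hx) b0 hb0
    have hM := hcA.sSup_mem hne
    have hm := hcB.sInf_mem hne'
    set M := sSup A'
    set m := sInf B'
    rw [← tr m A', ← tr M B']
    have hd : AEDisjoint volume ((fun x => m + x) '' A') ((fun x => M + x) '' B') := by
      have hsub : ((fun x => m + x) '' A') ∩ ((fun x => M + x) '' B') ⊆ {M + m} := by
        rintro z ⟨⟨x, hx, rfl⟩, ⟨y, hy, hxy⟩⟩
        have h1 : x ≤ M := le_csSup hcA.bddAbove hx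
        have h2 : m ≤ y := csInf_le hcB.bddBelow hy
        simp only at hxy ⊢
        rw [mem_singleton_iff]
        linarith
      exact measure_mono_null hsub (by simp)
    rw [← measure_union₀ (hcB.image (by fun_prop)).measurableSet.nullMeasurableSet hd]
    apply measure_mono
    rintro z (⟨x, hx, rfl⟩ | ⟨y, hy, rfl⟩)
    · simp only [add_comm m x]
      exact hC x (hA' hx) m (hB' hm)
    · exact hC M (hA' hM) y (hB' hy)
  rw [hA.measure_eq_iSup_isCompact volume, hB.measure_eq_iSup_isCompact volume]
  simp only [iSup_and']
  apply ENNReal.biSup_add_biSup_le' 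
  · exact ⟨∅, by simp⟩
  · exact ⟨∅, by simp⟩
  · rintro A' ⟨h1, h2⟩ B' ⟨h3, h4⟩
    exact hcomp A' h1 h2 B' h3 h4

theorem bm_one_scaled (l : ℝ) (hl : 0 < l) (hl1 : l < 1) (A B C : Set ℝ) (hA : MeasurableSet A)
    (hB : MeasurableSet B)
    (hAn : A.Nonempty) (hBn : B.Nonempty) (hC : ∀ a ∈ A, ∀ b ∈ B, (1 - l) * a + l * b ∈ C) :
    ENNReal.ofReal (1 - l) * volume A + ENNReal.ofReal l * volume B ≤ volume C := by
  have h := bm_one ((1 - l) • A) (l • B) C (hA.const_smul₀ _) (hB.const_smul₀ _)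
    hAn.smul_set hBn.smul_set (by
      rintro _ ⟨a, ha, rfl⟩ _ ⟨b, hb, rfl⟩
      exact hC a ha b hb)
  simpa [Measure.addHaar_smul, abs_of_pos hl, abs_of_pos (sub_pos.2 hl1)] using h

theorem pl_one_norm (l : ℝ) (hl : 0 < l) (hl1 : l < 1) (f g h : ℝ → ℝ)
    (hf : Measurable f) (hg : Measurable g) (hh : Measurable h)
    (f0 : ∀ x, 0 ≤ f x) (g0 : ∀ x, 0 ≤ g x) (h0 : ∀ x, 0 ≤ h x)
    (f1 : ∀ x, f x ≤ 1) (g1 : ∀ x, g x ≤ 1)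
    (fs : ∀ t < 1, ∃ x, t < f x) (gs : ∀ t < 1, ∃ x, t < g x)
    (hfg : ∀ x y, f x ^ (1 - l) * g y ^ l ≤ h ((1 - l) * x + l * y)) :
    ENNReal.ofReal (1 - l) * (∫⁻ x, ENNReal.ofReal (f x)) +
      ENNReal.ofReal l * (∫⁻ x, ENNReal.ofReal (g x)) ≤ ∫⁻ x, ENNReal.ofReal (h x) := by
  rw [lintegral_eq_lintegral_meas_lt volume (.of_forall f0) hf.aemeasurable,
    lintegral_eq_lintegral_meas_lt volume (.of_forall g0) hg.aemeasurable,
    lintegral_eq_lintegral_meas_lt volume (.of_forall h0) hh.aemeasurable]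
  have mf : ∀ F : ℝ → ℝ, Measurable (fun t => volume {a | t < F a}) := by
    intro F
    apply Antitone.measurable
    intro s t hst
    exact measure_mono (fun a (ha : t < F a) => lt_of_le_of_lt hst ha)
  rw [← lintegral_const_mul _ (mf f), ← lintegral_const_mul _ (mf g),
    ← lintegral_add_left ((mf f).const_mul _)]
  apply setLIntegral_mono (mf h)
  intro t ht
  have ht : 0 < t := ht
  rcases lt_or_ge t 1 with h1 | h1
  · apply bm_one_scaled l hl hl1 _ _ _ (measurableSet_lt measurable_const hf)
      (measurableSet_lt measurable_const hg) (fs t h1) (gs t h1)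
    intro a ha b hb
    refine lt_of_lt_of_le ?_ (hfg a b)
    have : t = t ^ (1 - l) * t ^ l := by
      rw [← rpow_add ht]; simp
    rw [this]
    have h1' : 0 < 1 - l := by linarith
    have ha : t < f a := ha
    have hb : t < g b := hb
    have hlt : t ^ (1 - l) < f a ^ (1 - l) := rpow_lt_rpow ht.le ha h1'
    have hlt2 : t ^ l < g b ^ l := rpow_lt_rpow ht.le hb hl
    exact mul_lt_mul'' hlt hlt2 (by positivity) (by positivity)
  · have e1 : {a | t < f a} = ∅ := by
      ext a; simp; exact (f1 a).trans h1
    have e2 : {a | t < g a} = ∅ := by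
      ext a; simp; exact (g1 a).trans h1
    simp [e1, e2]

theorem ennreal_amgm (l : ℝ) (hl : 0 < l) (hl1 : l < 1) (a b : ℝ≥0∞) :
    a ^ (1 - l) * b ^ l ≤ ENNReal.ofReal (1 - l) * a + ENNReal.ofReal l * b := by
  have h1 : 0 < 1 - l := by linarith
  have p1 : ENNReal.ofReal (1 - l) ≠ 0 := by simpa using h1
  have p2 : ENNReal.ofReal l ≠ 0 := by simpa using hl
  by_cases ha : a = ⊤
  · subst ha; simp [ENNReal.mul_top p1]
  by_cases hb : b = ⊤
  · subst hb; simp [ENNReal.mul_top p2]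
  lift a to NNReal using ha
  lift b to NNReal using hb
  rw [← ENNReal.coe_rpow_of_nonneg _ h1.le, ← ENNReal.coe_rpow_of_nonneg _ hl.le]
  have := NNReal.geom_mean_le_arith_mean2_weighted ⟨1 - l, h1.le⟩ ⟨l, hl.le⟩ a b (by
    apply NNReal.eq; show (1 - l) + l = 1; ring)
  rw [ENNReal.ofReal_eq_coe_nnreal h1.le, ENNReal.ofReal_eq_coe_nnreal hl.le]
  exact_mod_cast this

theorem pl_one_bdd (l : ℝ) (hl : 0 < l) (hl1 : l < 1) (f g h : ℝ → ℝ≥0∞)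
    (hf : Measurable f) (hg : Measurable g) (hh : Measurable h)
    (M : NNReal) (fM : ∀ x, f x ≤ M) (gM : ∀ x, g x ≤ M)
    (hfg : ∀ x y, f x ^ (1 - l) * g y ^ l ≤ h ((1 - l) * x + l * y)) :
    (∫⁻ x, f x) ^ (1 - l) * (∫⁻ x, g x) ^ l ≤ ∫⁻ x, h x := by
  have hl' : 0 < 1 - l := by linarith
  set a := ⨆ x, f x with ha
  set b := ⨆ x, g x with hb
  have fa : ∀ x, f x ≤ a := fun x => le_iSup f x
  have gb : ∀ x, g x ≤ b := fun x => le_iSup g x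
  have aT : a ≠ ⊤ := ne_top_of_le_ne_top ENNReal.coe_ne_top (iSup_le fM)
  have bT : b ≠ ⊤ := ne_top_of_le_ne_top ENNReal.coe_ne_top (iSup_le gM)
  by_cases a0 : a = 0
  · have : ∀ x, f x = 0 := fun x => by simpa [a0] using fa x
    simp [this, ENNReal.zero_rpow_of_pos hl']
  by_cases b0 : b = 0
  · have : ∀ x, g x = 0 := fun x => by simpa [b0] using gb x
    simp [this, ENNReal.zero_rpow_of_pos hl]
  set c := a ^ (1 - l) * b ^ l with hc
  have c0 : c ≠ 0 := by
    simp only [hc, ne_eq, mul_eq_zero, not_or]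
    exact ⟨by simp [ENNReal.rpow_eq_zero_iff, a0, aT], by simp [ENNReal.rpow_eq_zero_iff, b0, bT]⟩
  have cT : c ≠ ⊤ := ENNReal.mul_ne_top (ENNReal.rpow_ne_top_of_nonneg hl'.le aT)
    (ENNReal.rpow_ne_top_of_nonneg hl.le bT)
  have fle : ∀ x, f x / a ≤ 1 := fun x => ENNReal.div_le_of_le_mul (by simpa using fa x)
  have gle : ∀ x, g x / b ≤ 1 := fun x => ENNReal.div_le_of_le_mul (by simpa using gb x)
  have ft : ∀ x, f x / a ≠ ⊤ := fun x => ne_top_of_le_ne_top ENNReal.one_ne_top (fle x)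
  have gt : ∀ x, g x / b ≠ ⊤ := fun x => ne_top_of_le_ne_top ENNReal.one_ne_top (gle x)
  have ht : ∀ x, min (h x / c) 1 ≠ ⊤ := fun x => ne_top_of_le_ne_top ENNReal.one_ne_top (min_le_right _ _)
  have sup1 : ∀ (F : ℝ → ℝ≥0∞) (A : ℝ≥0∞), A = ⨆ x, F x → A ≠ 0 → A ≠ ⊤ →
      ∀ t < (1:ℝ), ∃ x, t < (F x / A).toReal := by
    intro F A hA hA0 hAT t ht
    rcases lt_or_ge t 0 with h0 | h0
    · exact ⟨0, lt_of_lt_of_le h0 ENNReal.toReal_nonneg⟩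
    have : ENNReal.ofReal t * A < A := by
      conv_rhs => rw [← one_mul A]
      exact ENNReal.mul_lt_mul_left hA0 hAT (by simpa using ht)
    have h2 : ENNReal.ofReal t * A < ⨆ x, F x := lt_of_lt_of_eq this hA
    obtain ⟨x, hx⟩ := lt_iSup_iff.1 h2
    refine ⟨x, ?_⟩
    have h3 : ENNReal.ofReal t < F x / A := by
      rwa [ENNReal.lt_div_iff_mul_lt (Or.inl hA0) (Or.inl hAT)]
    have hFA : F x / A ≠ ⊤ := by
      refine ne_top_of_le_ne_top ENNReal.one_ne_top (ENNReal.div_le_of_le_mul ?_)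
      rw [one_mul, hA]; exact le_iSup F x
    exact (ENNReal.ofReal_lt_iff_lt_toReal h0 hFA).1 h3
  have key := pl_one_norm l hl hl1 (fun x => (f x / a).toReal) (fun x => (g x / b).toReal)
    (fun x => (min (h x / c) 1).toReal) (by fun_prop) (by fun_prop) (by fun_prop)
    (fun _ => ENNReal.toReal_nonneg) (fun _ => ENNReal.toReal_nonneg) (fun _ => ENNReal.toReal_nonneg)
    (fun x => ENNReal.toReal_le_of_le_ofReal zero_le_one (by simpa using fle x))
    (fun x => ENNReal.toReal_le_of_le_ofReal zero_le_one (by simpa using gle x))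
    (sup1 f a ha a0 aT) (sup1 g b hb b0 bT) (by
      intro x y
      rw [ENNReal.toReal_rpow, ENNReal.toReal_rpow, ← ENNReal.toReal_mul]
      apply ENNReal.toReal_mono (ht _)
      apply le_min
      · rw [ENNReal.div_rpow_of_nonneg _ _ hl'.le, ENNReal.div_rpow_of_nonneg _ _ hl.le]
        rw [ENNReal.le_div_iff_mul_le (Or.inl c0) (Or.inl cT)]
        refine le_trans (le_of_eq ?_) (hfg x y)
        rw [hc, div_eq_mul_inv, div_eq_mul_inv]
        have i1 : (a ^ (1 - l))⁻¹ * a ^ (1 - l) = 1 := ENNReal.inv_mul_cancel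
          (by simp [ENNReal.rpow_eq_zero_iff, a0, aT]) (ENNReal.rpow_ne_top_of_nonneg hl'.le aT)
        have i2 : (b ^ l)⁻¹ * b ^ l = 1 := ENNReal.inv_mul_cancel
          (by simp [ENNReal.rpow_eq_zero_iff, b0, bT]) (ENNReal.rpow_ne_top_of_nonneg hl.le bT)
        calc _ = f x ^ (1 - l) * g y ^ l * ((a ^ (1 - l))⁻¹ * a ^ (1 - l)) * ((b ^ l)⁻¹ * b ^ l) := by ring
          _ = _ := by rw [i1, i2]; simp
      · exact mul_le_one' (ENNReal.rpow_le_one (fle x) hl'.le) (ENNReal.rpow_le_one (gle y) hl.le))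
  simp only [ENNReal.ofReal_toReal (ft _), ENNReal.ofReal_toReal (gt _), ENNReal.ofReal_toReal (ht _)] at key
  have k2 : ∫⁻ x, min (h x / c) 1 ≤ (∫⁻ x, h x) / c := by
    rw [div_eq_mul_inv, ← lintegral_mul_const _ hh]
    exact lintegral_mono (fun x => min_le_left _ _)
  have k3 := (ennreal_amgm l hl hl1 (∫⁻ x, f x / a) (∫⁻ x, g x / b)).trans (key.trans k2)
  simp only [div_eq_mul_inv] at k3
  rw [lintegral_mul_const _ hf, lintegral_mul_const _ hg, ← div_eq_mul_inv (∫⁻ x, h x),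
    ENNReal.le_div_iff_mul_le (Or.inl c0) (Or.inl cT), ENNReal.mul_rpow_of_nonneg _ _ hl'.le,
    ENNReal.mul_rpow_of_nonneg _ _ hl.le, ENNReal.inv_rpow, ENNReal.inv_rpow] at k3
  refine le_trans (le_of_eq ?_) k3
  have i1 : (a ^ (1 - l))⁻¹ * a ^ (1 - l) = 1 := ENNReal.inv_mul_cancel
          (by simp [ENNReal.rpow_eq_zero_iff, a0, aT]) (ENNReal.rpow_ne_top_of_nonneg hl'.le aT)
  have i2 : (b ^ l)⁻¹ * b ^ l = 1 := ENNReal.inv_mul_cancel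
          (by simp [ENNReal.rpow_eq_zero_iff, b0, bT]) (ENNReal.rpow_ne_top_of_nonneg hl.le bT)
  symm
  calc _ = (∫⁻ x, f x) ^ (1 - l) * (∫⁻ x, g x) ^ l * ((a ^ (1 - l))⁻¹ * a ^ (1 - l)) * ((b ^ l)⁻¹ * b ^ l) := by
        rw [hc]; ring
    _ = _ := by rw [i1, i2]; simp

theorem pl_one (l : ℝ) (hl : 0 < l) (hl1 : l < 1) (f g h : ℝ → ℝ≥0∞)
    (hf : Measurable f) (hg : Measurable g) (hh : Measurable h)
    (hfg : ∀ x y, f x ^ (1 - l) * g y ^ l ≤ h ((1 - l) * x + l * y)) :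
    (∫⁻ x, f x) ^ (1 - l) * (∫⁻ x, g x) ^ l ≤ ∫⁻ x, h x := by
  have hl' : 0 < 1 - l := by linarith
  have tend : ∀ F : ℝ → ℝ≥0∞, Measurable F → Filter.Tendsto (fun M : ℕ => ∫⁻ x, min (F x) (M : ℝ≥0∞))
      Filter.atTop (nhds (∫⁻ x, F x)) := by
    intro F hF
    apply lintegral_tendsto_of_tendsto_of_monotone
    · intro M; exact (hF.min measurable_const).aemeasurable
    · refine .of_forall fun x => ?_
      intro m m' hm
      exact min_le_min le_rfl (by exact_mod_cast hm)
    · refine .of_forall fun x => ?_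
      have : Filter.Tendsto (fun M : ℕ => min (F x) (M : ℝ≥0∞)) Filter.atTop (nhds (min (F x) ⊤)) :=
        Filter.Tendsto.min tendsto_const_nhds ENNReal.tendsto_nat_nhds_top
      simpa using this
  by_cases f0 : ∫⁻ x, f x = 0
  · simp [f0, ENNReal.zero_rpow_of_pos hl']
  by_cases g0 : ∫⁻ x, g x = 0
  · simp [g0, ENNReal.zero_rpow_of_pos hl]
  have t1 := ((ENNReal.continuous_rpow_const (y := 1 - l)).tendsto _).comp (tend f hf)
  have t2 := ((ENNReal.continuous_rpow_const (y := l)).tendsto _).comp (tend g hg)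
  have t3 := ENNReal.Tendsto.mul t1 (Or.inl (by simp [ENNReal.rpow_eq_zero_iff, f0, hl'.not_gt]; try grind))
    t2 (Or.inl (by simp [ENNReal.rpow_eq_zero_iff, g0, hl.not_gt]; try grind))
  refine le_of_tendsto' t3 fun M => ?_
  apply pl_one_bdd l hl hl1 _ _ h (hf.min measurable_const) (hg.min measurable_const) hh (M : NNReal)
  · intro x; exact_mod_cast min_le_right _ _
  · intro x; exact_mod_cast min_le_right _ _
  · intro x y
    refine le_trans ?_ (hfg x y)
    gcongr <;> exact min_le_left _ _

theorem pl_pi (l : ℝ) (hl : 0 < l) (hl1 : l < 1) : ∀ (n : ℕ) (f g h : (Fin n → ℝ) → ℝ≥0∞)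
    (_ : Measurable f) (_ : Measurable g) (_ : Measurable h)
    (_ : ∀ x y, f x ^ (1 - l) * g y ^ l ≤ h ((1 - l) • x + l • y)),
    (∫⁻ x, f x) ^ (1 - l) * (∫⁻ x, g x) ^ l ≤ ∫⁻ x, h x := by
  intro n
  induction n with
  | zero =>
    intro f g h hf hg hh hfg
    simp only [lintegral_unique]
    have hv : (volume : Measure (Fin 0 → ℝ)) univ = 1 := by
      simp [volume_pi]
    rw [hv]
    simp only [mul_one]
    convert hfg default default
    
  | succ n ih =>
    intro f g h hf hg hh hfg
    have mp := (volume_preserving_piFinSuccAbove (fun _ : Fin (n+1) => ℝ) 0).symm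
    have conv : ∀ F : (Fin (n+1) → ℝ) → ℝ≥0∞, Measurable F →
        ∫⁻ x, F x = ∫⁻ t : ℝ, ∫⁻ z : Fin n → ℝ, F ((MeasurableEquiv.piFinSuccAbove (fun _ => ℝ) 0).symm (t, z)) := by
      intro F hF
      rw [← mp.lintegral_comp hF, Measure.volume_eq_prod, lintegral_prod]
      · exact (hF.comp mp.measurable).aemeasurable
    have meas : ∀ F : (Fin (n+1) → ℝ) → ℝ≥0∞, Measurable F →
        Measurable (fun q : ℝ × (Fin n → ℝ) => F ((MeasurableEquiv.piFinSuccAbove (fun _ => ℝ) 0).symm q)) := by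
      intro F hF
      exact hF.comp mp.measurable
    rw [conv f hf, conv g hg, conv h hh]
    apply pl_one l hl hl1 _ _ _ (meas f hf).lintegral_prod_right' (meas g hg).lintegral_prod_right'
      (meas h hh).lintegral_prod_right'
    intro s t
    apply ih
    · exact (meas f hf).comp (measurable_const.prodMk measurable_id)
    · exact (meas g hg).comp (measurable_const.prodMk measurable_id)
    · exact (meas h hh).comp (measurable_const.prodMk measurable_id)
    · intro x y
      refine le_trans (hfg _ _) (le_of_eq ?_)
      congr 1
      ext i
      refine Fin.cases ?_ (fun j => ?_) i <;> simp [MeasurableEquiv.piFinSuccAbove]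

/-- Prekopa-Leindler inequality -/
theorem prekopa_leindler {n : ℕ} (l : ℝ) (hl : 0 < l) (hl1 : l < 1) (f g h : E n → ℝ≥0∞)
    (hf : Measurable f) (hg : Measurable g) (hh : Measurable h)
    (hfg : ∀ x y, f x ^ (1 - l) * g y ^ l ≤ h ((1 - l) • x + l • y)) :
    (∫⁻ x, f x) ^ (1 - l) * (∫⁻ x, g x) ^ l ≤ ∫⁻ x, h x := by
  have mp' : MeasurePreserving (fun x : Fin n → ℝ => (WithLp.toLp 2 x : E n)) volume volume :=
    PiLp.volume_preserving_toLp (Fin n)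
  rw [← mp'.lintegral_comp hf, ← mp'.lintegral_comp hg, ← mp'.lintegral_comp hh]
  apply pl_pi l hl hl1
  · exact hf.comp mp'.measurable
  · exact hg.comp mp'.measurable
  · exact hh.comp mp'.measurable
  · intro x y
    exact hfg _ _



def ind (M : Set (E n)) : E n → ℝ := M.indicator (fun _ => 1)

theorem ind_nonneg (M : Set (E n)) (x : E n) : 0 ≤ ind M x := by
  unfold ind; exact indicator_nonneg (fun _ _ => zero_le_one) x

theorem ind_le_one (M : Set (E n)) (x : E n) : ind M x ≤ 1 := by
  unfold ind; exact indicator_le' (fun _ _ => le_rfl) (fun _ _ => zero_le_one) x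

/-- weighted integral over K -/
def ex (K : Set (E n)) (w φ : E n → ℝ) : ℝ := ∫ x in K, w x * φ x

/-- bounded measurable functions on K -/
def Adm (K : Set (E n)) (φ : E n → ℝ) : Prop :=
  AEStronglyMeasurable φ (volume.restrict K) ∧ ∃ M, ∀ x ∈ K, |φ x| ≤ M

section
variable {K : Set (E n)}

theorem Adm.const (c : ℝ) : Adm K (fun _ => c) :=
  ⟨aestronglyMeasurable_const, |c|, fun _ _ => le_rfl⟩

theorem Adm.add {φ ψ : E n → ℝ} (h1 : Adm K φ) (h2 : Adm K ψ) : Adm K (fun x => φ x + ψ x) := by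
  obtain ⟨a1, M1, b1⟩ := h1
  obtain ⟨a2, M2, b2⟩ := h2
  exact ⟨a1.add a2, M1 + M2, fun x hx => (abs_add_le _ _).trans (add_le_add (b1 x hx) (b2 x hx))⟩

theorem Adm.mul {φ ψ : E n → ℝ} (h1 : Adm K φ) (h2 : Adm K ψ) : Adm K (fun x => φ x * ψ x) := by
  obtain ⟨a1, M1, b1⟩ := h1
  obtain ⟨a2, M2, b2⟩ := h2
  refine ⟨a1.mul a2, M1 * M2, fun x hx => ?_⟩
  rw [abs_mul]
  exact mul_le_mul (b1 x hx) (b2 x hx) (abs_nonneg _) ((abs_nonneg _).trans (b1 x hx))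

theorem Adm.smul {φ : E n → ℝ} (c : ℝ) (h1 : Adm K φ) : Adm K (fun x => c * φ x) :=
  (Adm.const c).mul h1

theorem Adm.neg {φ : E n → ℝ} (h1 : Adm K φ) : Adm K (fun x => - φ x) := by
  simpa using h1.smul (-1)

theorem Adm.sub {φ ψ : E n → ℝ} (h1 : Adm K φ) (h2 : Adm K ψ) : Adm K (fun x => φ x - ψ x) := by
  simpa [sub_eq_add_neg] using h1.add h2.neg

theorem Adm.pow {φ : E n → ℝ} (h1 : Adm K φ) (k : ℕ) : Adm K (fun x => φ x ^ k) := by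
  induction k with
  | zero => simpa using Adm.const (K := K) 1
  | succ k ih => simpa [pow_succ] using ih.mul h1

theorem Adm.sum {ι : Type*} {s : Finset ι} {φ : ι → E n → ℝ} (h : ∀ i ∈ s, Adm K (φ i)) :
    Adm K (fun x => ∑ i ∈ s, φ i x) := by
  classical
  induction s using Finset.induction_on with
  | empty => simpa using Adm.const (K := K) 0
  | insert a s ha ih =>
    simp only [Finset.sum_insert ha]
    exact (h a (by simp)).add (ih fun i hi => h i (by simp [hi]))

theorem Adm.ofCont (hK : IsCompact K) {φ : E n → ℝ} (h : Continuous φ) : Adm K φ := by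
  refine ⟨h.aestronglyMeasurable, ?_⟩
  obtain ⟨M, hM⟩ := hK.exists_bound_of_continuousOn h.continuousOn
  exact ⟨M, hM⟩

theorem Adm.ind {M : Set (E n)} (hM : MeasurableSet M) : Adm K (ind M) := by
  refine ⟨(measurable_const.indicator hM).aestronglyMeasurable, 1, fun x _ => ?_⟩
  rw [abs_of_nonneg (ind_nonneg M x)]; exact ind_le_one M x

theorem Adm.integrable (hK : IsCompact K) {φ : E n → ℝ} (h : Adm K φ) : IntegrableOn φ K := by
  obtain ⟨a, M, b⟩ := h
  have : IsFiniteMeasure (volume.restrict K) := ⟨by simpa using hK.measure_lt_top⟩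
  exact Integrable.of_bound a M ((ae_restrict_iff' hK.measurableSet).2 (.of_forall b))

theorem ex_add (hK : IsCompact K) {w φ ψ : E n → ℝ} (hw : Adm K w) (h1 : Adm K φ) (h2 : Adm K ψ) :
    ex K w (fun x => φ x + ψ x) = ex K w φ + ex K w ψ := by
  unfold ex
  rw [← integral_add ((hw.mul h1).integrable hK) ((hw.mul h2).integrable hK)]
  simp only [mul_add]

theorem ex_smul (c : ℝ) (w φ : E n → ℝ) :
    ex K w (fun x => c * φ x) = c * ex K w φ := by
  unfold ex
  rw [← integral_const_mul]
  congr 1; ext x; ring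

theorem ex_sub (hK : IsCompact K) {w φ ψ : E n → ℝ} (hw : Adm K w) (h1 : Adm K φ) (h2 : Adm K ψ) :
    ex K w (fun x => φ x - ψ x) = ex K w φ - ex K w ψ := by
  unfold ex
  rw [← integral_sub ((hw.mul h1).integrable hK) ((hw.mul h2).integrable hK)]
  simp only [mul_sub]

theorem ex_sum (hK : IsCompact K) {ι : Type*} {s : Finset ι} {w : E n → ℝ} {φ : ι → E n → ℝ}
    (hw : Adm K w) (h : ∀ i ∈ s, Adm K (φ i)) :
    ex K w (fun x => ∑ i ∈ s, φ i x) = ∑ i ∈ s, ex K w (φ i) := by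
  unfold ex
  simp only [Finset.mul_sum]
  rw [integral_finsetSum]
  intro i hi
  exact (hw.mul (h i hi)).integrable hK

theorem ex_congr (hK : IsCompact K) {w φ ψ : E n → ℝ} (h : ∀ x ∈ K, φ x = ψ x) :
    ex K w φ = ex K w ψ := by
  unfold ex
  apply setIntegral_congr_fun hK.measurableSet
  intro x hx
  simp only [h x hx]

theorem ex_mono (hK : IsCompact K) {w φ ψ : E n → ℝ} (hw : Adm K w) (h0 : ∀ x ∈ K, 0 ≤ w x)
    (h1 : Adm K φ) (h2 : Adm K ψ) (h : ∀ x ∈ K, φ x ≤ ψ x) :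
    ex K w φ ≤ ex K w ψ := by
  unfold ex
  apply setIntegral_mono_on ((hw.mul h1).integrable hK) ((hw.mul h2).integrable hK) hK.measurableSet
  intro x hx
  exact mul_le_mul_of_nonneg_left (h x hx) (h0 x hx)

theorem ex_nonneg (hK : IsCompact K) {w φ : E n → ℝ} (h0 : ∀ x ∈ K, 0 ≤ w x)
    (h : ∀ x ∈ K, 0 ≤ φ x) : 0 ≤ ex K w φ := by
  unfold ex
  apply setIntegral_nonneg hK.measurableSet
  intro x hx
  exact mul_nonneg (h0 x hx) (h x hx)

theorem ex_cs (hK : IsCompact K) {w φ ψ : E n → ℝ} (hw : Adm K w) (h0 : ∀ x ∈ K, 0 ≤ w x)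
    (h1 : Adm K φ) (h2 : Adm K ψ) :
    (ex K w (fun x => φ x * ψ x)) ^ 2 ≤ ex K w (fun x => φ x ^ 2) * ex K w (fun x => ψ x ^ 2) := by
  have key : ∀ s t : ℝ, 0 ≤ s ^ 2 * ex K w (fun x => φ x ^ 2) - 2 * s * t * ex K w (fun x => φ x * ψ x)
      + t ^ 2 * ex K w (fun x => ψ x ^ 2) := by
    intro s t
    have := ex_nonneg hK (w := w) (φ := fun x => (s * φ x - t * ψ x) ^ 2) h0 (fun x _ => sq_nonneg _)
    rw [← ex_smul, ← ex_smul, ← ex_smul, ← ex_sub hK hw ((h1.pow 2).smul _) ((h1.mul h2).smul _),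
      ← ex_add hK hw (((h1.pow 2).smul _).sub ((h1.mul h2).smul _)) ((h2.pow 2).smul _)]
    refine this.trans_eq ?_
    congr 1; ext x; ring
  set a := ex K w (fun x => φ x ^ 2)
  set b := ex K w (fun x => φ x * ψ x)
  set c := ex K w (fun x => ψ x ^ 2)
  have ha : 0 ≤ a := ex_nonneg hK h0 (fun x _ => sq_nonneg _)
  have hc : 0 ≤ c := ex_nonneg hK h0 (fun x _ => sq_nonneg _)
  rcases hc.eq_or_lt with h | h
  · have hb : b = 0 := by
      by_contra hb
      have := key b ((a + 1) / 2)
      rw [← h] at this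
      have hb2 : 0 < b ^ 2 := by positivity
      nlinarith
    rw [hb]; simp [← h]
  · have := key c b
    have h3 : 0 ≤ c * (a * c - b ^ 2) := by nlinarith
    have := nonneg_of_mul_nonneg_right h3 h
    linarith

theorem lint_ind (hK : IsCompact K) {w : E n → ℝ} (hw : Continuous w) (h0 : ∀ x ∈ K, 0 ≤ w x)
    {M : Set (E n)} (hM : MeasurableSet M) :
    ∫⁻ x, (M ∩ K).indicator (fun x => ENNReal.ofReal (w x)) x = ENNReal.ofReal (ex K w (ind M)) := by
  unfold ex
  rw [ofReal_integral_eq_lintegral_ofReal (((Adm.ofCont hK hw).mul (Adm.ind hM)).integrable hK)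
    ((ae_restrict_iff' hK.measurableSet).2 (.of_forall fun x hx => mul_nonneg (h0 x hx) (ind_nonneg _ _)))]
  rw [← lintegral_indicator hK.measurableSet]
  congr 1; ext x
  by_cases h1 : x ∈ K <;> by_cases h2 : x ∈ M <;> simp [h1, h2, ind]

theorem pl_ex (hK : IsCompact K) {w : E n → ℝ} (hw : Continuous w) (h0 : ∀ x ∈ K, 0 ≤ w x)
    {A B C : Set (E n)} (hA : MeasurableSet A) (hB : MeasurableSet B) (hC : MeasurableSet C)
    (l θ : ℝ) (hl : 0 < l) (hl1 : l < 1) (hθ : 0 ≤ θ)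
    (h : ∀ x ∈ A, x ∈ K → ∀ y ∈ B, y ∈ K → (1 - l) • x + l • y ∈ C ∧ (1 - l) • x + l • y ∈ K ∧
      w x ^ (1 - l) * w y ^ l ≤ θ * w ((1 - l) • x + l • y)) :
    (ex K w (ind A)) ^ (1 - l) * (ex K w (ind B)) ^ l ≤ θ * ex K w (ind C) := by
  have hl' : 0 < 1 - l := by linarith
  have e0 : ∀ M, 0 ≤ ex K w (ind M) := fun M => ex_nonneg hK h0 (fun x _ => ind_nonneg M x)
  have mw : Measurable (fun x => ENNReal.ofReal (w x)) := by fun_prop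
  have key := prekopa_leindler l hl hl1 ((A ∩ K).indicator (fun x => ENNReal.ofReal (w x)))
    ((B ∩ K).indicator (fun x => ENNReal.ofReal (w x)))
    (fun z => ENNReal.ofReal θ * (C ∩ K).indicator (fun x => ENNReal.ofReal (w x)) z)
    (mw.indicator (hA.inter hK.measurableSet)) (mw.indicator (hB.inter hK.measurableSet))
    ((mw.indicator (hC.inter hK.measurableSet)).const_mul _) (by
      intro x y
      by_cases hx : x ∈ A ∩ K
      swap
      · rw [indicator_of_notMem hx, ENNReal.zero_rpow_of_pos hl', zero_mul]; exact zero_le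
      by_cases hy : y ∈ B ∩ K
      swap
      · rw [indicator_of_notMem hy, ENNReal.zero_rpow_of_pos hl, mul_zero]; exact zero_le
      obtain ⟨h1, h2, h3⟩ := h x hx.1 hx.2 y hy.1 hy.2
      rw [indicator_of_mem hx, indicator_of_mem hy, indicator_of_mem (show (1 - l) • x + l • y ∈ C ∩ K from ⟨h1, h2⟩),
        ENNReal.ofReal_rpow_of_nonneg (h0 x hx.2) hl'.le, ENNReal.ofReal_rpow_of_nonneg (h0 y hy.2) hl.le,
        ← ENNReal.ofReal_mul (rpow_nonneg (h0 x hx.2) _), ← ENNReal.ofReal_mul hθ]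
      exact ENNReal.ofReal_le_ofReal h3)
  rw [lintegral_const_mul _ (mw.indicator (hC.inter hK.measurableSet)), lint_ind hK hw h0 hA,
    lint_ind hK hw h0 hB, lint_ind hK hw h0 hC, ENNReal.ofReal_rpow_of_nonneg (e0 _) hl'.le,
    ENNReal.ofReal_rpow_of_nonneg (e0 _) hl.le, ← ENNReal.ofReal_mul (rpow_nonneg (e0 _) _),
    ← ENNReal.ofReal_mul hθ] at key
  exact (ENNReal.ofReal_le_ofReal_iff (mul_nonneg hθ (e0 _))).1 key

end

/-- log-concave probability density on `K` -/
structure LC (K : Set (E n)) (w : E n → ℝ) : Prop where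
  cont : Continuous w
  nonneg : ∀ x ∈ K, 0 ≤ w x
  one : ex K w (fun _ => 1) = 1
  lc : ∀ x ∈ K, ∀ y ∈ K, ∀ l : ℝ, 0 < l → l < 1 → w x ^ (1 - l) * w y ^ l ≤ w ((1 - l) • x + l • y)

section
variable {K : Set (E n)} {w : E n → ℝ}

theorem LC.adm (hw : LC K w) (hK : IsCompact K) : Adm K w := Adm.ofCont hK hw.cont

theorem LC.ex_const (hw : LC K w) (c : ℝ) : ex K w (fun _ => c) = c := by
  have := ex_smul (K := K) c w (fun _ => 1)
  simpa [hw.one] using this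

theorem ind_compl (M : Set (E n)) (x : E n) : ind Mᶜ x = 1 - ind M x := by
  unfold ind; by_cases h : x ∈ M <;> simp [h]

theorem LC.compl (hw : LC K w) (hK : IsCompact K) {M : Set (E n)} (hM : MeasurableSet M) :
    ex K w (ind Mᶜ) = 1 - ex K w (ind M) := by
  rw [← hw.one, ← ex_sub hK (hw.adm hK) (Adm.const 1) (Adm.ind hM)]
  congr 1; ext x; exact ind_compl M x

theorem LC.le_one (hw : LC K w) (hK : IsCompact K) {M : Set (E n)} (hM : MeasurableSet M) :
    ex K w (ind M) ≤ 1 := by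
  rw [← hw.one]
  exact ex_mono hK (hw.adm hK) hw.nonneg (Adm.ind hM) (Adm.const 1) (fun x _ => ind_le_one M x)

theorem borell_tail (hK : IsCompact K) (hc : Convex ℝ K) (hw : LC K w) (N : Seminorm ℝ (E n))
    (hN : Continuous N) (a : E n) (σ : ℝ) (hσ : 0 < σ)
    (h2 : ex K w (fun x => N (x - a) ^ 2) ≤ σ ^ 2) (t : ℝ) (ht : 1 < t) :
    ex K w (ind {x | 2 * σ * t < N (x - a)}) ≤ (1 / 3) ^ (t / 2) := by
  have hcont : Continuous (fun x => N (x - a)) := hN.comp (by fun_prop)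
  have mB : MeasurableSet {x | 2 * σ < N (x - a)} := measurableSet_lt measurable_const hcont.measurable
  have mA : MeasurableSet {x | 2 * σ * t < N (x - a)} := measurableSet_lt measurable_const hcont.measurable
  set B := {x | 2 * σ < N (x - a)} with hB
  set A := {x | 2 * σ * t < N (x - a)} with hA
  have cheb : ex K w (ind B) ≤ 1 / 4 := by
    have : ex K w (ind B) ≤ ex K w (fun x => (1 / (4 * σ ^ 2)) * N (x - a) ^ 2) := by
      apply ex_mono hK (hw.adm hK) hw.nonneg (Adm.ind mB) (((Adm.ofCont hK hcont).pow 2).smul _)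
      intro x _
      by_cases hx : x ∈ B
      · have hx' : 2 * σ < N (x - a) := hx
        simp only [ind, indicator_of_mem hx]
        rw [one_div, inv_mul_eq_div, le_div_iff₀ (by positivity)]
        nlinarith
      · simp only [ind, indicator_of_notMem hx]
        positivity
    rw [ex_smul] at this
    refine this.trans ?_
    rw [one_div, inv_mul_eq_div, div_le_iff₀ (by positivity)]
    linarith
  set l := 2 / (t + 1) with hl
  have l0 : 0 < l := by positivity
  have l1 : l < 1 := by rw [hl, div_lt_one (by linarith)]; linarith
  have key := pl_ex hK hw.cont hw.nonneg (A := Bᶜ) (B := A) (C := B) mB.compl mA mB l 1 l0 l1 zero_le_one (by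
    intro x hx hxK y hy hyK
    refine ⟨?_, hc hxK hyK (by linarith) l0.le (by ring), by rw [one_mul]; exact hw.lc x hxK y hyK l l0 l1⟩
    have hx' : N (x - a) ≤ 2 * σ := not_lt.1 hx
    have hy' : 2 * σ * t < N (y - a) := hy
    show 2 * σ < N _
    have e : y - a = ((t + 1) / 2) • ((1 - l) • x + l • y - a) - ((t - 1) / 2) • (x - a) := by
      have h1 : (t + 1) / 2 * l = 1 := by rw [hl]; field_simp
      have h2 : (t + 1) / 2 * (1 - l) = (t - 1) / 2 := by rw [mul_sub, h1]; ring
      rw [smul_sub, smul_add, smul_smul, smul_smul, h1, h2, smul_sub, one_smul]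
      have : (t + 1) / 2 = (t - 1) / 2 + 1 := by ring
      rw [this, add_smul, one_smul]; abel
    have h3 : N (y - a) ≤ (t + 1) / 2 * N ((1 - l) • x + l • y - a) + (t - 1) / 2 * N (x - a) := by
      conv_lhs => rw [e]
      refine (map_sub_le_add N _ _).trans ?_
      rw [map_smul_eq_mul, map_smul_eq_mul, Real.norm_of_nonneg (by linarith), Real.norm_of_nonneg (by linarith)]
    by_contra hcon
    have hcon := not_lt.1 hcon
    nlinarith)
  rw [one_mul, hw.compl hK mB] at key
  set b := ex K w (ind B)
  set A' := ex K w (ind A)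
  have hA0 : 0 ≤ A' := ex_nonneg hK hw.nonneg (fun x _ => ind_nonneg _ x)
  have hb0 : 0 ≤ b := ex_nonneg hK hw.nonneg (fun x _ => ind_nonneg _ x)
  have h34 : (3 / 4 : ℝ) ^ (1 - l) * A' ^ l ≤ 1 / 4 := by
    refine le_trans ?_ (key.trans cheb)
    apply mul_le_mul_of_nonneg_right _ (rpow_nonneg hA0 _)
    exact rpow_le_rpow (by norm_num) (by linarith) (by linarith)
  have h35 : A' ^ l ≤ 1 / 3 := by
    have : (3 / 4 : ℝ) ^ (1 : ℝ) ≤ (3 / 4 : ℝ) ^ (1 - l) :=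
      rpow_le_rpow_of_exponent_ge (by norm_num) (by norm_num) (by linarith)
    rw [rpow_one] at this
    have h4 : 0 ≤ A' ^ l := rpow_nonneg hA0 _
    nlinarith
  have h36 : A' = (A' ^ l) ^ ((t + 1) / 2) := by
    rw [← rpow_mul hA0]
    have : l * ((t + 1) / 2) = 1 := by rw [hl]; field_simp
    rw [this, rpow_one]
  rw [h36]
  calc (A' ^ l) ^ ((t + 1) / 2) ≤ (1 / 3 : ℝ) ^ ((t + 1) / 2) :=
        rpow_le_rpow (rpow_nonneg hA0 _) h35 (by linarith)
    _ ≤ _ := rpow_le_rpow_of_exponent_ge (by norm_num) (by norm_num) (by linarith)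

theorem borell_exp (hK : IsCompact K) (hc : Convex ℝ K) (hw : LC K w) (N : Seminorm ℝ (E n))
    (hN : Continuous N) (a : E n) (σ : ℝ) (hσ : 0 < σ)
    (h2 : ex K w (fun x => N (x - a) ^ 2) ≤ σ ^ 2) :
    ex K w (fun x => Real.exp (N (x - a) / (8 * σ))) ≤ 9 := by
  have hcont : Continuous (fun x => N (x - a)) := hN.comp (by fun_prop)
  obtain ⟨M, hM⟩ := hK.exists_bound_of_continuousOn hcont.continuousOn
  obtain ⟨J, hJ⟩ := exists_nat_ge (M / (2 * σ))
  have mA : ∀ t : ℝ, MeasurableSet {x | 2 * σ * t < N (x - a)} :=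
    fun t => measurableSet_lt measurable_const hcont.measurable
  have q1 : Real.exp (1 / 4) ≤ 1.3 := by
    have h := Real.exp_one_lt_d9
    have h4 : Real.exp (1 / 4) ^ 4 = Real.exp 1 := by rw [← Real.exp_nat_mul]; norm_num
    by_contra hcon
    push Not at hcon
    have : (1.3 : ℝ) ^ 4 < Real.exp (1 / 4) ^ 4 := pow_lt_pow_left₀ hcon (by norm_num) (by norm_num)
    rw [h4] at this
    norm_num at this h
    linarith
  have q2 : (1 / 3 : ℝ) ^ (1 / 2 : ℝ) ≤ 0.578 := by
    rw [← Real.sqrt_eq_rpow]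
    rw [Real.sqrt_le_left (by norm_num)]; norm_num
  have tail : ∀ j : ℕ, ex K w (ind {x | 2 * σ * (j + 1 : ℝ) < N (x - a)}) ≤ 0.578 ^ j := by
    intro j
    rcases Nat.eq_zero_or_pos j with h | h
    · subst h; rw [pow_zero]; exact hw.le_one hK (mA _)
    · have hj : (1 : ℝ) ≤ j := by exact_mod_cast h
      refine (borell_tail hK hc hw N hN a σ hσ h2 (j + 1) (by linarith)).trans ?_
      calc (1 / 3 : ℝ) ^ (((j : ℝ) + 1) / 2) ≤ (1 / 3 : ℝ) ^ ((1 / 2 : ℝ) * j) :=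
            rpow_le_rpow_of_exponent_ge (by norm_num) (by norm_num) (by linarith)
        _ = ((1 / 3 : ℝ) ^ (1 / 2 : ℝ)) ^ j := by rw [rpow_mul (by norm_num), rpow_natCast]
        _ ≤ _ := pow_le_pow_left₀ (by positivity) q2 j
  have bd : ex K w (fun x => Real.exp (N (x - a) / (8 * σ))) ≤
      ex K w (fun x => 1.3 + ∑ j ∈ Finset.range J, (1.3 ^ (j + 2) : ℝ) *
        ind {x | 2 * σ * (j + 1 : ℝ) < N (x - a)} x) := by
    apply ex_mono hK (hw.adm hK) hw.nonneg (Adm.ofCont hK (by fun_prop))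
    · exact (Adm.const _).add (Adm.sum fun j _ => (Adm.ind (mA _)).smul _)
    intro x hx
    have hexp : ∀ j : ℕ, N (x - a) ≤ 2 * σ * j → Real.exp (N (x - a) / (8 * σ)) ≤ 1.3 ^ j := by
      intro j hj
      calc Real.exp (N (x - a) / (8 * σ)) ≤ Real.exp (j * (1 / 4)) := by
            apply Real.exp_le_exp.2
            rw [div_le_iff₀ (by positivity)]; linarith
        _ = Real.exp (1 / 4) ^ j := Real.exp_nat_mul _ _
        _ ≤ _ := pow_le_pow_left₀ (Real.exp_pos _).le q1 j
    have hterm : ∀ j ∈ Finset.range J, (0:ℝ) ≤ (1.3 ^ (j + 2) : ℝ) *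
        ind {x | 2 * σ * (j + 1 : ℝ) < N (x - a)} x :=
      fun j _ => mul_nonneg (by positivity) (ind_nonneg _ _)
    by_cases h1 : N (x - a) ≤ 2 * σ
    · have := hexp 1 (by simpa using h1)
      have := Finset.sum_nonneg hterm
      norm_num at *; linarith
    · push Not at h1
      have hex : ∃ j : ℕ, N (x - a) ≤ 2 * σ * j := by
        refine ⟨J, ?_⟩
        have h5 := hM x hx
        rw [Real.norm_of_nonneg (apply_nonneg N _)] at h5
        rw [div_le_iff₀ (by positivity)] at hJ
        linarith
      classical
      obtain ⟨j, hj, hmin⟩ : ∃ j : ℕ, N (x - a) ≤ 2 * σ * j ∧ ∀ i < j, ¬ (N (x - a) ≤ 2 * σ * i) :=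
        ⟨Nat.find hex, Nat.find_spec hex, fun i hi => Nat.find_min hex hi⟩
      have hj2 : 2 ≤ j := by
        by_contra hcon
        have : (j : ℝ) ≤ 1 := by exact_mod_cast (by omega : j ≤ 1)
        nlinarith
      have hjJ : j ≤ J := by
        by_contra hcon
        apply hmin J (by omega)
        have h5 := hM x hx
        rw [Real.norm_of_nonneg (apply_nonneg N _)] at h5
        rw [div_le_iff₀ (by positivity)] at hJ
        linarith
      obtain ⟨i, rfl⟩ : ∃ i, j = i + 2 := ⟨j - 2, by omega⟩
      have hm := not_le.1 (hmin (i + 1) (by omega))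
      have hmem : x ∈ {x | 2 * σ * (i + 1 : ℝ) < N (x - a)} := by
        show 2 * σ * (i + 1 : ℝ) < N (x - a)
        push_cast at hm; exact hm
      have h6 := Finset.single_le_sum hterm (Finset.mem_range.2 (by omega : i < J))
      have h7 : ind {x | 2 * σ * (i + 1 : ℝ) < N (x - a)} x = 1 := by
        unfold ind; rw [indicator_of_mem hmem]
      rw [h7, mul_one] at h6
      have := hexp (i + 2) hj
      norm_num at *; linarith
  refine bd.trans ?_
  rw [ex_add hK (hw.adm hK) (Adm.const _) (Adm.sum fun j _ => (Adm.ind (mA _)).smul _), hw.ex_const,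
    ex_sum hK (hw.adm hK) (fun j _ => (Adm.ind (mA _)).smul _)]
  have : ∑ j ∈ Finset.range J, ex K w (fun x => (1.3 ^ (j + 2) : ℝ) *
        ind {x | 2 * σ * (j + 1 : ℝ) < N (x - a)} x) ≤ ∑ j ∈ Finset.range J, 1.69 * (0.7514 : ℝ) ^ j := by
    apply Finset.sum_le_sum
    intro j _
    rw [ex_smul]
    calc _ ≤ (1.3 ^ (j + 2) : ℝ) * 0.578 ^ j := mul_le_mul_of_nonneg_left (tail j) (by positivity)
      _ = 1.69 * (1.3 * 0.578) ^ j := by rw [mul_pow]; ring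
      _ = _ := by norm_num
  rw [← Finset.mul_sum] at this
  have g : ∑ j ∈ Finset.range J, (0.7514 : ℝ) ^ j ≤ (1 - 0.7514)⁻¹ := by
    have := (summable_geometric_of_lt_one (r := (0.7514:ℝ)) (by norm_num) (by norm_num)).sum_le_tsum
      (Finset.range J) (fun _ _ => by positivity)
    rwa [tsum_geometric_of_lt_one (by norm_num) (by norm_num)] at this
  norm_num at *
  linarith

theorem borell_cube (hK : IsCompact K) (hc : Convex ℝ K) (hw : LC K w) (N : Seminorm ℝ (E n))
    (hN : Continuous N) (a : E n) (σ : ℝ) (hσ : 0 ≤ σ)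
    (h2 : ex K w (fun x => N (x - a) ^ 2) ≤ σ ^ 2) :
    ex K w (fun x => N (x - a) ^ 3) ≤ 27648 * σ ^ 3 := by
  have hcont : Continuous (fun x => N (x - a)) := hN.comp (by fun_prop)
  have pos : ∀ σ : ℝ, 0 < σ → ex K w (fun x => N (x - a) ^ 2) ≤ σ ^ 2 →
      ex K w (fun x => N (x - a) ^ 3) ≤ 27648 * σ ^ 3 := by
    intro σ hσ h2
    have h := borell_exp hK hc hw N hN a σ hσ h2
    have : ex K w (fun x => N (x - a) ^ 3) ≤
        ex K w (fun x => (3072 * σ ^ 3) * Real.exp (N (x - a) / (8 * σ))) := by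
      apply ex_mono hK (hw.adm hK) hw.nonneg (Adm.ofCont hK (by fun_prop)) (Adm.ofCont hK (by fun_prop))
      intro x _
      have hz : 0 ≤ N (x - a) / (8 * σ) := div_nonneg (apply_nonneg N _) (by positivity)
      have := Real.pow_div_factorial_le_exp _ hz 3
      set z := N (x - a) / (8 * σ) with hzd
      have e : N (x - a) = 8 * σ * z := by rw [hzd]; field_simp
      rw [e]
      norm_num [Nat.factorial] at this
      have h3 : 0 < σ ^ 3 := by positivity
      nlinarith
    rw [ex_smul] at this
    have h3 : 0 < σ ^ 3 := by positivity
    nlinarith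
  rcases hσ.eq_or_lt with h | h
  · subst h
    have : ∀ ε : ℝ, 0 < ε → ex K w (fun x => N (x - a) ^ 3) ≤ 27648 * ε ^ 3 := by
      intro ε hε
      apply pos ε hε (h2.trans (by simpa using sq_nonneg ε))
    have t : Filter.Tendsto (fun ε : ℝ => 27648 * ε ^ 3) (nhdsWithin 0 (Ioi 0)) (nhds (27648 * 0 ^ 3)) := by
      apply Filter.Tendsto.mono_left _ nhdsWithin_le_nhds
      exact Continuous.tendsto (by fun_prop) 0
    exact ge_of_tendsto t (Filter.eventually_of_mem self_mem_nhdsWithin this)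
  · exact pos σ h h2

theorem borell_ind (hK : IsCompact K) (hc : Convex ℝ K) (hw : LC K w) (N : Seminorm ℝ (E n))
    (hN : Continuous N) (a : E n) (σ : ℝ) (hσ : 0 < σ)
    (h2 : ex K w (fun x => N (x - a) ^ 2) ≤ σ ^ 2) {M : Set (E n)} (hM : MeasurableSet M) (b : ℝ) :
    ex K w (fun x => ind M x * N (x - a)) ≤ 8 * σ * (b * ex K w (ind M) + 9 * Real.exp (-b)) := by
  have hcont : Continuous (fun x => N (x - a)) := hN.comp (by fun_prop)
  have h := borell_exp hK hc hw N hN a σ hσ h2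
  have a1 : Adm K (fun x => (8 * σ * b) * ind M x) := (Adm.ind hM).smul _
  have a2 : Adm K (fun x => (8 * σ * Real.exp (-b)) * Real.exp (N (x - a) / (8 * σ))) :=
    Adm.ofCont hK (by fun_prop)
  have : ex K w (fun x => ind M x * N (x - a)) ≤
      ex K w (fun x => (8 * σ * b) * ind M x + (8 * σ * Real.exp (-b)) * Real.exp (N (x - a) / (8 * σ))) := by
    apply ex_mono hK (hw.adm hK) hw.nonneg ((Adm.ind hM).mul (Adm.ofCont hK hcont)) (a1.add a2)
    intro x _
    set z := N (x - a) / (8 * σ) with hzd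
    have e : N (x - a) = 8 * σ * z := by rw [hzd]; field_simp
    rw [e]
    have h3 : z ≤ b + Real.exp (-b) * Real.exp z := by
      rw [← Real.exp_add]
      have := Real.add_one_le_exp (-b + z)
      linarith
    have h4 : 0 ≤ Real.exp (-b) * Real.exp z := by positivity
    have i0 := ind_nonneg M x
    have i1 := ind_le_one M x
    have h5 : ind M x * z ≤ b * ind M x + Real.exp (-b) * Real.exp z := by nlinarith
    nlinarith
  rw [ex_add hK (hw.adm hK) a1 a2, ex_smul, ex_smul] at this
  have h6 : 0 < 8 * σ * Real.exp (-b) := by positivity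
  nlinarith

end


def mn (K : Set (E n)) (w : E n → ℝ) (i : Fin n) : ℝ := ex K w (fun x => x i)
def tl (K : Set (E n)) (w : E n → ℝ) (i : Fin n) (x : E n) : ℝ := x i - mn K w i
def cov (K : Set (E n)) (w : E n → ℝ) (i j : Fin n) : ℝ := ex K w (fun x => tl K w i x * tl K w j x)
def tri (K : Set (E n)) (w : E n → ℝ) (i j k : Fin n) : ℝ :=
  ex K w (fun x => tl K w i x * tl K w j x * tl K w k x)
def Phi (K : Set (E n)) (w : E n → ℝ) : ℝ := ∑ i, ∑ j, cov K w i j ^ 2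
def cE (K : Set (E n)) (w : E n → ℝ) (M : Set (E n)) (k : Fin n) : ℝ :=
  ex K w (fun x => ind M x * tl K w k x)
def mvec (K : Set (E n)) (w : E n → ℝ) : E n := WithLp.toLp 2 (fun i => mn K w i)

/-- variance of the indicator -/
def vE (K : Set (E n)) (w : E n → ℝ) (M : Set (E n)) : ℝ := ex K w (ind M) * (1 - ex K w (ind M))

section
variable {K : Set (E n)} {w : E n → ℝ}

theorem coord_cont (i : Fin n) : Continuous (fun x : E n => x i) := by fun_prop

theorem tl_cont (i : Fin n) : Continuous (tl K w i) := by unfold tl; fun_prop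

theorem tl_adm (hK : IsCompact K) (i : Fin n) : Adm K (tl K w i) := Adm.ofCont hK (tl_cont i)

theorem sub_mvec (x : E n) (i : Fin n) : (x - mvec K w) i = tl K w i x := by
  simp [mvec, tl]

theorem ex_tl (hK : IsCompact K) (hw : LC K w) (i : Fin n) : ex K w (tl K w i) = 0 := by
  have := ex_sub hK (hw.adm hK) (Adm.ofCont hK (coord_cont i)) (Adm.const (mn K w i))
  rw [hw.ex_const] at this
  unfold tl; rw [this]; unfold mn; ring

theorem lin_adm (hK : IsCompact K) (c : Fin n → ℝ) : Adm K (fun x => ∑ i, c i * tl K w i x) :=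
  Adm.sum fun i _ => (tl_adm hK i).smul _

theorem quad_eq (hK : IsCompact K) (hw : LC K w) (c : Fin n → ℝ) :
    ex K w (fun x => (∑ i, c i * tl K w i x) ^ 2) = ∑ i, ∑ j, c i * c j * cov K w i j := by
  have e : (fun x => (∑ i, c i * tl K w i x) ^ 2) =
      fun x => ∑ i, ∑ j, (c i * c j) * (tl K w i x * tl K w j x) := by
    ext x
    rw [pow_two, Finset.sum_mul_sum]
    refine Finset.sum_congr rfl fun i _ => Finset.sum_congr rfl fun j _ => by ring
  have ad : ∀ i j, Adm K (fun x => (c i * c j) * (tl K w i x * tl K w j x)) :=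
    fun i j => ((tl_adm hK i).mul (tl_adm hK j)).smul _
  rw [e, ex_sum hK (hw.adm hK) (fun i _ => Adm.sum fun j _ => ad i j)]
  refine Finset.sum_congr rfl fun i _ => ?_
  rw [ex_sum hK (hw.adm hK) (fun j _ => ad i j)]
  refine Finset.sum_congr rfl fun j _ => ?_
  rw [ex_smul]; rfl

theorem quad_le (c : Fin n → ℝ) (y : ℝ) (hy : Phi K w ≤ y ^ 4) :
    ∑ i, ∑ j, c i * c j * cov K w i j ≤ (∑ i, c i ^ 2) * y ^ 2 := by
  have h := Finset.sum_mul_sq_le_sq_mul_sq (Finset.univ : Finset (Fin n × Fin n))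
    (fun p => c p.1 * c p.2) (fun p => cov K w p.1 p.2)
  simp only [Fintype.sum_prod_type] at h
  have e : ∑ i, ∑ j, (c i * c j) ^ 2 = (∑ i, c i ^ 2) ^ 2 := by
    rw [pow_two (∑ i, c i ^ 2), Finset.sum_mul_sum]
    refine Finset.sum_congr rfl fun i _ => Finset.sum_congr rfl fun j _ => by ring
  rw [e] at h
  have h0 : 0 ≤ (∑ i, c i ^ 2) * y ^ 2 := by positivity
  apply abs_le_of_sq_le_sq' _ h0 |>.2
  refine h.trans ?_
  rw [mul_pow, ← pow_mul]
  exact mul_le_mul_of_nonneg_left hy (by positivity)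

theorem c_sum (hK : IsCompact K) (hw : LC K w) {M : Set (E n)} (hM : MeasurableSet M) (c : Fin n → ℝ) :
    ex K w (fun x => ind M x * (∑ i, c i * tl K w i x)) = ∑ i, c i * cE K w M i := by
  have e : (fun x => ind M x * (∑ i, c i * tl K w i x)) =
      fun x => ∑ i, c i * (ind M x * tl K w i x) := by
    ext x
    rw [Finset.mul_sum]
    refine Finset.sum_congr rfl fun i _ => by ring
  rw [e, ex_sum hK (hw.adm hK) (fun i _ => ((Adm.ind hM).mul (tl_adm hK i)).smul _)]
  refine Finset.sum_congr rfl fun i _ => ?_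
  rw [ex_smul]; rfl

theorem ex_lin_zero (hK : IsCompact K) (hw : LC K w) (c : Fin n → ℝ) :
    ex K w (fun x => ∑ i, c i * tl K w i x) = 0 := by
  rw [ex_sum hK (hw.adm hK) (fun i _ => (tl_adm hK i).smul _)]
  refine Finset.sum_eq_zero fun i _ => ?_
  rw [ex_smul, ex_tl hK hw, mul_zero]

theorem ind_sq (M : Set (E n)) (x : E n) : ind M x ^ 2 = ind M x := by
  unfold ind; by_cases h : x ∈ M <;> simp [h]

theorem c_bound1 (hK : IsCompact K) (hw : LC K w) {M : Set (E n)} (hM : MeasurableSet M)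
    (y : ℝ) (hy : Phi K w ≤ y ^ 4) :
    ∑ i, cE K w M i ^ 2 ≤ vE K w M * y ^ 2 := by
  set c := cE K w M with hc
  set e := ex K w (ind M) with he
  set s := ∑ i, c i ^ 2 with hs
  have s0 : 0 ≤ s := by positivity
  have l := lin_adm (w := w) hK c
  have h1 : ex K w (fun x => (ind M x - e) * (∑ i, c i * tl K w i x)) = s := by
    have e1 : (fun x => (ind M x - e) * (∑ i, c i * tl K w i x)) =
        fun x => ind M x * (∑ i, c i * tl K w i x) - e * (∑ i, c i * tl K w i x) := by
      ext x; ring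
    rw [e1, ex_sub hK (hw.adm hK) ((Adm.ind hM).mul l) (l.smul e), ex_smul, ex_lin_zero hK hw,
      c_sum hK hw hM]
    simp [hs, pow_two, hc]
  have h2 : ex K w (fun x => (ind M x - e) ^ 2) = vE K w M := by
    have e1 : (fun x => (ind M x - e) ^ 2) = fun x => (1 - 2 * e) * ind M x + e ^ 2 := by
      ext x
      have := ind_sq M x
      linear_combination this
    rw [e1, ex_add hK (hw.adm hK) ((Adm.ind hM).smul _) (Adm.const _), ex_smul, hw.ex_const]
    unfold vE; ring
  have h3 := ex_cs hK (hw.adm hK) hw.nonneg ((Adm.ind hM).sub (Adm.const e)) l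
  rw [h1, h2, quad_eq hK hw] at h3
  have h4 := quad_le (K := K) (w := w) c y hy
  have v0 : 0 ≤ vE K w M := by rw [← h2]; exact ex_nonneg hK hw.nonneg (fun x _ => sq_nonneg _)
  have h5 : s ^ 2 ≤ vE K w M * (s * y ^ 2) := h3.trans (mul_le_mul_of_nonneg_left h4 v0)
  rcases s0.eq_or_lt with h | h
  · rw [← h]; positivity
  · have : s * s ≤ s * (vE K w M * y ^ 2) := by nlinarith
    exact le_of_mul_le_mul_left this h

def linSem (c : Fin n → ℝ) : Seminorm ℝ (E n) :=
  Seminorm.of (fun x => |∑ i, c i * x i|)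
    (by
      intro x y
      refine le_trans (le_of_eq ?_) (abs_add_le _ _)
      rw [← Finset.sum_add_distrib]
      congr 1
      refine Finset.sum_congr rfl fun i _ => by simp; ring)
    (by
      intro a x
      rw [Real.norm_eq_abs, ← abs_mul, Finset.mul_sum]
      congr 1
      refine Finset.sum_congr rfl fun i _ => by simp; ring)

theorem linSem_apply (c : Fin n → ℝ) (x : E n) : linSem c x = |∑ i, c i * x i| := rfl

theorem linSem_cont (c : Fin n → ℝ) : Continuous (linSem c) := by
  show Continuous (fun x : E n => |∑ i, c i * x i|)
  fun_prop

theorem linSem_sub (c : Fin n → ℝ) (x : E n) :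
    linSem c (x - mvec K w) = |∑ i, c i * tl K w i x| := by
  simp only [linSem_apply, sub_mvec]

theorem c_bound2 (hK : IsCompact K) (hcv : Convex ℝ K) (hw : LC K w) {M : Set (E n)} (hM : MeasurableSet M)
    (y : ℝ) (hy0 : 0 < y) (hy : Phi K w ≤ y ^ 4) (b : ℝ) (hb : 0 ≤ b) :
    √(∑ i, cE K w M i ^ 2) ≤ 8 * y * (2 * b * vE K w M + 9 * Real.exp (-b)) := by
  set c := cE K w M with hc
  set e := ex K w (ind M) with he
  have e0 : 0 ≤ e := ex_nonneg hK hw.nonneg (fun x _ => ind_nonneg _ x)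
  have e1 : e ≤ 1 := hw.le_one hK hM
  have hv : vE K w M = e * (1 - e) := rfl
  set s := √(∑ i, c i ^ 2) with hs
  have ss : s ^ 2 = ∑ i, c i ^ 2 := Real.sq_sqrt (by positivity)
  have s0 : 0 ≤ s := Real.sqrt_nonneg _
  have l := lin_adm (w := w) hK c
  have hR : 0 ≤ 8 * y * (2 * b * vE K w M + 9 * Real.exp (-b)) := by
    have := Real.exp_pos (-b)
    have : 0 ≤ vE K w M := by rw [hv]; exact mul_nonneg e0 (by linarith)
    positivity
  rcases s0.eq_or_lt with h | h
  · rw [← h]; exact hR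
  have sec : ex K w (fun x => linSem c (x - mvec K w) ^ 2) ≤ (s * y) ^ 2 := by
    simp only [linSem_sub, sq_abs]
    rw [quad_eq hK hw, mul_pow, ss]
    exact quad_le c y hy
  have i1 := borell_ind hK hcv hw (linSem c) (linSem_cont c) (mvec K w) (s * y) (by positivity) sec hM b
  have i2 := borell_ind hK hcv hw (linSem c) (linSem_cont c) (mvec K w) (s * y) (by positivity) sec hM.compl b
  rw [hw.compl hK hM] at i2
  simp only [linSem_sub] at i1 i2
  have k1 : s ^ 2 ≤ ex K w (fun x => ind M x * |∑ i, c i * tl K w i x|) := by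
    rw [ss]
    have : ∑ i, c i ^ 2 = ex K w (fun x => ind M x * (∑ i, c i * tl K w i x)) := by
      rw [c_sum hK hw hM]; simp [hc, pow_two]
    rw [this]
    apply ex_mono hK (hw.adm hK) hw.nonneg ((Adm.ind hM).mul l)
      ((Adm.ind hM).mul (Adm.ofCont hK (by unfold tl; fun_prop)))
    intro x _
    exact mul_le_mul_of_nonneg_left (le_abs_self _) (ind_nonneg _ _)
  have k2 : s ^ 2 ≤ ex K w (fun x => ind Mᶜ x * |∑ i, c i * tl K w i x|) := by
    rw [ss]
    have : ∑ i, c i ^ 2 = ex K w (fun x => ind M x * (∑ i, c i * tl K w i x)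
        - (∑ i, c i * tl K w i x)) := by
      rw [ex_sub hK (hw.adm hK) ((Adm.ind hM).mul l) l, ex_lin_zero hK hw, c_sum hK hw hM]
      simp [hc, pow_two]
    rw [this]
    apply ex_mono hK (hw.adm hK) hw.nonneg (((Adm.ind hM).mul l).sub l)
      ((Adm.ind hM.compl).mul (Adm.ofCont hK (by unfold tl; fun_prop)))
    intro x _
    rw [ind_compl]
    have h1 := neg_abs_le (∑ i, c i * tl K w i x)
    have h2 := ind_le_one M x
    nlinarith
  have hE := Real.exp_pos (-b)
  have j1 : s ≤ 8 * y * (b * e + 9 * Real.exp (-b)) := by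
    apply le_of_mul_le_mul_left _ h
    nlinarith
  have j2 : s ≤ 8 * y * (b * (1 - e) + 9 * Real.exp (-b)) := by
    apply le_of_mul_le_mul_left _ h
    nlinarith
  have fin : ∀ z, z ≤ 2 * vE K w M → s ≤ 8 * y * (b * z + 9 * Real.exp (-b)) →
      s ≤ 8 * y * (2 * b * vE K w M + 9 * Real.exp (-b)) := by
    intro z hz h
    refine h.trans ?_
    have : b * z ≤ b * (2 * vE K w M) := mul_le_mul_of_nonneg_left hz hb
    apply mul_le_mul_of_nonneg_left _ (by positivity)
    linarith
  rcases le_total e (1 / 2) with h5 | h5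
  · exact fin e (by rw [hv]; nlinarith) j1
  · exact fin (1 - e) (by rw [hv]; nlinarith) j2

/-- the covariance seminorm -/
def covSem (hK : IsCompact K) (hw : LC K w) : Seminorm ℝ (E n) :=
  Seminorm.of (fun u => √(ex K w (fun x => (∑ i, u i * tl K w i x) ^ 2)))
    (by
      intro u v
      have ha := ex_nonneg hK (w := w) (φ := fun x => (∑ i, u i * tl K w i x) ^ 2) hw.nonneg (fun x _ => sq_nonneg _)
      have hb := ex_nonneg hK (w := w) (φ := fun x => (∑ i, v i * tl K w i x) ^ 2) hw.nonneg (fun x _ => sq_nonneg _)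
      have l1 := lin_adm (w := w) hK u
      have l2 := lin_adm (w := w) hK v
      have cs := ex_cs hK (hw.adm hK) hw.nonneg l1 l2
      rw [Real.sqrt_le_left (by positivity)]
      have e : (fun x => (∑ i, (u + v) i * tl K w i x) ^ 2) =
          fun x => ((∑ i, u i * tl K w i x) ^ 2 +
            2 * ((∑ i, u i * tl K w i x) * (∑ i, v i * tl K w i x))) + (∑ i, v i * tl K w i x) ^ 2 := by
        ext x
        have : ∑ i, (u + v) i * tl K w i x = (∑ i, u i * tl K w i x) + (∑ i, v i * tl K w i x) := by
          rw [← Finset.sum_add_distrib]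
          refine Finset.sum_congr rfl fun i _ => by simp; ring
        rw [this]; ring
      rw [e, ex_add hK (hw.adm hK) ((l1.pow 2).add ((l1.mul l2).smul 2)) (l2.pow 2),
        ex_add hK (hw.adm hK) (l1.pow 2) ((l1.mul l2).smul 2), ex_smul, add_sq, Real.sq_sqrt ha, Real.sq_sqrt hb]
      have : ex K w (fun x => (∑ i, u i * tl K w i x) * (∑ i, v i * tl K w i x)) ≤
          √(ex K w (fun x => (∑ i, u i * tl K w i x) ^ 2)) * √(ex K w (fun x => (∑ i, v i * tl K w i x) ^ 2)) := by
        rw [← Real.sqrt_mul ha]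
        exact Real.le_sqrt_of_sq_le cs
      linarith)
    (by
      intro a u
      have e : (fun x => (∑ i, (a • u) i * tl K w i x) ^ 2) =
          fun x => a ^ 2 * (∑ i, u i * tl K w i x) ^ 2 := by
        ext x
        have : ∑ i, (a • u) i * tl K w i x = a * (∑ i, u i * tl K w i x) := by
          rw [Finset.mul_sum]
          refine Finset.sum_congr rfl fun i _ => by simp; ring
        rw [this]; ring
      rw [e, ex_smul, Real.sqrt_mul (sq_nonneg a), Real.sqrt_sq_eq_abs, Real.norm_eq_abs])

theorem covSem_apply (hK : IsCompact K) (hw : LC K w) (u : E n) :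
    covSem hK hw u = √(ex K w (fun x => (∑ i, u i * tl K w i x) ^ 2)) := rfl

theorem covSem_cont (hK : IsCompact K) (hw : LC K w) : Continuous (covSem hK hw) := by
  show Continuous (fun u : E n => √(ex K w (fun x => (∑ i, u i * tl K w i x) ^ 2)))
  have : (fun u : E n => √(ex K w (fun x => (∑ i, u i * tl K w i x) ^ 2))) =
      fun u : E n => √(∑ i, ∑ j, u i * u j * cov K w i j) := by
    ext u
    rw [quad_eq hK hw (fun i => u i)]
  rw [this]
  fun_prop

theorem cube_sum (f : Fin n → ℝ) : (∑ i, f i) ^ 3 = ∑ i, ∑ j, ∑ k, f i * f j * f k := by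
  rw [pow_three', Finset.sum_mul_sum, Finset.sum_mul]
  refine Finset.sum_congr rfl fun i _ => ?_
  rw [Finset.sum_mul]
  refine Finset.sum_congr rfl fun j _ => ?_
  rw [Finset.mul_sum]

theorem ex_triple (hK : IsCompact K) (hw : LC K w) (c : Fin n → Fin n → Fin n → ℝ) :
    ex K w (fun x => ∑ i, ∑ j, ∑ k, c i j k * (tl K w i x * tl K w j x * tl K w k x)) =
      ∑ i, ∑ j, ∑ k, c i j k * tri K w i j k := by
  have ad : ∀ i j k, Adm K (fun x => c i j k * (tl K w i x * tl K w j x * tl K w k x)) :=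
    fun i j k => (((tl_adm hK i).mul (tl_adm hK j)).mul (tl_adm hK k)).smul _
  rw [ex_sum hK (hw.adm hK) (fun i _ => Adm.sum fun j _ => Adm.sum fun k _ => ad i j k)]
  refine Finset.sum_congr rfl fun i _ => ?_
  rw [ex_sum hK (hw.adm hK) (fun j _ => Adm.sum fun k _ => ad i j k)]
  refine Finset.sum_congr rfl fun j _ => ?_
  rw [ex_sum hK (hw.adm hK) (fun k _ => ad i j k)]
  refine Finset.sum_congr rfl fun k _ => ?_
  rw [ex_smul]; rfl

theorem tri_form (hK : IsCompact K) (hcv : Convex ℝ K) (hw : LC K w) (u : E n) :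
    ∑ i, ∑ j, ∑ k, (u i * u j * u k) * tri K w i j k ≤ 27648 * covSem hK hw u ^ 3 := by
  have l := lin_adm (w := w) hK u
  have h := borell_cube hK hcv hw (linSem u) (linSem_cont u) (mvec K w) (covSem hK hw u)
    (apply_nonneg _ _) (by
      simp only [linSem_sub, sq_abs]
      rw [covSem_apply, Real.sq_sqrt]
      exact ex_nonneg hK hw.nonneg (fun x _ => sq_nonneg _))
  refine le_trans ?_ h
  rw [← ex_triple hK hw]
  have e : (fun x => ∑ i, ∑ j, ∑ k, (u i * u j * u k) * (tl K w i x * tl K w j x * tl K w k x)) =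
      fun x => (∑ i, u i * tl K w i x) ^ 3 := by
    ext x
    rw [cube_sum]
    refine Finset.sum_congr rfl fun i _ => Finset.sum_congr rfl fun j _ => Finset.sum_congr rfl fun k _ => by ring
  rw [e]
  simp only [linSem_sub]
  apply ex_mono hK (hw.adm hK) hw.nonneg (l.pow 3) (Adm.ofCont hK (by unfold tl; fun_prop))
  intro x _
  rw [← abs_pow]; exact le_abs_self _

theorem tri_bound (hK : IsCompact K) (hcv : Convex ℝ K) (hw : LC K w)
    (y : ℝ) (hy0 : 0 < y) (hy : Phi K w ≤ y ^ 4) :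
    ∑ i, ∑ j, ∑ k, tri K w i j k ^ 2 ≤ (27648 * y ^ 3) ^ 2 := by
  have h := borell_cube hK hcv hw (covSem hK hw) (covSem_cont hK hw) (mvec K w) (y ^ 2) (by positivity) (by
    have : (fun x => covSem hK hw (x - mvec K w) ^ 2) =
        fun x => ∑ i, ∑ j, cov K w i j * (tl K w i x * tl K w j x) := by
      ext x
      rw [covSem_apply, Real.sq_sqrt (ex_nonneg hK hw.nonneg (fun x _ => sq_nonneg _)),
        quad_eq hK hw (fun i => (x - mvec K w) i)]
      simp only [sub_mvec]
      refine Finset.sum_congr rfl fun i _ => Finset.sum_congr rfl fun j _ => by ring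
    rw [this]
    have ad : ∀ i j, Adm K (fun x => cov K w i j * (tl K w i x * tl K w j x)) :=
      fun i j => ((tl_adm hK i).mul (tl_adm hK j)).smul _
    rw [ex_sum hK (hw.adm hK) (fun i _ => Adm.sum fun j _ => ad i j), ← pow_mul]
    refine le_trans (le_of_eq ?_) hy
    unfold Phi
    refine Finset.sum_congr rfl fun i _ => ?_
    rw [ex_sum hK (hw.adm hK) (fun j _ => ad i j)]
    refine Finset.sum_congr rfl fun j _ => ?_
    rw [ex_smul, pow_two]; rfl)
  have h2 : ∑ i, ∑ j, ∑ k, tri K w i j k ^ 2 ≤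
      ex K w (fun x => 27648 * covSem hK hw (x - mvec K w) ^ 3) := by
    have e : ∑ i, ∑ j, ∑ k, tri K w i j k ^ 2 =
      ex K w (fun x => ∑ i, ∑ j, ∑ k, tri K w i j k * (tl K w i x * tl K w j x * tl K w k x)) := by
      rw [ex_triple hK hw]
      simp only [pow_two]
    rw [e]
    have hcont := covSem_cont hK hw
    apply ex_mono hK (hw.adm hK) hw.nonneg (Adm.ofCont hK (by unfold tl; fun_prop))
      (Adm.ofCont hK (by fun_prop))
    intro x _
    refine le_trans (le_of_eq ?_) (tri_form hK hcv hw (x - mvec K w))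
    simp only [sub_mvec]
    refine Finset.sum_congr rfl fun i _ => Finset.sum_congr rfl fun j _ => Finset.sum_congr rfl fun k _ => by ring
  rw [ex_smul] at h2
  refine h2.trans ?_
  nlinarith

end


def stepw (K : Set (E n)) (w : E n → ℝ) (k : Fin n) (h : ℝ) : E n → ℝ :=
  fun x => w x * (1 + h * tl K w k x)

section
variable {K : Set (E n)} {w : E n → ℝ}

theorem abs_ex_le (hK : IsCompact K) (hw : LC K w) {φ : E n → ℝ} (hφ : Adm K φ) (B : ℝ)
    (h : ∀ x ∈ K, |φ x| ≤ B) : |ex K w φ| ≤ B := by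
  rw [abs_le]
  constructor
  · rw [← hw.ex_const (-B)]
    exact ex_mono hK (hw.adm hK) hw.nonneg (Adm.const _) hφ (fun x hx => (abs_le.1 (h x hx)).1)
  · rw [← hw.ex_const B]
    exact ex_mono hK (hw.adm hK) hw.nonneg hφ (Adm.const _) (fun x hx => (abs_le.1 (h x hx)).2)

theorem tl_le (hK : IsCompact K) (hw : LC K w) {R : ℝ} (hR : ∀ x ∈ K, ∀ i, |x i| ≤ R) (k : Fin n) :
    ∀ x ∈ K, |tl K w k x| ≤ 2 * R := by
  intro x hx
  have h1 : |mn K w k| ≤ R := abs_ex_le hK hw (Adm.ofCont hK (coord_cont k)) R (fun x hx => hR x hx k)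
  have := abs_sub (x k) (mn K w k)
  unfold tl
  linarith [hR x hx k]

theorem cov_le (hK : IsCompact K) (hw : LC K w) {R : ℝ} (hR : ∀ x ∈ K, ∀ i, |x i| ≤ R) (i j : Fin n) :
    |cov K w i j| ≤ (2 * R) * (2 * R) := by
  apply abs_ex_le hK hw ((tl_adm hK i).mul (tl_adm hK j))
  intro x hx
  rw [abs_mul]
  exact mul_le_mul (tl_le hK hw hR i x hx) (tl_le hK hw hR j x hx) (abs_nonneg _)
    ((abs_nonneg _).trans (tl_le hK hw hR i x hx))

theorem tri_le (hK : IsCompact K) (hw : LC K w) {R : ℝ} (hR : ∀ x ∈ K, ∀ i, |x i| ≤ R) (i j k : Fin n) :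
    |tri K w i j k| ≤ (2 * R) * (2 * R) * (2 * R) := by
  apply abs_ex_le hK hw (((tl_adm hK i).mul (tl_adm hK j)).mul (tl_adm hK k))
  intro x hx
  have h0 := (abs_nonneg _).trans (tl_le hK hw hR i x hx)
  rw [abs_mul, abs_mul]
  exact mul_le_mul (mul_le_mul (tl_le hK hw hR i x hx) (tl_le hK hw hR j x hx) (abs_nonneg _) h0)
    (tl_le hK hw hR k x hx) (abs_nonneg _) (by positivity)

theorem fac_bd (hK : IsCompact K) (hw : LC K w) {R : ℝ} (hR : ∀ x ∈ K, ∀ i, |x i| ≤ R) (k : Fin n)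
    {h : ℝ} (hh : |h| * (2 * R) ≤ 1 / 2) : ∀ x ∈ K, 1 / 2 ≤ 1 + h * tl K w k x ∧ 1 + h * tl K w k x ≤ 2 := by
  intro x hx
  have : |h * tl K w k x| ≤ 1 / 2 := by
    rw [abs_mul]
    exact (mul_le_mul_of_nonneg_left (tl_le hK hw hR k x hx) (abs_nonneg _)).trans hh
  have := abs_le.1 this
  constructor <;> linarith

theorem ex_step (hK : IsCompact K) (hw : LC K w) (k : Fin n) (h : ℝ) {φ : E n → ℝ} (hφ : Adm K φ) :
    ex K (stepw K w k h) φ = ex K w φ + h * ex K w (fun x => φ x * tl K w k x) := by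
  rw [← ex_smul, ← ex_add hK (hw.adm hK) hφ ((hφ.mul (tl_adm hK k)).smul h)]
  unfold ex stepw
  congr 1; ext x; ring

theorem tl_affine (k : Fin n) (x y : E n) (l : ℝ) :
    tl K w k ((1 - l) • x + l • y) = (1 - l) * tl K w k x + l * tl K w k y := by
  unfold tl; simp; ring

theorem LC.step (hK : IsCompact K) (hcv : Convex ℝ K) (hw : LC K w) {R : ℝ}
    (hR : ∀ x ∈ K, ∀ i, |x i| ≤ R) (k : Fin n)
    {h : ℝ} (hh : |h| * (2 * R) ≤ 1 / 2) : LC K (stepw K w k h) where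
  cont := by have := hw.cont; have := tl_cont (K := K) (w := w) k; unfold stepw; fun_prop
  nonneg := fun x hx => mul_nonneg (hw.nonneg x hx) (by linarith [(fac_bd hK hw hR k hh x hx).1])
  one := by
    rw [ex_step hK hw k h (Adm.const 1), hw.one]
    simp only [one_mul]
    have := ex_tl hK hw k
    rw [this]; ring
  lc := by
    intro x hx y hy l hl hl1
    have hl' : 0 < 1 - l := by linarith
    have hz : (1 - l) • x + l • y ∈ K := hcv hx hy hl'.le hl.le (by ring)
    have fx : 0 ≤ 1 + h * tl K w k x := by linarith [(fac_bd hK hw hR k hh x hx).1]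
    have fy : 0 ≤ 1 + h * tl K w k y := by linarith [(fac_bd hK hw hR k hh y hy).1]
    unfold stepw
    rw [mul_rpow (hw.nonneg x hx) fx, mul_rpow (hw.nonneg y hy) fy]
    have h1 := hw.lc x hx y hy l hl hl1
    have h2 := Real.geom_mean_le_arith_mean2_weighted hl'.le hl.le fx fy (by ring)
    calc _ = (w x ^ (1 - l) * w y ^ l) * ((1 + h * tl K w k x) ^ (1 - l) * (1 + h * tl K w k y) ^ l) := by ring
      _ ≤ w ((1 - l) • x + l • y) * ((1 - l) * (1 + h * tl K w k x) + l * (1 + h * tl K w k y)) :=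
        mul_le_mul h1 h2 (mul_nonneg (rpow_nonneg fx _) (rpow_nonneg fy _)) (hw.nonneg _ hz)
      _ = _ := by rw [tl_affine]; ring

theorem mn_step (hK : IsCompact K) (hw : LC K w) (k : Fin n) (h : ℝ) (i : Fin n) :
    mn K (stepw K w k h) i = mn K w i + h * cov K w i k := by
  unfold mn
  rw [ex_step hK hw k h (Adm.ofCont hK (coord_cont i))]
  congr 2
  have e : (fun x : E n => x i * tl K w k x) = fun x => tl K w i x * tl K w k x + mn K w i * tl K w k x := by
    ext x; unfold tl; ring
  rw [e, ex_add hK (hw.adm hK) ((tl_adm hK i).mul (tl_adm hK k)) ((tl_adm hK k).smul _), ex_smul, ex_tl hK hw]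
  unfold cov; ring

theorem cov_step (hK : IsCompact K) (hw : LC K w) (k : Fin n) (h : ℝ) (i j : Fin n) 
    (h1 : ex K (stepw K w k h) (fun _ => 1) = 1) (hS : Adm K (stepw K w k h)) :
    cov K (stepw K w k h) i j = cov K w i j + h * tri K w i j k - h ^ 2 * (cov K w i k * cov K w j k) := by
  set w' := stepw K w k h with hw'
  have et : ∀ i, tl K w' i = fun x => tl K w i x - h * cov K w i k := by
    intro i; ext x; unfold tl; rw [mn_step hK hw k h i]; ring
  have m : ∀ i, ex K w' (tl K w i) = h * cov K w i k := by
    intro i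
    rw [hw', ex_step hK hw k h (tl_adm hK i), ex_tl hK hw]
    unfold cov; ring
  have e : (fun x => tl K w' i x * tl K w' j x) = fun x => (tl K w i x * tl K w j x -
      (h * cov K w j k) * tl K w i x) - ((h * cov K w i k) * tl K w j x - (h ^ 2 * cov K w i k * cov K w j k) * 1) := by
    ext x; rw [et, et]; ring
  have a1 : Adm K (fun x => tl K w i x * tl K w j x) := (tl_adm hK i).mul (tl_adm hK j)
  have a2 : Adm K (fun x => (h * cov K w j k) * tl K w i x) := (tl_adm hK i).smul _
  have a3 : Adm K (fun x => (h * cov K w i k) * tl K w j x) := (tl_adm hK j).smul _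
  have a4 : Adm K (fun _ => (h ^ 2 * cov K w i k * cov K w j k) * 1) := Adm.const _
  have : cov K w' i j = ex K w' (fun x => tl K w' i x * tl K w' j x) := rfl
  rw [this, e, ex_sub hK hS (a1.sub a2) (a3.sub a4), ex_sub hK hS a1 a2, ex_sub hK hS a3 a4, ex_smul, ex_smul,
    ex_smul, h1, m, m]
  have : ex K w' (fun x => tl K w i x * tl K w j x) = cov K w i j + h * tri K w i j k := by
    rw [hw', ex_step hK hw k h a1]; rfl
  rw [this]; ring

theorem e_step (hK : IsCompact K) (hw : LC K w) (k : Fin n) (h : ℝ) {M : Set (E n)} (hM : MeasurableSet M) :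
    ex K (stepw K w k h) (ind M) = ex K w (ind M) + h * cE K w M k := ex_step hK hw k h (Adm.ind hM)

theorem vE_step (hK : IsCompact K) (hw : LC K w) (k : Fin n) (h : ℝ) {M : Set (E n)} (hM : MeasurableSet M) :
    vE K (stepw K w k h) M = vE K w M + h * ((1 - 2 * ex K w (ind M)) * cE K w M k) - h ^ 2 * cE K w M k ^ 2 := by
  unfold vE
  rw [e_step hK hw k h hM]; ring

theorem vE_nonneg (hK : IsCompact K) (hw : LC K w) {M : Set (E n)} (hM : MeasurableSet M) : 0 ≤ vE K w M :=
  mul_nonneg (ex_nonneg hK hw.nonneg (fun x _ => ind_nonneg _ x)) (by linarith [hw.le_one hK hM])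

theorem vE_le (hK : IsCompact K) (hw : LC K w) {M : Set (E n)} (hM : MeasurableSet M) : vE K w M ≤ 1 := by
  unfold vE
  nlinarith [hw.le_one hK hM, sq_nonneg (ex K w (ind M)), sq_nonneg (ex K w (ind M) - 1)]

/-- `⟨A, T_k⟩` -/
def XX (K : Set (E n)) (w : E n → ℝ) (k : Fin n) : ℝ := ∑ i, ∑ j, cov K w i j * tri K w i j k
/-- `|T_k|²` -/
def ZZ (K : Set (E n)) (w : E n → ℝ) (k : Fin n) : ℝ := ∑ i, ∑ j, tri K w i j k ^ 2

def K1 (n : ℕ) (R : ℝ) : ℝ := n * (n * (2 * (2 * R) ^ 7 + (2 * R) ^ 8))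

theorem Phi_step (hK : IsCompact K) (hw : LC K w) {R : ℝ} (hR0 : 0 ≤ R)
    (hR : ∀ x ∈ K, ∀ i, |x i| ≤ R) (k : Fin n) (h : ℝ) (hh1 : |h| ≤ 1)
    (h1 : ex K (stepw K w k h) (fun _ => 1) = 1) (hS : Adm K (stepw K w k h)) :
    Phi K (stepw K w k h) ≤ Phi K w + 2 * h * XX K w k + h ^ 2 * ZZ K w k + |h| ^ 3 * K1 n R := by
  have psd : 0 ≤ ∑ i, ∑ j, cov K w i k * cov K w j k * cov K w i j := by
    rw [← quad_eq hK hw]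
    exact ex_nonneg hK hw.nonneg (fun x _ => sq_nonneg _)
  have ebd : ∀ i j, |h| ^ 3 * (2 * (2 * R) ^ 7 + (2 * R) ^ 8) ≥
      -2 * h ^ 3 * tri K w i j k * (cov K w i k * cov K w j k) + h ^ 4 * (cov K w i k * cov K w j k) ^ 2 := by
    intro i j
    have t := tri_le hK hw hR i j k
    have a := cov_le hK hw hR i k
    have b := cov_le hK hw hR j k
    have ab : |cov K w i k * cov K w j k| ≤ (2 * R) ^ 4 := by
      rw [abs_mul]
      calc _ ≤ ((2 * R) * (2 * R)) * ((2 * R) * (2 * R)) := mul_le_mul a b (abs_nonneg _) (by positivity)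
        _ = _ := by ring
    set q := cov K w i k * cov K w j k
    have tq : |tri K w i j k| * |q| ≤ (2 * R) ^ 7 := by
      calc _ ≤ ((2 * R) * (2 * R) * (2 * R)) * (2 * R) ^ 4 := mul_le_mul t ab (abs_nonneg _) (by positivity)
        _ = _ := by ring
    have qq : q ^ 2 ≤ (2 * R) ^ 8 := by
      rw [← sq_abs]
      calc |q| ^ 2 ≤ ((2 * R) ^ 4) ^ 2 := pow_le_pow_left₀ (abs_nonneg _) ab 2
        _ = _ := by ring
    have p1 : -2 * h ^ 3 * tri K w i j k * q ≤ |h| ^ 3 * (2 * (2 * R) ^ 7) := by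
      refine (le_abs_self _).trans ?_
      rw [abs_mul, abs_mul, abs_mul, abs_pow]
      simp only [abs_neg, abs_two]
      have : 0 ≤ |h| ^ 3 := by positivity
      nlinarith
    have p2 : h ^ 4 * q ^ 2 ≤ |h| ^ 3 * (2 * R) ^ 8 := by
      have : h ^ 4 ≤ |h| ^ 3 := by
        have e : h ^ 4 = |h| ^ 4 := by rw [← abs_pow, abs_of_nonneg (by positivity)]
        rw [e, pow_succ]
        exact mul_le_of_le_one_right (by positivity) hh1
      exact mul_le_mul this qq (sq_nonneg _) (by positivity)
    linarith
  unfold Phi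
  simp only [cov_step hK hw k h _ _ h1 hS]
  have e : ∀ i j, (cov K w i j + h * tri K w i j k - h ^ 2 * (cov K w i k * cov K w j k)) ^ 2 ≤
      cov K w i j ^ 2 + 2 * h * (cov K w i j * tri K w i j k) + h ^ 2 * tri K w i j k ^ 2
      - 2 * h ^ 2 * (cov K w i k * cov K w j k * cov K w i j) + |h| ^ 3 * (2 * (2 * R) ^ 7 + (2 * R) ^ 8) := by
    intro i j
    have := ebd i j
    nlinarith
  refine (Finset.sum_le_sum fun i _ => Finset.sum_le_sum fun j _ => e i j).trans ?_
  simp only [Finset.sum_add_distrib, Finset.sum_sub_distrib, ← Finset.mul_sum, Finset.sum_const,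
    Finset.card_univ, Fintype.card_fin, nsmul_eq_mul]
  have : 0 ≤ 2 * h ^ 2 * ∑ i, ∑ j, cov K w i k * cov K w j k * cov K w i j := by positivity
  unfold XX ZZ K1
  linarith

theorem tangent (r r' : ℝ) (hr : 0 < r) (hr' : 0 < r') : 1 / r - (r' ^ 2 - r ^ 2) / (2 * r ^ 3) ≤ 1 / r' := by
  have : 1 / r' - (1 / r - (r' ^ 2 - r ^ 2) / (2 * r ^ 3)) = (r - r') ^ 2 * (2 * r + r') / (2 * r ^ 3 * r') := by
    field_simp; ring
  have h2 : 0 ≤ (r - r') ^ 2 * (2 * r + r') / (2 * r ^ 3 * r') := by positivity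
  linarith

theorem pair_real (D Φ r v g c X Z κ η Φp Φm vp vm : ℝ) (hD : 0 < D) (hΦ : 0 ≤ Φ) (hr : 0 < r)
    (hr2 : r ^ 2 = D + Φ) (hΦp : 0 ≤ Φp) (hΦm : 0 ≤ Φm) (hvp : 0 ≤ vp) (hvm : 0 ≤ vm)
    (hη : 0 ≤ η) (hZ : 0 ≤ Z) (hκ : 0 ≤ κ) (hg : |g| ≤ |c|)
    (ep : vp = v + η * g - η ^ 2 * c ^ 2) (em : vm = v - η * g - η ^ 2 * c ^ 2)
    (hp : Φp ≤ Φ + 2 * η * X + η ^ 2 * Z + η ^ 3 * κ)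
    (hm : Φm ≤ Φ - 2 * η * X + η ^ 2 * Z + η ^ 3 * κ) :
    2 * (v / r) - 2 * η ^ 2 * (c ^ 2 / r + (2 * (|c| * |X|) + v * Z) / (2 * r ^ 3)) - η ^ 3 * (κ * v / r ^ 3) ≤
      vp / √(D + Φp) + vm / √(D + Φm) := by
  have one : ∀ Φ' v' B : ℝ, 0 ≤ Φ' → 0 ≤ v' → Φ' ≤ Φ + B → v' * (1 / r - B / (2 * r ^ 3)) ≤ v' / √(D + Φ') := by
    intro Φ' v' B h1 h2 h3
    have s : 0 < √(D + Φ') := Real.sqrt_pos.2 (by linarith)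
    have t := tangent r _ hr s
    rw [Real.sq_sqrt (by linarith), hr2] at t
    rw [div_eq_mul_one_div v']
    apply mul_le_mul_of_nonneg_left _ h2
    refine le_trans ?_ t
    have : (D + Φ' - (D + Φ)) / (2 * r ^ 3) ≤ B / (2 * r ^ 3) := by
      apply div_le_div_of_nonneg_right _ (by positivity); linarith
    linarith
  have o1 := one Φp vp (2 * η * X + η ^ 2 * Z + η ^ 3 * κ) hΦp hvp (by linarith)
  have o2 := one Φm vm (-2 * η * X + η ^ 2 * Z + η ^ 3 * κ) hΦm hvm (by linarith)
  refine le_trans ?_ (add_le_add o1 o2)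
  have gX : g * X ≤ |c| * |X| := by
    refine (le_abs_self _).trans ?_
    rw [abs_mul]; exact mul_le_mul_of_nonneg_right hg (abs_nonneg _)
  have id : vp * (1 / r - (2 * η * X + η ^ 2 * Z + η ^ 3 * κ) / (2 * r ^ 3)) +
      vm * (1 / r - (-2 * η * X + η ^ 2 * Z + η ^ 3 * κ) / (2 * r ^ 3)) -
      (2 * (v / r) - 2 * η ^ 2 * (c ^ 2 / r + (2 * (|c| * |X|) + v * Z) / (2 * r ^ 3)) - η ^ 3 * (κ * v / r ^ 3)) =
      (4 * η ^ 2 * (|c| * |X| - g * X) + 2 * η ^ 2 * c ^ 2 * (η ^ 2 * Z + η ^ 3 * κ)) / (2 * r ^ 3) := by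
    rw [ep, em]
    generalize |c| * |X| = q
    field_simp
    ring
  have : 0 ≤ (4 * η ^ 2 * (|c| * |X| - g * X) + 2 * η ^ 2 * c ^ 2 * (η ^ 2 * Z + η ^ 3 * κ)) / (2 * r ^ 3) := by
    have : 0 ≤ |c| * |X| - g * X := by linarith
    positivity
  linarith

def UU (K : Set (E n)) (M : Set (E n)) (D : ℝ) (w : E n → ℝ) : ℝ := vE K w M / √(D + Phi K w)

theorem Phi_nonneg : 0 ≤ Phi K w := by unfold Phi; positivity

theorem X_sq_le (k : Fin n) : XX K w k ^ 2 ≤ Phi K w * ZZ K w k := by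
  have h := Finset.sum_mul_sq_le_sq_mul_sq (Finset.univ : Finset (Fin n × Fin n))
    (fun p => cov K w p.1 p.2) (fun p => tri K w p.1 p.2 k)
  simp only [Fintype.sum_prod_type] at h
  exact h

set_option maxHeartbeats 2000000 in
theorem one_step (hn : 0 < n) (hK : IsCompact K) (hcv : Convex ℝ K) (hw : LC K w) {R : ℝ} (hR0 : 0 ≤ R)
    (hR : ∀ x ∈ K, ∀ i, |x i| ≤ R) {M : Set (E n)} (hM : MeasurableSet M) (D : ℝ) (hD : 0 < D)
    (η : ℝ) (hη : 0 ≤ η) (hη1 : η ≤ 1) (hηR : η * (2 * R) ≤ 1 / 2) (b : ℝ) (hb : 0 ≤ b) :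
    UU K M D w - (η ^ 2 / n) * (27648 ^ 2 * ((1 + b) * vE K w M + Real.exp (-b))) - η ^ 3 * (K1 n R / (√D) ^ 3) ≤
    (1 / (2 * n)) * ∑ k, (UU K M D (stepw K w k η) + UU K M D (stepw K w k (-η))) := by
  have Φ0 : 0 ≤ Phi K w := Phi_nonneg
  set r := √(D + Phi K w) with hr
  have r0 : 0 < r := Real.sqrt_pos.2 (by linarith)
  have r2 : r ^ 2 = D + Phi K w := Real.sq_sqrt (by linarith)
  set y := √r with hy
  have y0 : 0 < y := Real.sqrt_pos.2 r0
  have y2 : y ^ 2 = r := Real.sq_sqrt r0.le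
  have y4 : Phi K w ≤ y ^ 4 := by
    have : y ^ 4 = r ^ 2 := by rw [← y2]; ring
    rw [this, r2]; linarith
  have v0 := vE_nonneg hK hw hM
  have v1 := vE_le hK hw hM
  set v := vE K w M with hv
  have hκ : 0 ≤ K1 n R := by unfold K1; positivity
  have habs : |(-η)| = η := by rw [abs_neg, abs_of_nonneg hη]
  have habs' : |η| = η := abs_of_nonneg hη
  have Lp : ∀ k, LC K (stepw K w k η) := fun k => LC.step hK hcv hw hR k (by rw [habs']; exact hηR)
  have Lm : ∀ k, LC K (stepw K w k (-η)) := fun k => LC.step hK hcv hw hR k (by rw [habs]; exact hηR)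
  have pk : ∀ k, 2 * (v / r) - 2 * η ^ 2 * (cE K w M k ^ 2 / r + (2 * (|cE K w M k| * |XX K w k|) + v * ZZ K w k) / (2 * r ^ 3))
      - η ^ 3 * (K1 n R * v / r ^ 3) ≤ UU K M D (stepw K w k η) + UU K M D (stepw K w k (-η)) := by
    intro k
    have P1 := Phi_step hK hw hR0 hR k η (by rw [habs']; exact hη1) (Lp k).one ((Lp k).adm hK)
    have P2 := Phi_step hK hw hR0 hR k (-η) (by rw [habs]; exact hη1) (Lm k).one ((Lm k).adm hK)
    rw [habs'] at P1
    rw [habs] at P2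
    unfold UU
    apply pair_real D (Phi K w) r v ((1 - 2 * ex K w (ind M)) * cE K w M k) (cE K w M k) (XX K w k) (ZZ K w k)
      (K1 n R) η _ _ _ _ hD Φ0 r0 r2 Phi_nonneg Phi_nonneg (vE_nonneg hK (Lp k) hM) (vE_nonneg hK (Lm k) hM) hη
      (by unfold ZZ; positivity) hκ
    · rw [abs_mul]
      apply mul_le_of_le_one_left (abs_nonneg _)
      have e0 : 0 ≤ ex K w (ind M) := ex_nonneg hK hw.nonneg (fun x _ => ind_nonneg _ x)
      have e1 := hw.le_one hK hM
      rw [abs_le]; constructor <;> linarith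
    · exact vE_step hK hw k η hM
    · rw [vE_step hK hw k (-η) hM]; ring
    · exact P1
    · linarith
  have sum := Finset.sum_le_sum fun k (_ : k ∈ Finset.univ) => pk k
  have e1 : ∑ k, (2 * (v / r) - 2 * η ^ 2 * (cE K w M k ^ 2 / r + (2 * (|cE K w M k| * |XX K w k|) + v * ZZ K w k) / (2 * r ^ 3))
      - η ^ 3 * (K1 n R * v / r ^ 3)) = n * (2 * (v / r)) - 2 * η ^ 2 * ((∑ k, cE K w M k ^ 2) / r +
      (2 * (∑ k, |cE K w M k| * |XX K w k|) + v * ∑ k, ZZ K w k) / (2 * r ^ 3)) - n * (η ^ 3 * (K1 n R * v / r ^ 3)) := by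
    simp only [Finset.sum_sub_distrib, Finset.sum_const, Finset.card_univ, Fintype.card_fin, nsmul_eq_mul,
      ← Finset.mul_sum, Finset.sum_add_distrib, ← Finset.sum_div]
  rw [e1] at sum
  have b1 := c_bound1 hK hw hM y y4
  have b2 := c_bound2 hK hcv hw hM y y0 y4 b hb
  have b3 : ∑ k, ZZ K w k ≤ (27648 * y ^ 3) ^ 2 := by
    refine le_trans (le_of_eq ?_) (tri_bound hK hcv hw y y0 y4)
    unfold ZZ
    rw [Finset.sum_comm]
    refine Finset.sum_congr rfl fun i _ => ?_
    rw [Finset.sum_comm]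
  have b4 : ∑ k, |cE K w M k| * |XX K w k| ≤ √(∑ k, cE K w M k ^ 2) * (y ^ 2 * (27648 * y ^ 3)) := by
    have cs := Finset.sum_mul_sq_le_sq_mul_sq (Finset.univ) (fun k => |cE K w M k|) (fun k => |XX K w k|)
    simp only [sq_abs] at cs
    have hX : ∑ k, XX K w k ^ 2 ≤ (y ^ 2 * (27648 * y ^ 3)) ^ 2 := by
      calc ∑ k, XX K w k ^ 2 ≤ ∑ k, Phi K w * ZZ K w k := Finset.sum_le_sum fun k _ => X_sq_le k
        _ = Phi K w * ∑ k, ZZ K w k := by rw [Finset.mul_sum]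
        _ ≤ y ^ 4 * (27648 * y ^ 3) ^ 2 := mul_le_mul y4 b3 (by unfold ZZ; positivity) (by positivity)
        _ = _ := by ring
    have c0 : 0 ≤ ∑ k, cE K w M k ^ 2 := by positivity
    apply abs_le_of_sq_le_sq' _ (by positivity) |>.2
    rw [mul_pow, Real.sq_sqrt c0]
    exact cs.trans (mul_le_mul_of_nonneg_left hX c0)
  have hex := Real.exp_pos (-b)
  set ε := Real.exp (-b) with hε
  have q1 : (∑ k, cE K w M k ^ 2) / r ≤ v := by
    rw [div_le_iff₀ r0, ← y2]; exact b1
  have q2 : (2 * (∑ k, |cE K w M k| * |XX K w k|) + v * ∑ k, ZZ K w k) / (2 * r ^ 3) ≤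
      8 * 27648 * (2 * b * v + 9 * ε) + v * 27648 ^ 2 / 2 := by
    rw [div_le_iff₀ (by positivity), ← y2]
    have h1 : ∑ k, |cE K w M k| * |XX K w k| ≤ (8 * y * (2 * b * v + 9 * ε)) * (y ^ 2 * (27648 * y ^ 3)) :=
      b4.trans (mul_le_mul_of_nonneg_right b2 (by positivity))
    have h2 : v * ∑ k, ZZ K w k ≤ v * (27648 * y ^ 3) ^ 2 := mul_le_mul_of_nonneg_left b3 v0
    refine le_trans (add_le_add (mul_le_mul_of_nonneg_left h1 zero_le_two) h2) (le_of_eq ?_)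
    ring
  have q3 : (∑ k, cE K w M k ^ 2) / r + (2 * (∑ k, |cE K w M k| * |XX K w k|) + v * ∑ k, ZZ K w k) / (2 * r ^ 3) ≤
      27648 ^ 2 * ((1 + b) * v + ε) := by
    have : 0 ≤ b * v := by positivity
    linarith
  have q4 : K1 n R * v / r ^ 3 ≤ K1 n R / (√D) ^ 3 := by
    have : √D ≤ r := Real.sqrt_le_sqrt (by linarith)
    have hsD : 0 < √D := Real.sqrt_pos.2 hD
    apply div_le_div₀ hκ (mul_le_of_le_one_right hκ v1) (by positivity)
    exact pow_le_pow_left₀ hsD.le this 3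
  have hn' : (0 : ℝ) < n := by exact_mod_cast hn
  refine le_trans ?_ (mul_le_mul_of_nonneg_left sum (by positivity : (0:ℝ) ≤ 1 / (2 * n)))
  have e2 : ∀ Q S : ℝ, 1 / (2 * (n:ℝ)) * (n * (2 * (v / r)) - 2 * η ^ 2 * Q - n * (η ^ 3 * S)) =
      v / r - (η ^ 2 / n) * Q - η ^ 3 * S / 2 := by
    intro Q S; field_simp
  rw [e2]
  have r1 := mul_le_mul_of_nonneg_left q3 (by positivity : (0:ℝ) ≤ η ^ 2 / n)
  have r3 := mul_le_mul_of_nonneg_left q4 (by positivity : (0:ℝ) ≤ η ^ 3)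
  have r5 : 0 ≤ η ^ 3 * (K1 n R / (√D) ^ 3) := by positivity
  have : UU K M D w = v / r := rfl
  rw [this]
  linarith

end


abbrev St (n : ℕ) := (E n → ℝ) × (Fin n → ℕ)

def stp (K : Set (E n)) (S : St n) (k : Fin n) (h : ℝ) : St n :=
  (stepw K S.1 k h, fun j => S.2 j + if j = k then 1 else 0)

def av (K : Set (E n)) (η : ℝ) (F : St n → ℝ) (S : St n) : ℝ :=
  (1 / (2 * n)) * ∑ k, (F (stp K S k η) + F (stp K S k (-η)))

structure Good (K : Set (E n)) (η : ℝ) (S : St n) : Prop where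
  lc : LC K S.1
  strong : ∀ x ∈ K, ∀ y ∈ K, S.1 x * S.1 y ≤
    Real.exp (-(η ^ 2 / 16 * ∑ k, (S.2 k : ℝ) * (x k - y k) ^ 2)) *
      S.1 ((1 - 1 / 2 : ℝ) • x + (1 / 2 : ℝ) • y) ^ 2

section
variable {K : Set (E n)} {η : ℝ}

theorem Good.step (hK : IsCompact K) (hcv : Convex ℝ K) {R : ℝ}
    (hR : ∀ x ∈ K, ∀ i, |x i| ≤ R) {S : St n} (hS : Good K η S) (k : Fin n)
    {h : ℝ} (hh : |h| * (2 * R) ≤ 1 / 2) (hη : h ^ 2 = η ^ 2) : Good K η (stp K S k h) where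
  lc := LC.step hK hcv hS.lc hR k hh
  strong := by
    intro x hx y hy
    have hz : (1 - 1 / 2 : ℝ) • x + (1 / 2 : ℝ) • y ∈ K := hcv hx hy (by norm_num) (by norm_num) (by norm_num)
    have st := hS.strong x hx y hy
    have fx := fac_bd hK hS.lc hR k hh x hx
    have fy := fac_bd hK hS.lc hR k hh y hy
    have fz := fac_bd hK hS.lc hR k hh _ hz
    have ta := tl_affine (K := K) (w := S.1) k x y (1 / 2)
    have td : tl K S.1 k x - tl K S.1 k y = x k - y k := by unfold tl; ring
    set z := (1 - 1 / 2 : ℝ) • x + (1 / 2 : ℝ) • y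
    have w0 := hS.lc.nonneg x hx
    have w1 := hS.lc.nonneg y hy
    show S.1 x * (1 + h * tl K S.1 k x) * (S.1 y * (1 + h * tl K S.1 k y)) ≤ _ * (S.1 z * (1 + h * tl K S.1 k z)) ^ 2
    set a := tl K S.1 k x
    set b := tl K S.1 k y
    have hd : (x k - y k) ^ 2 = (a - b) ^ 2 := by rw [td]
    have e1 : (1 + h * a) * (1 + h * b) = (1 + h * tl K S.1 k z) ^ 2 - h ^ 2 * (a - b) ^ 2 / 4 := by
      rw [ta]; ring
    have e2 : (1 + h * a) * (1 + h * b) ≤ Real.exp (-(η ^ 2 / 16 * (x k - y k) ^ 2)) * (1 + h * tl K S.1 k z) ^ 2 := by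
      rw [e1, hd, ← hη]
      set m := 1 + h * tl K S.1 k z
      have h1 := Real.one_sub_le_exp_neg (h ^ 2 / 16 * (a - b) ^ 2)
      have h2 : (1 - h ^ 2 / 16 * (a - b) ^ 2) * m ^ 2 ≤ Real.exp (-(h ^ 2 / 16 * (a - b) ^ 2)) * m ^ 2 :=
        mul_le_mul_of_nonneg_right h1 (sq_nonneg _)
      have h3 : m ^ 2 ≤ 4 := by nlinarith [fz.1, fz.2]
      have h4 : 0 ≤ h ^ 2 * (a - b) ^ 2 := by positivity
      nlinarith
    have e3 : ∑ j, (((stp K S k h).2 j : ℕ) : ℝ) * (x j - y j) ^ 2 =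
        (∑ j, (S.2 j : ℝ) * (x j - y j) ^ 2) + (x k - y k) ^ 2 := by
      simp only [stp]
      push_cast
      simp [add_mul, Finset.sum_add_distrib]
    rw [e3, mul_add (η ^ 2 / 16), neg_add, Real.exp_add]
    have := mul_le_mul st e2 (mul_nonneg (by linarith) (by linarith)) (by positivity)
    calc _ = S.1 x * S.1 y * ((1 + h * a) * (1 + h * b)) := by ring
      _ ≤ _ := this
      _ = _ := by ring

theorem av_lin (hn : 0 < n) (a b c : ℝ) (F G : St n → ℝ) :
    av K η (fun S => a * F S + b * G S + c) = fun S => a * av K η F S + b * av K η G S + c := by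
  ext S
  unfold av
  have hn' : (n : ℝ) ≠ 0 := by positivity
  have : ∀ k, (a * F (stp K S k η) + b * G (stp K S k η) + c + (a * F (stp K S k (-η)) + b * G (stp K S k (-η)) + c))
      = a * (F (stp K S k η) + F (stp K S k (-η))) + b * (G (stp K S k η) + G (stp K S k (-η))) + 2 * c := by
    intro k; ring
  simp only [this, Finset.sum_add_distrib, ← Finset.mul_sum, Finset.sum_const, Finset.card_univ,
    Fintype.card_fin, nsmul_eq_mul]
  field_simp

theorem it_lin (hn : 0 < n) (a b c : ℝ) (F G : St n → ℝ) (j : ℕ) :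
    (av K η)^[j] (fun S => a * F S + b * G S + c) =
      fun S => a * (av K η)^[j] F S + b * (av K η)^[j] G S + c := by
  induction j with
  | zero => rfl
  | succ j ih => rw [Function.iterate_succ_apply', ih, av_lin hn]; simp only [Function.iterate_succ_apply']

variable {R : ℝ}

theorem av_mono (hK : IsCompact K) (hcv : Convex ℝ K) (hR : ∀ x ∈ K, ∀ i, |x i| ≤ R) (hη : 0 ≤ η)
    (hηR : η * (2 * R) ≤ 1 / 2) {F G : St n → ℝ} (h : ∀ S, Good K η S → F S ≤ G S) :
    ∀ S, Good K η S → av K η F S ≤ av K η G S := by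
  intro S hS
  unfold av
  apply mul_le_mul_of_nonneg_left _ (by positivity)
  apply Finset.sum_le_sum
  intro k _
  apply add_le_add
  · exact h _ (hS.step hK hcv hR k (by rwa [abs_of_nonneg hη]) rfl)
  · exact h _ (hS.step hK hcv hR k (by rwa [abs_neg, abs_of_nonneg hη]) (by ring))

theorem it_mono (hK : IsCompact K) (hcv : Convex ℝ K) (hR : ∀ x ∈ K, ∀ i, |x i| ≤ R) (hη : 0 ≤ η)
    (hηR : η * (2 * R) ≤ 1 / 2) {F G : St n → ℝ} (h : ∀ S, Good K η S → F S ≤ G S) (j : ℕ) :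
    ∀ S, Good K η S → (av K η)^[j] F S ≤ (av K η)^[j] G S := by
  induction j with
  | zero => exact h
  | succ j ih =>
    simp only [Function.iterate_succ_apply']
    exact av_mono hK hcv hR hη hηR ih

theorem it_super (hK : IsCompact K) (hcv : Convex ℝ K) (hR : ∀ x ∈ K, ∀ i, |x i| ≤ R) (hη : 0 ≤ η)
    (hηR : η * (2 * R) ≤ 1 / 2) {F : St n → ℝ} (h : ∀ S, Good K η S → av K η F S ≤ F S) (j : ℕ) :
    ∀ S, Good K η S → (av K η)^[j] F S ≤ F S := by
  induction j with
  | zero => intro S _; exact le_rfl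
  | succ j ih =>
    intro S hS
    rw [Function.iterate_succ_apply']
    exact (av_mono hK hcv hR hη hηR ih S hS).trans (h S hS)

theorem av_q (hn : 0 < n) (hK : IsCompact K) {M : Set (E n)} (hM : MeasurableSet M) :
    ∀ S, Good K η S → av K η (fun S => ex K S.1 (ind M)) S ≤ ex K S.1 (ind M) := by
  intro S hS
  unfold av
  have hn' : (n : ℝ) ≠ 0 := by positivity
  have : ∀ k, ex K (stp K S k η).1 (ind M) + ex K (stp K S k (-η)).1 (ind M) = 2 * ex K S.1 (ind M) := by
    intro k
    simp only [stp]
    rw [e_step hK hS.lc k η hM, e_step hK hS.lc k (-η) hM]; ring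
  simp only [this, Finset.sum_const, Finset.card_univ, Fintype.card_fin, nsmul_eq_mul]
  apply le_of_eq; field_simp

theorem av_v (hn : 0 < n) (hK : IsCompact K) {M : Set (E n)} (hM : MeasurableSet M) :
    ∀ S, Good K η S → av K η (fun S => vE K S.1 M) S ≤ vE K S.1 M := by
  intro S hS
  unfold av
  have hn' : (n : ℝ) ≠ 0 := by positivity
  have : ∀ k, vE K (stp K S k η).1 M + vE K (stp K S k (-η)).1 M ≤ 2 * vE K S.1 M := by
    intro k
    simp only [stp]
    rw [vE_step hK hS.lc k η hM, vE_step hK hS.lc k (-η) hM]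
    have : 0 ≤ η ^ 2 * cE K S.1 M k ^ 2 := by positivity
    nlinarith
  refine (mul_le_mul_of_nonneg_left (Finset.sum_le_sum fun k _ => this k) (by positivity)).trans (le_of_eq ?_)
  simp only [Finset.sum_const, Finset.card_univ, Fintype.card_fin, nsmul_eq_mul]
  field_simp

theorem it_U (hn : 0 < n) (hK : IsCompact K) (hcv : Convex ℝ K) (hR : ∀ x ∈ K, ∀ i, |x i| ≤ R) (hη : 0 ≤ η)
    (hηR : η * (2 * R) ≤ 1 / 2) {M : Set (E n)} (hM : MeasurableSet M) (U : St n → ℝ) (c1 c2 : ℝ) (hc1 : 0 ≤ c1)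
    (h : ∀ S, Good K η S → U S - c1 * vE K S.1 M - c2 ≤ av K η U S) (j : ℕ) :
    ∀ S, Good K η S → U S - j * (c1 * vE K S.1 M + c2) ≤ (av K η)^[j] U S := by
  induction j with
  | zero => intro S _; simp
  | succ j ih =>
    intro S hS
    rw [Function.iterate_succ_apply']
    have ih' : ∀ S, Good K η S → 1 * U S + (-(j * c1)) * (fun S : St n => vE K S.1 M) S + (-(j * c2)) ≤ (av K η)^[j] U S := by
      intro S hS
      refine le_trans (le_of_eq ?_) (ih S hS)
      ring
    have h1 := av_mono hK hcv hR hη hηR ih' S hS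
    rw [av_lin hn] at h1
    refine le_trans ?_ h1
    have h2 := h S hS
    have h3 := av_v hn hK hM S hS
    have h4 : (j * c1) * av K η (fun S : St n => vE K S.1 M) S ≤ (j * c1) * vE K S.1 M :=
      mul_le_mul_of_nonneg_left h3 (by positivity)
    push_cast
    nlinarith

def QQ (τ : ℝ) (S : St n) : ℝ := ∑ k, ((S.2 k : ℝ) - τ) ^ 2

theorem av_Q (hn : 0 < n) (τ : ℝ) (S : St n) : av K η (QQ τ) S ≤ QQ (τ - 1 / n) S + 1 := by
  unfold av
  have hn' : (0 : ℝ) < n := by positivity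
  have e : ∀ k h, QQ τ (stp K S k h) = QQ τ S + 2 * ((S.2 k : ℝ) - τ) + 1 := by
    intro k h
    unfold QQ stp
    have : ∀ j, (((S.2 j + if j = k then 1 else 0 : ℕ) : ℝ) - τ) ^ 2 = ((S.2 j : ℝ) - τ) ^ 2 +
        if j = k then (2 * ((S.2 j : ℝ) - τ) + 1) else 0 := by
      intro j
      by_cases hj : j = k
      · simp [hj]; ring
      · simp [hj]
    simp only [this, Finset.sum_add_distrib, Finset.sum_ite_eq', Finset.mem_univ, if_true]
    ring
  have e2 : QQ (τ - 1 / n) S = QQ τ S + (2 / n) * ∑ k, ((S.2 k : ℝ) - τ) + 1 / n := by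
    unfold QQ
    have : ∀ k, ((S.2 k : ℝ) - (τ - 1 / n)) ^ 2 = ((S.2 k : ℝ) - τ) ^ 2 + (2 / n) * ((S.2 k : ℝ) - τ) + 1 / n ^ 2 := by
      intro k; ring
    simp only [this, Finset.sum_add_distrib, ← Finset.mul_sum, Finset.sum_const, Finset.card_univ,
      Fintype.card_fin, nsmul_eq_mul]
    field_simp
  simp only [e, e2, Finset.sum_add_distrib, ← Finset.mul_sum, Finset.sum_const, Finset.card_univ,
      Fintype.card_fin, nsmul_eq_mul]
  have : 0 ≤ 1 / (n : ℝ) := by positivity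
  have e3 : ∀ q s : ℝ, 1 / (2 * (n : ℝ)) * (n * q + 2 * s + n * 1 + (n * q + 2 * s + n * 1)) = q + 2 / n * s + 1 := by
    intro q s; field_simp; ring
  rw [e3]; linarith

theorem av_mono' {F G : St n → ℝ} (h : ∀ S, F S ≤ G S) (S : St n) : av K η F S ≤ av K η G S := by
  unfold av
  apply mul_le_mul_of_nonneg_left _ (by positivity)
  apply Finset.sum_le_sum
  intro k _
  linarith [h (stp K S k η), h (stp K S k (-η))]

theorem it_Q (hn : 0 < n) (j : ℕ) (τ : ℝ) (S : St n) :
    (av K η)^[j] (QQ τ) S ≤ QQ (τ - j / n) S + j := by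
  have hn' : (0 : ℝ) < n := by positivity
  induction j generalizing S with
  | zero => simp
  | succ j ih =>
    rw [Function.iterate_succ_apply']
    have : av K η ((av K η)^[j] (QQ τ)) S ≤ av K η (fun S => 1 * QQ (τ - j / n) S + 0 * QQ τ S + j) S := by
      apply av_mono'
      intro S
      linarith [ih S]
    rw [av_lin hn] at this
    have h2 := av_Q (K := K) (η := η) hn (τ - j / n) S
    have e : τ - (j : ℝ) / n - 1 / n = τ - ((j + 1 : ℕ) : ℝ) / n := by push_cast; ring
    rw [e] at h2
    push_cast at *
    linarith

theorem leaf (hn : 0 < n) (hK : IsCompact K) (hcv : Convex ℝ K) {M F : Set (E n)} (hM : MeasurableSet M)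
    (hF : MeasurableSet F) (δ : ℝ) (hδ : 0 < δ) (hMF : ∀ x ∈ M, ∀ y ∈ F, δ ≤ ‖x - y‖) (N : ℕ) (hN : 0 < N)
    (S : St n) (hS : Good K η S) :
    vE K S.1 M ≤ ex K S.1 (ind (M ∪ F)ᶜ) + Real.exp (-(η ^ 2 * N / n * δ ^ 2 / 32)) +
      (4 * n ^ 2 / N ^ 2) * QQ (N / n) S := by
  have hn' : (0 : ℝ) < n := by positivity
  have hN' : (0 : ℝ) < N := by positivity
  have v1 := vE_le hK hS.lc hM
  have rest0 : 0 ≤ ex K S.1 (ind (M ∪ F)ᶜ) := ex_nonneg hK hS.lc.nonneg (fun x _ => ind_nonneg _ x)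
  have exp0 := Real.exp_pos (-(η ^ 2 * N / n * δ ^ 2 / 32))
  have Q0 : 0 ≤ QQ (N / n) S := by unfold QQ; positivity
  by_cases hall : ∀ k, (N : ℝ) / (2 * n) ≤ S.2 k
  · set e := ex K S.1 (ind M) with he
    set f := ex K S.1 (ind F) with hf
    have e0 : 0 ≤ e := ex_nonneg hK hS.lc.nonneg (fun x _ => ind_nonneg _ x)
    have f0 : 0 ≤ f := ex_nonneg hK hS.lc.nonneg (fun x _ => ind_nonneg _ x)
    have e1 : e ≤ 1 := hS.lc.le_one hK hM
    set t := η ^ 2 * N / n * δ ^ 2 / 32 with ht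
    have key := pl_ex hK hS.lc.cont hS.lc.nonneg hM hF MeasurableSet.univ (1 / 2) (Real.exp (-(t / 2)))
      (by norm_num) (by norm_num) (Real.exp_pos _).le (by
        intro x hx hxK y hy hyK
        have hz : (1 - 1 / 2 : ℝ) • x + (1 / 2 : ℝ) • y ∈ K := hcv hxK hyK (by norm_num) (by norm_num) (by norm_num)
        refine ⟨mem_univ _, hz, ?_⟩
        have st := hS.strong x hxK y hyK
        set z := (1 - 1 / 2 : ℝ) • x + (1 / 2 : ℝ) • y
        have hsum : (N : ℝ) / (2 * n) * δ ^ 2 ≤ ∑ k, (S.2 k : ℝ) * (x k - y k) ^ 2 := by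
          have h1 : δ ^ 2 ≤ ∑ k, (x k - y k) ^ 2 := by
            have := hMF x hx y hy
            have h2 : δ ^ 2 ≤ ‖x - y‖ ^ 2 := pow_le_pow_left₀ hδ.le this 2
            rw [EuclideanSpace.norm_sq_eq] at h2
            simpa using h2
          calc _ ≤ (N : ℝ) / (2 * n) * ∑ k, (x k - y k) ^ 2 := mul_le_mul_of_nonneg_left h1 (by positivity)
            _ = ∑ k, (N : ℝ) / (2 * n) * (x k - y k) ^ 2 := by rw [Finset.mul_sum]
            _ ≤ _ := Finset.sum_le_sum fun k _ => mul_le_mul_of_nonneg_right (hall k) (sq_nonneg _)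
        have hexp : Real.exp (-(η ^ 2 / 16 * ∑ k, (S.2 k : ℝ) * (x k - y k) ^ 2)) ≤ Real.exp (-t) := by
          apply Real.exp_le_exp.2
          apply neg_le_neg
          have : t = η ^ 2 / 16 * ((N : ℝ) / (2 * n) * δ ^ 2) := by rw [ht]; ring
          rw [this]
          exact mul_le_mul_of_nonneg_left hsum (by positivity)
        have st2 : S.1 x * S.1 y ≤ (Real.exp (-(t / 2)) * S.1 z) ^ 2 := by
          refine st.trans ?_
          rw [mul_pow, ← Real.exp_nat_mul]
          have : ((2 : ℕ) : ℝ) * (-(t / 2)) = -t := by push_cast; ring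
          rw [this]
          exact mul_le_mul_of_nonneg_right hexp (sq_nonneg _)
        have : (1 : ℝ) - 1 / 2 = 1 / 2 := by norm_num
        rw [this, ← Real.mul_rpow (hS.lc.nonneg x hxK) (hS.lc.nonneg y hyK), ← Real.sqrt_eq_rpow]
        apply Real.sqrt_le_iff.2
        exact ⟨mul_nonneg (Real.exp_pos _).le (hS.lc.nonneg z hz), st2⟩)
    have hu : ex K S.1 (ind univ) = 1 := by
      have : ind (univ : Set (E n)) = fun _ => 1 := by ext x; simp [ind]
      rw [this]; exact hS.lc.one
    rw [hu, mul_one] at key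
    have : (1 : ℝ) - 1 / 2 = 1 / 2 := by norm_num
    rw [this, ← Real.mul_rpow e0 f0, ← Real.sqrt_eq_rpow, Real.sqrt_le_left (Real.exp_pos _).le,
      ← Real.exp_nat_mul] at key
    have h2 : ((2 : ℕ) : ℝ) * (-(t / 2)) = -t := by push_cast; ring
    rw [h2] at key
    have hsum : 1 - e ≤ f + ex K S.1 (ind (M ∪ F)ᶜ) := by
      rw [he, ← hS.lc.compl hK hM, hf, ← ex_add hK (hS.lc.adm hK) (Adm.ind hF) (Adm.ind (hM.union hF).compl)]
      apply ex_mono hK (hS.lc.adm hK) hS.lc.nonneg (Adm.ind hM.compl)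
        ((Adm.ind hF).add (Adm.ind (hM.union hF).compl))
      intro x _
      unfold ind
      by_cases a : x ∈ M <;> by_cases b : x ∈ F <;> simp [a, b]
    have : vE K S.1 M = e * (1 - e) := rfl
    rw [this]
    have h5 : 0 ≤ (4 * (n:ℝ) ^ 2 / N ^ 2) * QQ (N / n) S := by positivity
    have h6 : e * (1 - e) ≤ e * (f + ex K S.1 (ind (M ∪ F)ᶜ)) := mul_le_mul_of_nonneg_left hsum e0
    have h7 : e * ex K S.1 (ind (M ∪ F)ᶜ) ≤ 1 * ex K S.1 (ind (M ∪ F)ᶜ) := mul_le_mul_of_nonneg_right e1 rest0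
    nlinarith
  · push Not at hall
    obtain ⟨k, hk⟩ := hall
    have : 1 ≤ (4 * (n:ℝ) ^ 2 / N ^ 2) * QQ (N / n) S := by
      have h1 : ((S.2 k : ℝ) - N / n) ^ 2 ≤ QQ (N / n) S := by
        unfold QQ
        exact Finset.single_le_sum (f := fun k => ((S.2 k : ℝ) - N / n) ^ 2) (fun _ _ => sq_nonneg _) (Finset.mem_univ k)
      have h2 : ((N : ℝ) / (2 * n)) ^ 2 ≤ ((S.2 k : ℝ) - N / n) ^ 2 := by
        have : (N : ℝ) / n = 2 * (N / (2 * n)) := by field_simp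
        rw [this]
        have p : 0 ≤ (N : ℝ) / (2 * n) := by positivity
        nlinarith
      calc (1 : ℝ) = (4 * (n:ℝ) ^ 2 / N ^ 2) * ((N : ℝ) / (2 * n)) ^ 2 := by field_simp; norm_num
        _ ≤ _ := mul_le_mul_of_nonneg_left (h2.trans h1) (by positivity)
    linarith

theorem loc_ineq (hn : 0 < n) (hK : IsCompact K) (hcv : Convex ℝ K) (hL : LC K (fun _ => 1)) (hR0 : 0 ≤ R)
    (hR : ∀ x ∈ K, ∀ i, |x i| ≤ R) {M F : Set (E n)} (hM : MeasurableSet M)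
    (hF : MeasurableSet F) (δ : ℝ) (hδ : 0 < δ) (hMF : ∀ x ∈ M, ∀ y ∈ F, δ ≤ ‖x - y‖)
    (D : ℝ) (hD : 0 < D) (b : ℝ) (hb : 0 ≤ b) (N : ℕ) (hN : 0 < N)
    (hη : 0 ≤ η) (hη1 : η ≤ 1) (hηR : η * (2 * R) ≤ 1 / 2) :
    √D * (UU K M D (fun _ => 1) - N * (η ^ 2 / n * 27648 ^ 2 * (1 + b) * vE K (fun _ => 1) M +
      (η ^ 2 / n * 27648 ^ 2 * Real.exp (-b) + η ^ 3 * (K1 n R / (√D) ^ 3)))) ≤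
    ex K (fun _ => 1) (ind (M ∪ F)ᶜ) + Real.exp (-(η ^ 2 * N / n * δ ^ 2 / 32)) + 4 * n ^ 2 / N := by
  have hn' : (0 : ℝ) < n := by positivity
  have hN' : (0 : ℝ) < N := by positivity
  set S0 : St n := (fun _ => 1, fun _ => 0) with hS0
  have g0 : Good K η S0 := ⟨hL, by intro x _ y _; simp [hS0]⟩
  have h1 := it_U hn hK hcv hR hη hηR hM (fun S => UU K M D S.1) (η ^ 2 / n * 27648 ^ 2 * (1 + b))
    (η ^ 2 / n * 27648 ^ 2 * Real.exp (-b) + η ^ 3 * (K1 n R / (√D) ^ 3)) (by positivity) (by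
      intro S hS
      have := one_step hn hK hcv hS.lc hR0 hR hM D hD η hη hη1 hηR b hb
      refine le_trans (le_of_eq ?_) this
      ring) N S0 g0
  have h2 : (av K η)^[N] (fun S => UU K M D S.1) S0 ≤ (av K η)^[N] (fun S => (1 / √D) * (fun S : St n => vE K S.1 M) S
      + 0 * (fun S : St n => vE K S.1 M) S + 0) S0 := by
    apply it_mono hK hcv hR hη hηR _ N S0 g0
    intro S hS
    have sD : 0 < √D := Real.sqrt_pos.2 hD
    have : √D ≤ √(D + Phi K S.1) := Real.sqrt_le_sqrt (by linarith [Phi_nonneg (K := K) (w := S.1)])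
    unfold UU
    simp only [zero_mul, add_zero]
    rw [one_div, inv_mul_eq_div]
    exact div_le_div_of_nonneg_left (vE_nonneg hK hS.lc hM) sD this
  rw [it_lin hn] at h2
  have h3 : (av K η)^[N] (fun S => vE K S.1 M) S0 ≤ (av K η)^[N] (fun S => 1 * (fun S : St n => ex K S.1 (ind (M ∪ F)ᶜ)) S +
      (4 * n ^ 2 / N ^ 2) * QQ (N / n) S + Real.exp (-(η ^ 2 * N / n * δ ^ 2 / 32))) S0 := by
    apply it_mono hK hcv hR hη hηR _ N S0 g0
    intro S hS
    have := leaf hn hK hcv hM hF δ hδ hMF N hN S hS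
    linarith
  rw [it_lin hn] at h3
  have h4 := it_super hK hcv hR hη hηR (av_q hn hK (hM.union hF).compl) N S0 g0
  have h5 := it_Q (K := K) (η := η) hn N (N / n) S0
  have h6 : QQ ((N : ℝ) / n - N / n) S0 = 0 := by unfold QQ; simp [hS0]
  rw [h6, zero_add] at h5
  have h7 : (4 * (n:ℝ) ^ 2 / N ^ 2) * (av K η)^[N] (QQ (N / n)) S0 ≤ (4 * (n:ℝ) ^ 2 / N ^ 2) * N :=
    mul_le_mul_of_nonneg_left h5 (by positivity)
  have e7 : (4 * (n:ℝ) ^ 2 / N ^ 2) * N = 4 * n ^ 2 / N := by field_simp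
  have sD : 0 < √D := Real.sqrt_pos.2 hD
  have h8 := mul_le_mul_of_nonneg_left (h1.trans h2) sD.le
  have e8 : ∀ z : ℝ, √D * (1 / √D * z + 0 * z + 0) = z := by intro z; field_simp; ring
  rw [e8] at h8
  simp only [] at h3 h4
  refine h8.trans (h3.trans ?_)
  have h4' : (av K η)^[N] (fun S : St n => ex K S.1 (ind (M ∪ F)ᶜ)) S0 ≤ ex K (fun _ => 1) (ind (M ∪ F)ᶜ) := h4
  linarith

theorem separation (hn : 0 < n) (hK : IsCompact K) (hcv : Convex ℝ K) (hL : LC K (fun _ => 1))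
    {M F : Set (E n)} (hM : MeasurableSet M)
    (hF : MeasurableSet F) (δ : ℝ) (hδ : 0 < δ) (hMF : ∀ x ∈ M, ∀ y ∈ F, δ ≤ ‖x - y‖)
    (D : ℝ) (hD : 0 < D) (hPhi : Phi K (fun _ => 1) ≤ D) (b : ℝ) (hb : 0 ≤ b)
    (hbv : Real.exp (-b) = vE K (fun _ => 1) M) (s : ℝ) (hs : 0 < s)
    (hs1 : √D * s * (27648 ^ 2 * (2 + b)) ≤ 1 / 10) :
    0.6 * vE K (fun _ => 1) M ≤ ex K (fun _ => 1) (ind (M ∪ F)ᶜ) + Real.exp (-(s * δ ^ 2 / 32)) := by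
  have hn' : (0 : ℝ) < n := by positivity
  set v := vE K (fun _ => 1) M with hv
  have v0 : 0 < v := by rw [← hbv]; exact Real.exp_pos _
  obtain ⟨R0, hR0⟩ := hK.exists_bound_of_continuousOn (f := fun x : E n => x) continuousOn_id
  set R := max R0 0 with hRd
  have hR : ∀ x ∈ K, ∀ i, |x i| ≤ R := by
    intro x hx i
    have := PiLp.norm_apply_le x i
    rw [Real.norm_eq_abs] at this
    exact this.trans ((hR0 x hx).trans (le_max_left _ _))
  have sD : 0 < √D := Real.sqrt_pos.2 hD
  have tη : Filter.Tendsto (fun N : ℕ => √(n * s / N)) Filter.atTop (nhds 0) := by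
    have : Filter.Tendsto (fun N : ℕ => (n * s) / (N : ℝ)) Filter.atTop (nhds 0) :=
      tendsto_const_div_atTop_nhds_zero_nat _
    have h := (Real.continuous_sqrt.tendsto 0).comp this
    rw [Real.sqrt_zero] at h
    exact h
  set κ := √D * (n * s) * (K1 n R / (√D) ^ 3) with hκ
  have terr : Filter.Tendsto (fun N : ℕ => ex K (fun _ => 1) (ind (M ∪ F)ᶜ) + Real.exp (-(s * δ ^ 2 / 32))
      + (κ * √(n * s / N) + 4 * n ^ 2 / N)) Filter.atTop
      (nhds (ex K (fun _ => 1) (ind (M ∪ F)ᶜ) + Real.exp (-(s * δ ^ 2 / 32)) + (κ * 0 + 0))) := by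
    apply Filter.Tendsto.add tendsto_const_nhds
    apply Filter.Tendsto.add (tη.const_mul κ)
    exact tendsto_const_div_atTop_nhds_zero_nat _
  rw [mul_zero, add_zero, add_zero] at terr
  apply ge_of_tendsto terr
  have ev1 : ∀ᶠ N : ℕ in Filter.atTop, √(n * s / N) < 1 := tη.eventually (gt_mem_nhds zero_lt_one)
  have ev2 : ∀ᶠ N : ℕ in Filter.atTop, √(n * s / N) * (2 * R) < 1 / 2 := by
    have : Filter.Tendsto (fun N : ℕ => √(n * s / N) * (2 * R)) Filter.atTop (nhds (0 * (2 * R))) :=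
      tη.mul_const _
    rw [zero_mul] at this
    exact this.eventually (gt_mem_nhds (by norm_num))
  filter_upwards [ev1, ev2, Filter.eventually_gt_atTop 0] with N h1 h2 hN
  have hN' : (0 : ℝ) < N := by positivity
  set η := √(n * s / N) with hη
  have η2 : η ^ 2 = n * s / N := Real.sq_sqrt (by positivity)
  have key := loc_ineq (η := η) hn hK hcv hL (le_max_right R0 0) hR hM hF δ hδ hMF D hD b hb N hN
    (Real.sqrt_nonneg _) h1.le h2.le
  have e1 : η ^ 2 * N / n = s := by rw [η2]; field_simp
  rw [e1] at key
  have e2 : √D * (UU K M D (fun _ => 1) - N * (η ^ 2 / n * 27648 ^ 2 * (1 + b) * v +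
      (η ^ 2 / n * 27648 ^ 2 * Real.exp (-b) + η ^ 3 * (K1 n R / (√D) ^ 3)))) =
      √D * UU K M D (fun _ => 1) - √D * s * (27648 ^ 2 * (2 + b)) * v - κ * η := by
    rw [hbv]
    have : η ^ 3 = n * s / N * η := by rw [← η2]; ring
    rw [this, η2, hκ]
    generalize K1 n R / (√D) ^ 3 = z
    field_simp
    ring
  rw [e2] at key
  have hU : 0.7 * v ≤ √D * UU K M D (fun _ => 1) := by
    unfold UU
    have Φ0 := Phi_nonneg (K := K) (w := fun _ => 1)
    have h3 : √(D + Phi K (fun _ => 1)) ≤ √2 * √D := by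
      rw [← Real.sqrt_mul (by norm_num)]
      exact Real.sqrt_le_sqrt (by linarith)
    have h4 : 0 < √(D + Phi K (fun _ => 1)) := Real.sqrt_pos.2 (by linarith)
    rw [← mul_div_assoc, le_div_iff₀ h4]
    have h5 : √2 ≤ 1.42 := by rw [Real.sqrt_le_left (by norm_num)]; norm_num
    have h6 : √(D + Phi K (fun _ => 1)) ≤ 1.42 * √D := h3.trans (mul_le_mul_of_nonneg_right h5 sD.le)
    have : vE K (fun _ => 1) M = v := rfl
    rw [this]
    calc 0.7 * v * √(D + Phi K (fun _ => 1)) ≤ 0.7 * v * (1.42 * √D) := mul_le_mul_of_nonneg_left h6 (by positivity)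
      _ = 0.994 * (√D * v) := by ring
      _ ≤ _ := by nlinarith [mul_pos sD v0]
  have h8 := mul_le_mul_of_nonneg_right hs1 v0.le
  linarith

end


/-- probability of `M` under the uniform measure on `K` -/
def pr (K M : Set (E n)) : ℝ := ex K (fun _ => 1) (ind M)

section
variable {K : Set (E n)}

theorem pr_mono (hK : IsCompact K) {M M' : Set (E n)} (hM : MeasurableSet M) (hM' : MeasurableSet M')
    (h : M ⊆ M') : pr K M ≤ pr K M' := by
  apply ex_mono hK (Adm.const 1) (fun _ _ => zero_le_one) (Adm.ind hM) (Adm.ind hM')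
  intro x _
  exact indicator_le_indicator_of_subset h (fun _ => zero_le_one) x

theorem pr_nonneg (hK : IsCompact K) (M : Set (E n)) : 0 ≤ pr K M :=
  ex_nonneg hK (fun _ _ => zero_le_one) (fun x _ => ind_nonneg _ x)

theorem pr_eq (hK : IsCompact K) {M : Set (E n)} (hM : MeasurableSet M) :
    pr K M = (volume.restrict K M).toReal := by
  unfold pr ex ind
  simp only [one_mul]
  rw [integral_indicator hM]
  simp [Measure.real]

theorem tail_step (hn : 0 < n) (hK : IsCompact K) (hcv : Convex ℝ K) (hL : LC K (fun _ => 1))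
    (D : ℝ) (hD : 0 < D) (hPhi : Phi K (fun _ => 1) ≤ D) (A : ℝ) (hA : 0 < A)
    (hA2 : A ^ 2 = 484 * 27648 ^ 2 * √D) (g : E n → ℝ) (hg : Continuous g)
    (hg1 : ∀ x y, g y - g x ≤ ‖x - y‖) (a b' : ℝ) (hb' : 0 ≤ b') (hG : pr K {x | a < g x} ≤ 1 / 2)
    (hb : Real.exp (-b') ≤ pr K {x | a < g x} / 2) :
    pr K {x | a + A * (2 + b') < g x} ≤ 3 / 4 * pr K {x | a < g x} := by
  have mm : ∀ c, MeasurableSet {x : E n | c < g x} := fun c => measurableSet_lt measurable_const hg.measurable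
  set G := pr K {x | a < g x} with hGd
  set M : Set (E n) := {x | a < g x}ᶜ with hM
  have mM : MeasurableSet M := (mm a).compl
  have ev : vE K (fun _ => 1) M = (1 - G) * G := by
    unfold vE
    rw [hM, hL.compl hK (mm a)]
    show (1 - G) * (1 - (1 - G)) = _
    ring
  have G0 : 0 < G := by linarith [Real.exp_pos (-b')]
  have v0 : 0 < (1 - G) * G := mul_pos (by linarith) G0
  have vG : G / 2 ≤ (1 - G) * G := by nlinarith
  set b := -Real.log ((1 - G) * G) with hbd
  have eb : Real.exp (-b) = (1 - G) * G := by rw [hbd, neg_neg, Real.exp_log v0]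
  have b0 : 0 ≤ b := by
    rw [hbd, neg_nonneg]
    apply Real.log_nonpos v0.le
    nlinarith [sq_nonneg G, sq_nonneg (1 - G)]
  have bb : b ≤ b' := by
    have : Real.exp (-b') ≤ Real.exp (-b) := by rw [eb]; linarith
    have := Real.exp_le_exp.1 this
    linarith
  have sD : 0 < √D := Real.sqrt_pos.2 hD
  set δ := A * (2 + b) with hδ
  have δ0 : 0 < δ := by positivity
  set F : Set (E n) := {x | a + δ < g x} with hF
  set s := 1 / (10 * √D * 27648 ^ 2 * (2 + b)) with hs
  have s0 : 0 < s := by positivity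
  have key := separation hn hK hcv hL mM (mm (a + δ)) δ δ0 (by
    intro x hx y hy
    have h1 : ¬ (a < g x) := hx
    have h2 : a + δ < g y := hy
    have := hg1 x y
    linarith) D hD hPhi b b0 (by rw [ev, eb]) s s0 (by
      rw [hs]; apply le_of_eq; field_simp)
  rw [ev] at key
  have e1 : s * δ ^ 2 / 32 = 484 / 320 * (2 + b) := by
    rw [hs, hδ, mul_pow, hA2]; field_simp; norm_num
  have e2 : Real.exp (-(s * δ ^ 2 / 32)) ≤ 0.1 * ((1 - G) * G) := by
    rw [e1, ← eb]
    have : -(484 / 320 * (2 + b)) ≤ -3 + -b := by linarith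
    refine (Real.exp_le_exp.2 this).trans ?_
    rw [Real.exp_add]
    apply mul_le_mul_of_nonneg_right _ (Real.exp_pos _).le
    rw [Real.exp_neg]
    have h3 : (10 : ℝ) ≤ Real.exp 3 := by
      have h := Real.exp_one_gt_d9
      have : Real.exp 3 = Real.exp 1 ^ 3 := by rw [← Real.exp_nat_mul]; norm_num
      rw [this]
      calc (10 : ℝ) ≤ 2.7 ^ 3 := by norm_num
        _ ≤ _ := pow_le_pow_left₀ (by norm_num) (by linarith) 3
    calc (Real.exp 3)⁻¹ ≤ 10⁻¹ := inv_anti₀ (by norm_num) h3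
      _ = 0.1 := by norm_num
  have e3 : ex K (fun _ => 1) (ind (M ∪ F)ᶜ) = G - pr K F := by
    rw [hGd]
    unfold pr
    rw [← ex_sub hK (Adm.const 1) (Adm.ind (mm a)) (Adm.ind (mm _))]
    congr 1
    ext x
    have : F ⊆ {x | a < g x} := by
      intro x hx
      have h2 : a + δ < g x := hx
      show a < g x
      linarith
    by_cases h1 : a < g x
    · by_cases h2 : a + δ < g x
      · simp [ind, hM, hF, h1, h2]
      · simp [ind, hM, hF, h1, h2]
    · have h2 : ¬ (a + δ < g x) := by intro h; apply h1; linarith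
      simp [ind, hM, hF, h1, h2]
  rw [e3] at key
  have e4 : pr K {x | a + A * (2 + b') < g x} ≤ pr K F := by
    apply pr_mono hK (mm _) (mm _)
    intro x hx
    have h2 : a + A * (2 + b') < g x := hx
    show a + δ < g x
    have : δ ≤ A * (2 + b') := by rw [hδ]; gcongr
    linarith
  linarith

theorem tail_iter (hn : 0 < n) (hK : IsCompact K) (hcv : Convex ℝ K) (hL : LC K (fun _ => 1))
    (D : ℝ) (hD : 0 < D) (hPhi : Phi K (fun _ => 1) ≤ D) (A : ℝ) (hA : 0 < A)
    (hA2 : A ^ 2 = 484 * 27648 ^ 2 * √D) (g : E n → ℝ) (hg : Continuous g)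
    (hg1 : ∀ x y, g y - g x ≤ ‖x - y‖) (a : ℝ) (hG : pr K {x | a < g x} ≤ 1 / 2) (j : ℕ) :
    pr K {x | a + 5 * A * j ^ 2 < g x} ≤ 1 / 2 * (3 / 4) ^ j := by
  have mm : ∀ c, MeasurableSet {x : E n | c < g x} := fun c => measurableSet_lt measurable_const hg.measurable
  have mono : ∀ c d, c ≤ d → pr K {x | d < g x} ≤ pr K {x | c < g x} := by
    intro c d h
    exact pr_mono hK (mm _) (mm _) (fun x hx => lt_of_le_of_lt h hx)
  induction j with
  | zero => simpa using hG
  | succ j ih =>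
    set c := a + 5 * A * (j : ℝ) ^ 2 with hc
    have hj : (0 : ℝ) ≤ j := by positivity
    by_cases h : pr K {x | c < g x} ≤ 1 / 2 * (3 / 4) ^ (j + 1)
    · refine (mono c _ ?_).trans h
      rw [hc]; push_cast; nlinarith [mul_nonneg hA.le hj]
    · push Not at h
      have p1 : (3 / 4 : ℝ) ^ j ≤ 1 := pow_le_one₀ (by norm_num) (by norm_num)
      have st := tail_step hn hK hcv hL D hD hPhi A hA hA2 g hg hg1 c (2 + (j + 1)) (by positivity)
        (by linarith) (by
          have e : Real.exp (-(2 + ((j : ℝ) + 1))) ≤ 1 / 4 * (3 / 4) ^ (j + 1) := by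
            rw [neg_add, Real.exp_add]
            apply mul_le_mul _ _ (Real.exp_pos _).le (by norm_num)
            · rw [Real.exp_neg]
              have : (4 : ℝ) ≤ Real.exp 2 := by
                have h := Real.exp_one_gt_d9
                have : Real.exp 2 = Real.exp 1 ^ 2 := by rw [← Real.exp_nat_mul]; norm_num
                rw [this]; nlinarith
              calc (Real.exp 2)⁻¹ ≤ 4⁻¹ := inv_anti₀ (by norm_num) this
                _ = _ := by norm_num
            · have : Real.exp (-((j : ℝ) + 1)) = (Real.exp (-1)) ^ (j + 1) := by
                rw [← Real.exp_nat_mul]; congr 1; push_cast; ring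
              rw [this]
              apply pow_le_pow_left₀ (Real.exp_pos _).le
              rw [Real.exp_neg]
              have h := Real.exp_one_gt_d9
              calc (Real.exp 1)⁻¹ ≤ 2⁻¹ := inv_anti₀ (by norm_num) (by linarith)
                _ ≤ _ := by norm_num
          linarith)
      refine (mono (c + A * (2 + (2 + ((j : ℝ) + 1)))) _ ?_).trans (st.trans ?_)
      · rw [hc]; push_cast; nlinarith [mul_nonneg hA.le hj]
      · rw [pow_succ]; linarith

theorem exists_median (hK : IsCompact K) (hL : LC K (fun _ => 1)) (g : E n → ℝ) (hg : Continuous g) :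
    ∃ a, pr K {x | a < g x} ≤ 1 / 2 ∧ pr K {x | g x < a} ≤ 1 / 2 := by
  have mm : ∀ c, MeasurableSet {x : E n | c < g x} := fun c => measurableSet_lt measurable_const hg.measurable
  have mm' : ∀ c, MeasurableSet {x : E n | g x < c} := fun c => measurableSet_lt hg.measurable measurable_const
  have mono : ∀ c d, c ≤ d → pr K {x | d < g x} ≤ pr K {x | c < g x} := by
    intro c d h
    exact pr_mono hK (mm _) (mm _) (fun x hx => lt_of_le_of_lt h hx)
  have fin : IsFiniteMeasure (volume.restrict K) := ⟨by simpa using hK.measure_lt_top⟩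
  obtain ⟨R, hR⟩ := hK.exists_bound_of_continuousOn hg.continuousOn
  have cz : ∀ M : Set (E n), (∀ x ∈ K, x ∉ M) → pr K M = 0 := by
    intro M h
    have : pr K M = ex K (fun _ => 1) (fun _ => 0) := by
      apply ex_congr hK
      intro x hx; simp [ind, h x hx]
    rw [this]; simp [ex]
  have co : ∀ M : Set (E n), (∀ x ∈ K, x ∈ M) → pr K M = 1 := by
    intro M h
    rw [← hL.one]
    apply ex_congr hK
    intro x hx; simp [ind, h x hx]
  set S := {a | pr K {x | a < g x} ≤ 1 / 2} with hS
  have ne : S.Nonempty := ⟨R, by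
    show pr K {x | R < g x} ≤ 1 / 2
    rw [cz]; · norm_num
    intro x hx h
    have h2 : R < g x := h
    have := hR x hx
    rw [Real.norm_eq_abs] at this
    linarith [le_abs_self (g x)]⟩
  have bd : BddBelow S := ⟨-R - 1, by
    intro a ha
    by_contra hlt
    push Not at hlt
    have : pr K {x | a < g x} = 1 := by
      apply co
      intro x hx
      show a < g x
      have := hR x hx
      rw [Real.norm_eq_abs] at this
      linarith [neg_abs_le (g x)]
    have h2 : pr K {x | a < g x} ≤ 1 / 2 := ha
    linarith⟩
  have half : ENNReal.ofReal (1 / 2) ≠ ∞ := ENNReal.ofReal_ne_top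
  refine ⟨sInf S, ?_, ?_⟩
  · have hu : {x | sInf S < g x} = ⋃ k : ℕ, {x | sInf S + 1 / ((k : ℝ) + 1) < g x} := by
      ext x
      simp only [mem_setOf_eq, mem_iUnion]
      constructor
      · intro h
        obtain ⟨k, hk⟩ := exists_nat_one_div_lt (sub_pos.2 h)
        exact ⟨k, by linarith⟩
      · rintro ⟨k, hk⟩
        have : (0 : ℝ) < 1 / ((k : ℝ) + 1) := by positivity
        linarith
    rw [hu, pr_eq hK (MeasurableSet.iUnion fun k => mm _), Monotone.measure_iUnion]
    · apply ENNReal.toReal_le_of_le_ofReal (by norm_num)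
      apply iSup_le
      intro k
      rw [ENNReal.le_ofReal_iff_toReal_le (measure_ne_top _ _) (by norm_num), ← pr_eq hK (mm _)]
      have : (0 : ℝ) < 1 / ((k : ℝ) + 1) := by positivity
      obtain ⟨a, ha, hlt⟩ := exists_lt_of_csInf_lt ne (show sInf S < sInf S + 1 / ((k : ℝ) + 1) by linarith)
      exact (mono a _ hlt.le).trans ha
    · intro k l hkl x hx
      have h2 : sInf S + 1 / ((k : ℝ) + 1) < g x := hx
      show sInf S + 1 / ((l : ℝ) + 1) < g x
      have : 1 / ((l : ℝ) + 1) ≤ 1 / ((k : ℝ) + 1) := by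
        apply one_div_le_one_div_of_le (by positivity)
        have : (k : ℝ) ≤ l := by exact_mod_cast hkl
        linarith
      linarith
  · have hu : {x | g x < sInf S} = ⋃ k : ℕ, {x | g x < sInf S - 1 / ((k : ℝ) + 1)} := by
      ext x
      simp only [mem_setOf_eq, mem_iUnion]
      constructor
      · intro h
        obtain ⟨k, hk⟩ := exists_nat_one_div_lt (sub_pos.2 h)
        exact ⟨k, by linarith⟩
      · rintro ⟨k, hk⟩
        have : (0 : ℝ) < 1 / ((k : ℝ) + 1) := by positivity
        linarith
    rw [hu, pr_eq hK (MeasurableSet.iUnion fun k => mm' _), Monotone.measure_iUnion]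
    · apply ENNReal.toReal_le_of_le_ofReal (by norm_num)
      apply iSup_le
      intro k
      rw [ENNReal.le_ofReal_iff_toReal_le (measure_ne_top _ _) (by norm_num), ← pr_eq hK (mm' _)]
      have : (0 : ℝ) < 1 / ((k : ℝ) + 1) := by positivity
      set c := sInf S - 1 / ((k : ℝ) + 1) with hc
      have nS : c ∉ S := fun h => by
        have := csInf_le bd h
        linarith
      have h1 : 1 / 2 < pr K {x | c < g x} := by
        by_contra h; push Not at h; exact nS h
      have h2 : pr K {x | c < g x}ᶜ = 1 - pr K {x | c < g x} := hL.compl hK (mm c)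
      have h3 : pr K {x | g x < c} ≤ pr K {x | c < g x}ᶜ := by
        apply pr_mono hK (mm' _) (mm _).compl
        intro x hx
        have : g x < c := hx
        show ¬ (c < g x)
        linarith
      linarith
    · intro k l hkl x hx
      have h2 : g x < sInf S - 1 / ((k : ℝ) + 1) := hx
      show g x < sInf S - 1 / ((l : ℝ) + 1)
      have : 1 / ((l : ℝ) + 1) ≤ 1 / ((k : ℝ) + 1) := by
        apply one_div_le_one_div_of_le (by positivity)
        have : (k : ℝ) ≤ l := by exact_mod_cast hkl
        linarith
      linarith

end

section
variable {K : Set (E n)} {L : ℝ}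

theorem iso_LC (hI : IsIsotropic K L) : LC K (fun _ => 1) where
  cont := continuous_const
  nonneg := fun _ _ => zero_le_one
  one := by unfold ex; simp [hI.1, Measure.real]
  lc := by intro x _ y _ l _ _; simp

theorem odd_zero (hs : K = -K) (hK : IsCompact K) (φ : E n → ℝ) (h : ∀ x, φ (-x) = -φ x) :
    ex K (fun _ => 1) φ = 0 := by
  unfold ex
  simp only [one_mul]
  have e := integral_neg_eq_self (K.indicator φ) (volume : Measure (E n))
  have e2 : ∀ x, K.indicator φ (-x) = - K.indicator φ x := by
    intro x
    have : -x ∈ K ↔ x ∈ K := by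
      constructor
      · intro hx; rw [hs]; exact hx
      · intro hx; rw [hs] at hx; exact hx
    by_cases hx : x ∈ K
    · rw [indicator_of_mem (this.2 hx), indicator_of_mem hx, h]
    · rw [indicator_of_notMem (fun h => hx (this.1 h)), indicator_of_notMem hx, neg_zero]
  simp only [e2, integral_neg] at e
  rw [integral_indicator hK.measurableSet] at e
  linarith

theorem iso_coord (hI : IsIsotropic K L) (i : Fin n) : ex K (fun _ => 1) (fun x => x i ^ 2) = L ^ 2 := by
  have := hI.2 (EuclideanSpace.single i 1) (by simp)
  unfold ex
  rw [← this]
  congr 1; ext x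
  simp [EuclideanSpace.inner_single_right]

theorem iso_off (hK : IsCompact K) (hI : IsIsotropic K L) (i j : Fin n) (hij : i ≠ j) :
    ex K (fun _ => 1) (fun x => x i * x j) = 0 := by
  have hθ : ‖(√2)⁻¹ • (EuclideanSpace.single i (1:ℝ) + EuclideanSpace.single j 1 : E n)‖ = 1 := by
    have h : ‖(EuclideanSpace.single i (1:ℝ) + EuclideanSpace.single j 1 : E n)‖ ^ 2 = 2 := by
      rw [@norm_add_sq_real]
      simp [EuclideanSpace.inner_single_left, hij]
      norm_num
    have h2 : ‖(EuclideanSpace.single i (1:ℝ) + EuclideanSpace.single j 1 : E n)‖ = √2 := by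
      rw [← h, Real.sqrt_sq (norm_nonneg _)]
    rw [norm_smul, h2, norm_inv, Real.norm_of_nonneg (Real.sqrt_nonneg _)]
    field_simp
  have := hI.2 _ hθ
  have e : (∫ x in K, ⟪x, (√2)⁻¹ • (EuclideanSpace.single i (1:ℝ) + EuclideanSpace.single j 1 : E n)⟫ ^ 2) =
      ex K (fun _ => 1) (fun x => (1 / 2) * (x i ^ 2 + (x j ^ 2 + 2 * (x i * x j)))) := by
    unfold ex
    congr 1; ext x
    rw [inner_smul_right, inner_add_right]
    simp only [EuclideanSpace.inner_single_right]
    rw [mul_pow, inv_pow, Real.sq_sqrt (by norm_num)]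
    simp
    ring
  have ai : ∀ i, Adm K (fun x => x i) := fun i => Adm.ofCont hK (coord_cont i)
  rw [e, ex_smul, ex_add hK (Adm.const 1) ((ai i).pow 2) (((ai j).pow 2).add (((ai i).mul (ai j)).smul 2)),
    ex_add hK (Adm.const 1) ((ai j).pow 2) (((ai i).mul (ai j)).smul 2), ex_smul, iso_coord hI, iso_coord hI] at this
  linarith

theorem iso_Phi (hB : IsConvexBody K) (hI : IsIsotropic K L) : Phi K (fun _ => 1) = n * L ^ 4 := by
  have hK := hB.1
  have m0 : ∀ i, mn K (fun _ => 1) i = 0 := fun i => odd_zero hB.2.2.2 hK _ (by intro x; simp)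
  have c : ∀ i j, cov K (fun _ => 1) i j = if i = j then L ^ 2 else 0 := by
    intro i j
    unfold cov tl
    simp only [m0, sub_zero]
    split_ifs with h
    · subst h
      rw [← iso_coord hI i]
      congr 1; ext x; ring
    · exact iso_off hK hI i j h
  unfold Phi
  simp only [c]
  simp
  left; ring

theorem iso_norm (hK : IsCompact K) (hI : IsIsotropic K L) : ex K (fun _ => 1) (fun x => ‖x‖ ^ 2) = n * L ^ 2 := by
  have ai : ∀ i, Adm K (fun x => x i) := fun i => Adm.ofCont hK (coord_cont i)
  have : (fun x : E n => ‖x‖ ^ 2) = fun x => ∑ i, x i ^ 2 := by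
    ext x; rw [EuclideanSpace.norm_sq_eq]; simp
  rw [this, ex_sum hK (Adm.const 1) (fun i _ => (ai i).pow 2)]
  simp [iso_coord hI]

/-- moments from tails -/
theorem mom4 (hK : IsCompact K) (X : E n → ℝ) (hX : Continuous X) (h0 : ∀ x, 0 ≤ X x)
    (ht : ∀ j : ℕ, pr K {x | 5 * (j : ℝ) ^ 2 < X x} ≤ (3 / 4) ^ j) :
    ex K (fun _ => 1) (fun x => X x ^ 4) ≤ ∑' j : ℕ, 625 * ((j : ℝ) + 1) ^ 8 * (3 / 4) ^ j := by
  have mm : ∀ c, MeasurableSet {x : E n | c < X x} := fun c => measurableSet_lt measurable_const hX.measurable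
  obtain ⟨R, hR⟩ := hK.exists_bound_of_continuousOn hX.continuousOn
  obtain ⟨J, hJ⟩ := exists_nat_gt (max R 0)
  have sm : Summable (fun j : ℕ => 625 * ((j : ℝ) + 1) ^ 8 * (3 / 4 : ℝ) ^ j) := by
    have h := (summable_nat_add_iff 1).2 (summable_pow_mul_geometric_of_norm_lt_one 8 (r := (3 / 4 : ℝ)) (by norm_num))
    refine (h.mul_left (625 * (4 / 3))).congr ?_
    intro j
    push_cast
    rw [pow_succ]; ring
  have a1 : ∀ j : ℕ, Adm K (fun x => 625 * ((j : ℝ) + 1) ^ 8 * ind {x | 5 * (j : ℝ) ^ 2 < X x} x) :=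
    fun j => (Adm.ind (mm _)).smul _
  have s1 : ex K (fun _ => 1) (fun x => X x ^ 4) ≤
      ex K (fun _ => 1) (fun x => ∑ j ∈ Finset.range J, 625 * ((j : ℝ) + 1) ^ 8 * ind {x | 5 * (j : ℝ) ^ 2 < X x} x) := by
    apply ex_mono hK (Adm.const 1) (fun _ _ => zero_le_one) ((Adm.ofCont hK hX).pow 4) (Adm.sum fun j _ => a1 j)
    intro x hx
    have nn : ∀ j ∈ Finset.range J, 0 ≤ 625 * ((j : ℝ) + 1) ^ 8 * ind {x | 5 * (j : ℝ) ^ 2 < X x} x :=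
      fun j _ => mul_nonneg (by positivity) (ind_nonneg _ _)
    rcases (h0 x).eq_or_lt with h | h
    · rw [← h]; simpa using Finset.sum_nonneg nn
    · have ex1 : ∃ j : ℕ, X x ≤ 5 * ((j : ℝ) + 1) ^ 2 := by
        refine ⟨J, ?_⟩
        have := hR x hx
        rw [Real.norm_eq_abs, abs_of_nonneg (h0 x)] at this
        have := le_max_left R 0
        have hJ0 : (0 : ℝ) ≤ J := by positivity
        nlinarith
      classical
      set j := Nat.find ex1 with hj
      have p1 := Nat.find_spec ex1
      rw [← hj] at p1
      have p2 : 5 * (j : ℝ) ^ 2 < X x := by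
        rcases Nat.eq_zero_or_pos j with h2 | h2
        · rw [h2]; simpa using h
        · have := Nat.find_min ex1 (m := j - 1) (by rw [← hj]; omega)
          push Not at this
          have e : ((j - 1 : ℕ) : ℝ) + 1 = j := by
            rw [Nat.cast_sub h2]; simp
          rwa [e] at this
      have p3 : j ∈ Finset.range J := by
        rw [Finset.mem_range]
        by_contra h3
        push Not at h3
        have h4 : (J : ℝ) ≤ j := by exact_mod_cast h3
        have := hR x hx
        rw [Real.norm_eq_abs, abs_of_nonneg (h0 x)] at this
        have h5 := le_max_left R 0
        have h6 : (1 : ℝ) ≤ J := by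
          have : (0 : ℝ) < J := lt_of_le_of_lt (le_max_right R 0) hJ
          exact_mod_cast this
        nlinarith
      refine le_trans ?_ (Finset.single_le_sum nn p3)
      have : ind {x | 5 * (j : ℝ) ^ 2 < X x} x = 1 := by simp [ind, p2]
      rw [this, mul_one]
      calc X x ^ 4 ≤ (5 * ((j : ℝ) + 1) ^ 2) ^ 4 := pow_le_pow_left₀ (h0 x) p1 4
        _ = _ := by ring
  refine s1.trans ?_
  rw [ex_sum hK (Adm.const 1) (fun j _ => a1 j)]
  simp only [ex_smul]
  refine le_trans (Finset.sum_le_sum fun j _ => mul_le_mul_of_nonneg_left (ht j) (by positivity)) ?_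
  exact sm.sum_le_tsum _ (fun j _ => by positivity)

def C4 : ℝ := ∑' j : ℕ, 625 * ((j : ℝ) + 1) ^ 8 * (3 / 4) ^ j

theorem C4_nonneg : 0 ≤ C4 := tsum_nonneg (fun j => by positivity)

theorem norm_conc (hn : 0 < n) (hB : IsConvexBody K) (hI : IsIsotropic K L) (hL : 0 < L) :
    ∃ a0 : ℝ, |√n * L - a0| ≤ 608256 * √√n * L * √(1 + C4) ∧
      ex K (fun _ => 1) (fun x => (|‖x‖ - a0|) ^ 4) ≤ (608256 * √√n * L) ^ 4 * C4 ∧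
      ∀ j : ℕ, pr K {x | 608256 * √√n * L * (5 * (j : ℝ) ^ 2) < |‖x‖ - a0|} ≤ (3 / 4) ^ j := by
  have hK := hB.1
  have hLC := iso_LC hI
  have hn' : (0 : ℝ) < n := by positivity
  set D := (n : ℝ) * L ^ 4 with hD
  have D0 : 0 < D := by positivity
  set a := √√(n : ℝ) with ha
  have a0p : 0 < a := by positivity
  have a2 : a ^ 2 = √n := Real.sq_sqrt (Real.sqrt_nonneg _)
  have a4 : a ^ 4 = n := by
    rw [show a ^ 4 = (a ^ 2) ^ 2 by ring, a2, Real.sq_sqrt hn'.le]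
  have sD : √D = a ^ 2 * L ^ 2 := by
    rw [hD, ← a4, show a ^ 4 * L ^ 4 = (a ^ 2 * L ^ 2) ^ 2 by ring, Real.sqrt_sq (by positivity)]
  set A := 608256 * a * L with hA
  have A0 : 0 < A := by positivity
  have hA2 : A ^ 2 = 484 * 27648 ^ 2 * √D := by rw [sD, hA]; ring
  obtain ⟨m, m1, m2⟩ := exists_median hK hLC (fun x => ‖x‖) continuous_norm
  have up := tail_iter hn hK hB.2.1 hLC D D0 (iso_Phi hB hI).le A A0 hA2 (fun x => ‖x‖) continuous_norm
    (by intro x y; have := norm_sub_norm_le y x; rwa [norm_sub_rev] at this) m m1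
  have dn := tail_iter hn hK hB.2.1 hLC D D0 (iso_Phi hB hI).le A A0 hA2 (fun x => -‖x‖) continuous_norm.neg
    (by intro x y; have := norm_sub_norm_le x y; linarith) (-m) (by simpa using m2)
  have cX : Continuous (fun x : E n => |‖x‖ - m|) := by fun_prop
  have tl : ∀ j : ℕ, pr K {x | A * (5 * (j : ℝ) ^ 2) < |‖x‖ - m|} ≤ (3 / 4) ^ j := by
    intro j
    have M1 : MeasurableSet {x : E n | m + 5 * A * (j : ℝ) ^ 2 < ‖x‖} := measurableSet_lt measurable_const continuous_norm.measurable
    have M2 : MeasurableSet {x : E n | -m + 5 * A * (j : ℝ) ^ 2 < -‖x‖} := measurableSet_lt measurable_const continuous_norm.neg.measurable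
    have h : pr K {x | A * (5 * (j : ℝ) ^ 2) < |‖x‖ - m|} ≤
        ex K (fun _ => 1) (fun x => ind {x | m + 5 * A * (j : ℝ) ^ 2 < ‖x‖} x + ind {x | -m + 5 * A * (j : ℝ) ^ 2 < -‖x‖} x) := by
      apply ex_mono hK (Adm.const 1) (fun _ _ => zero_le_one)
        (Adm.ind (measurableSet_lt measurable_const cX.measurable)) ((Adm.ind M1).add (Adm.ind M2))
      intro x _
      have p1 := ind_nonneg {x : E n | m + 5 * A * (j : ℝ) ^ 2 < ‖x‖} x
      have p2 := ind_nonneg {x : E n | -m + 5 * A * (j : ℝ) ^ 2 < -‖x‖} x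
      by_cases hx : A * (5 * (j : ℝ) ^ 2) < |‖x‖ - m|
      · rcases lt_abs.1 hx with h | h
        · have : ind {x : E n | m + 5 * A * (j : ℝ) ^ 2 < ‖x‖} x = 1 := by
            have : m + 5 * A * (j : ℝ) ^ 2 < ‖x‖ := by linarith
            simp [ind, this]
          have := ind_le_one {x : E n | A * (5 * (j : ℝ) ^ 2) < |‖x‖ - m|} x
          linarith
        · have : ind {x : E n | -m + 5 * A * (j : ℝ) ^ 2 < -‖x‖} x = 1 := by
            have : -m + 5 * A * (j : ℝ) ^ 2 < -‖x‖ := by linarith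
            simp only [ind]; rw [indicator_of_mem]; exact this
          have := ind_le_one {x : E n | A * (5 * (j : ℝ) ^ 2) < |‖x‖ - m|} x
          linarith
      · have : ind {x : E n | A * (5 * (j : ℝ) ^ 2) < |‖x‖ - m|} x = 0 := by simp [ind, hx]
        linarith
    rw [ex_add hK (Adm.const 1) (Adm.ind M1) (Adm.ind M2)] at h
    have h1 := up j
    have h2 := dn j
    unfold pr at h1 h2 h ⊢
    linarith
  have M4 : ex K (fun _ => 1) (fun x => (|‖x‖ - m|) ^ 4) ≤ A ^ 4 * C4 := by
    have h := mom4 hK (fun x => |‖x‖ - m| / A) (cX.div_const A) (fun x => by positivity) (by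
      intro j
      refine le_trans (le_of_eq ?_) (tl j)
      congr 1; ext x
      simp only [mem_setOf_eq]
      rw [lt_div_iff₀ A0, mul_comm])
    have e : (fun x : E n => (|‖x‖ - m| / A) ^ 4) = fun x => (A ^ 4)⁻¹ * (|‖x‖ - m|) ^ 4 := by
      ext x; rw [div_pow]; field_simp
    rw [e, ex_smul, inv_mul_le_iff₀ (by positivity)] at h
    exact h
  refine ⟨m, ?_, M4, tl⟩
  have m0 : 0 ≤ m := by
    by_contra h
    push Not at h
    have : {x : E n | m < ‖x‖} = univ := by
      ext x; simp only [mem_setOf_eq, mem_univ, iff_true]; linarith [norm_nonneg x]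
    rw [this] at m1
    have e : pr K univ = 1 := by
      rw [← hLC.one]; unfold pr; congr 1; ext x; simp [ind]
    linarith
  have an : Adm K (fun x : E n => ‖x‖) := Adm.ofCont hK continuous_norm
  have aX := Adm.ofCont hK cX
  have M2 : ex K (fun _ => 1) (fun x => (|‖x‖ - m|) ^ 2) ≤ A ^ 2 * (1 + C4) := by
    have h : ex K (fun _ => 1) (fun x => (|‖x‖ - m|) ^ 2) ≤
        ex K (fun _ => 1) (fun x => A ^ 2 + (A ^ 2)⁻¹ * (|‖x‖ - m|) ^ 4) := by
      apply ex_mono hK (Adm.const 1) (fun _ _ => zero_le_one) (aX.pow 2) ((Adm.const _).add ((aX.pow 4).smul _))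
      intro x _
      set z := |‖x‖ - m|
      have hz : (A ^ 2)⁻¹ * z ^ 4 = (z ^ 2) ^ 2 / A ^ 2 := by field_simp
      rw [hz]
      have : z ^ 2 - A ^ 2 ≤ (z ^ 2) ^ 2 / A ^ 2 := by
        rw [le_div_iff₀ (by positivity)]
        nlinarith [sq_nonneg (z ^ 2 - A ^ 2), sq_nonneg (z ^ 2), sq_nonneg (A^2)]
      linarith
    rw [ex_add hK (Adm.const 1) (Adm.const _) ((aX.pow 4).smul _), ex_smul, hLC.ex_const] at h
    have h2 := mul_le_mul_of_nonneg_left M4 (show 0 ≤ (A ^ 2)⁻¹ by positivity)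
    have e : (A ^ 2)⁻¹ * (A ^ 4 * C4) = A ^ 2 * C4 := by field_simp
    rw [e] at h2
    linarith
  have eg : ex K (fun _ => 1) (fun x => ‖x‖) ≤ √n * L := by
    have h := ex_cs hK (Adm.const 1) (fun _ _ => zero_le_one) an (Adm.const 1)
    simp only [mul_one] at h
    rw [iso_norm hK hI, hLC.ex_const, one_pow, mul_one] at h
    have : (n : ℝ) * L ^ 2 = (√n * L) ^ 2 := by rw [mul_pow, Real.sq_sqrt hn'.le]
    rw [this] at h
    exact le_of_sq_le_sq h (by positivity)
  have ee : ex K (fun _ => 1) (fun x => (|‖x‖ - m|) ^ 2) = n * L ^ 2 - 2 * m * ex K (fun _ => 1) (fun x => ‖x‖) + m ^ 2 := by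
    rw [← iso_norm hK hI, ← ex_smul, ← hLC.ex_const (m ^ 2), ← ex_sub hK (Adm.const 1) (an.pow 2) (an.smul _),
      ← ex_add hK (Adm.const 1) ((an.pow 2).sub (an.smul _)) (Adm.const _)]
    congr 1; ext x
    rw [sq_abs]; ring
  have fin : (√n * L - m) ^ 2 ≤ (A * √(1 + C4)) ^ 2 := by
    rw [mul_pow A, Real.sq_sqrt (by linarith [C4_nonneg])]
    refine le_trans ?_ M2
    rw [ee]
    have : (n : ℝ) * L ^ 2 = (√n * L) ^ 2 := by rw [mul_pow, Real.sq_sqrt hn'.le]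
    rw [this]
    nlinarith [mul_le_mul_of_nonneg_left eg m0]
  exact abs_le_of_sq_le_sq fin (by positivity)

end


theorem conc_tail : ∃ c > (0 : ℝ), ∀ (n : ℕ), 0 < n → ∀ (K : Set (E n)) (L : ℝ), IsConvexBody K →
    IsIsotropic K L → 0 < L → ∀ u : ℝ, 0 < u →
    pr K {x | u * √√n * L ≤ |‖x‖ - √n * L|} ≤ 2 * Real.exp (-(c * √u)) := by
  set B := √(1 + C4) with hB
  have B0 : 0 < B := Real.sqrt_pos.2 (by linarith [C4_nonneg])
  set A : ℝ := 608256 with hA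
  have A0 : 0 < A := by norm_num
  have l2 : 0 < Real.log 2 := Real.log_pos (by norm_num)
  have l43 : 0 < Real.log (4 / 3) := Real.log_pos (by norm_num)
  set c := min (Real.log 2 / √(2 * A * B)) (Real.log (4 / 3) / √(11 * A)) with hc
  have c0 : 0 < c := by
    apply lt_min
    · have : 0 < √(2 * A * B) := Real.sqrt_pos.2 (by positivity)
      positivity
    · have : 0 < √(11 * A) := Real.sqrt_pos.2 (by positivity)
      positivity
  refine ⟨c, c0, ?_⟩
  intro n hn K L hBd hI hL u hu
  have hK := hBd.1
  have hLC := iso_LC hI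
  have hn' : (0 : ℝ) < n := by positivity
  obtain ⟨m, h1, _, h3⟩ := norm_conc hn hBd hI hL
  rw [← hB] at h1
  have cY : Continuous (fun x : E n => |‖x‖ - √n * L|) := by fun_prop
  have cX : Continuous (fun x : E n => |‖x‖ - m|) := by fun_prop
  have mY : MeasurableSet {x : E n | u * √√n * L ≤ |‖x‖ - √n * L|} := measurableSet_le measurable_const cY.measurable
  have aL : 0 < √√(n:ℝ) * L := by positivity
  by_cases hu2 : u ≤ 2 * A * B
  · refine (hLC.le_one hK mY).trans ?_
    have : c * √u ≤ Real.log 2 := by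
      calc c * √u ≤ Real.log 2 / √(2 * A * B) * √(2 * A * B) :=
            mul_le_mul (min_le_left _ _) (Real.sqrt_le_sqrt hu2) (Real.sqrt_nonneg _) (by positivity)
        _ = Real.log 2 := by
            have : √(2 * A * B) ≠ 0 := (Real.sqrt_pos.2 (by positivity)).ne'
            field_simp
    have h := Real.exp_le_exp.2 (neg_le_neg this)
    rw [Real.exp_neg, Real.exp_log (by norm_num)] at h
    linarith
  · push Not at hu2
    set j := ⌊√(u / (11 * A))⌋₊ with hj
    have j1 : (j : ℝ) ≤ √(u / (11 * A)) := Nat.floor_le (Real.sqrt_nonneg _)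
    have j2 : √(u / (11 * A)) < j + 1 := Nat.lt_floor_add_one _
    have j3 : (j : ℝ) ^ 2 ≤ u / (11 * A) := by
      calc (j : ℝ) ^ 2 ≤ √(u / (11 * A)) ^ 2 := pow_le_pow_left₀ (by positivity) j1 2
        _ = _ := Real.sq_sqrt (by positivity)
    have j4 : A * (5 * (j : ℝ) ^ 2) < u / 2 := by
      rw [le_div_iff₀ (by positivity)] at j3
      nlinarith
    have s1 : pr K {x | u * √√n * L ≤ |‖x‖ - √n * L|} ≤ (3 / 4) ^ j := by
      refine le_trans (pr_mono hK mY (measurableSet_lt measurable_const cX.measurable) ?_) (h3 j)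
      intro x hx
      have hx' : u * √√n * L ≤ |‖x‖ - √n * L| := hx
      show A * √√n * L * (5 * (j : ℝ) ^ 2) < |‖x‖ - m|
      have t1 : |‖x‖ - √n * L| ≤ |‖x‖ - m| + |√n * L - m| := by
        have := abs_sub_le ‖x‖ m (√n * L)
        rwa [abs_sub_comm m] at this
      have t2 : A * (5 * (j : ℝ) ^ 2) * (√√n * L) < (u / 2) * (√√n * L) := mul_lt_mul_of_pos_right j4 aL
      have t3 : 2 * A * B * (√√n * L) < u * (√√n * L) := mul_lt_mul_of_pos_right hu2 aL
      linarith
    refine s1.trans ?_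
    have e1 : (3 / 4 : ℝ) ^ j = Real.exp (-(Real.log (4 / 3) * j)) := by
      rw [show (-(Real.log (4 / 3) * j) : ℝ) = j * (-Real.log (4 / 3)) by ring, Real.exp_nat_mul, Real.exp_neg,
        Real.exp_log (by norm_num)]
      norm_num
    have e2 : Real.log (4 / 3) * (√(u / (11 * A)) - 1) ≤ Real.log (4 / 3) * j :=
      mul_le_mul_of_nonneg_left (by linarith) l43.le
    have e3 : c * √u ≤ Real.log (4 / 3) * √(u / (11 * A)) := by
      rw [Real.sqrt_div hu.le]
      calc c * √u ≤ Real.log (4 / 3) / √(11 * A) * √u := mul_le_mul_of_nonneg_right (min_le_right _ _) (Real.sqrt_nonneg _)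
        _ = _ := by ring
    rw [e1]
    calc Real.exp (-(Real.log (4 / 3) * j)) ≤ Real.exp (Real.log (4 / 3) + -(c * √u)) :=
          Real.exp_le_exp.2 (by linarith)
      _ = 4 / 3 * Real.exp (-(c * √u)) := by rw [Real.exp_add, Real.exp_log (by norm_num)]
      _ ≤ _ := mul_le_mul_of_nonneg_right (by norm_num) (Real.exp_pos _).le

theorem conc_var : ∃ C > (0 : ℝ), ∀ (n : ℕ), 0 < n → ∀ (K : Set (E n)) (L : ℝ), IsConvexBody K →
    IsIsotropic K L → 0 < L →
    ex K (fun _ => 1) (fun x => (‖x‖ ^ 2 - n * L ^ 2) ^ 2) ≤ C * (√√n ^ 3 * L ^ 2) ^ 2 := by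
  set B := √(1 + C4) with hB
  have B0 : 0 < B := Real.sqrt_pos.2 (by linarith [C4_nonneg])
  have c4 := C4_nonneg
  set A : ℝ := 608256 with hA
  have A0 : 0 < A := by norm_num
  refine ⟨96 * A ^ 4 * (C4 + B ^ 4) + 24, by positivity, ?_⟩
  intro n hn K L hBd hI hL
  have hK := hBd.1
  have hLC := iso_LC hI
  have hn' : (0 : ℝ) < n := by positivity
  obtain ⟨m, h1, h2, _⟩ := norm_conc hn hBd hI hL
  rw [← hB] at h1
  set a := √√(n : ℝ) with ha
  have a0p : 0 < a := by positivity
  have a2 : √n = a ^ 2 := (Real.sq_sqrt (Real.sqrt_nonneg _)).symm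
  have a4 : (n : ℝ) = a ^ 4 := by
    rw [show a ^ 4 = (a ^ 2) ^ 2 by ring, ← a2, Real.sq_sqrt hn'.le]
  have a1 : 1 ≤ a := by
    have : (1 : ℝ) ≤ n := by exact_mod_cast hn
    rw [ha, Real.one_le_sqrt, Real.one_le_sqrt]; exact this
  have cX : Continuous (fun x : E n => |‖x‖ - m|) := by fun_prop
  have aX := Adm.ofCont hK cX
  set b := a * L with hb
  have b0 : 0 < b := by positivity
  have key : ∀ x : E n, (‖x‖ ^ 2 - n * L ^ 2) ^ 2 ≤
      (96 * a ^ 2) * (|‖x‖ - m|) ^ 4 + (96 * a ^ 2 * (A ^ 4 * b ^ 4 * B ^ 4) + 24 * (a ^ 3 * L ^ 2) ^ 2) := by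
    intro x
    set X := |‖x‖ - m|
    set Y := |‖x‖ - √n * L| with hY
    have X0 : 0 ≤ X := abs_nonneg _
    have Y0 : 0 ≤ Y := abs_nonneg _
    have t1 : Y ≤ X + A * b * B := by
      have := abs_sub_le ‖x‖ m (√n * L)
      rw [abs_sub_comm m] at this
      have e : A * a * L * B = A * b * B := by rw [hb]; ring
      linarith
    have t2 : Y ^ 4 ≤ 8 * (X ^ 4 + (A * b * B) ^ 4) := by
      refine (pow_le_pow_left₀ Y0 t1 4).trans ?_
      have := add_pow_le X0 (show 0 ≤ A * b * B by positivity) 4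
      norm_num at this
      exact this
    set r := √n * L with hr
    have r0 : 0 < r := by rw [hr]; positivity
    have e1 : (‖x‖ ^ 2 - n * L ^ 2) = (‖x‖ - r) * ((‖x‖ - r) + 2 * r) := by
      have : (n : ℝ) * L ^ 2 = r ^ 2 := by rw [hr, mul_pow, Real.sq_sqrt hn'.le]
      rw [this]; ring
    have e2 : (‖x‖ ^ 2 - n * L ^ 2) ^ 2 ≤ 2 * Y ^ 4 + 8 * r ^ 2 * Y ^ 2 := by
      rw [e1]
      have e3 : Y ^ 2 = (‖x‖ - r) ^ 2 := sq_abs _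
      have e4 : Y ^ 4 = ((‖x‖ - r) ^ 2) ^ 2 := by rw [← e3]; ring
      rw [e3, e4]
      set z := ‖x‖ - r
      nlinarith [mul_nonneg (sq_nonneg z) (sq_nonneg (z - 2 * r))]
    have e5 : r ^ 2 * Y ^ 2 ≤ a ^ 2 * Y ^ 4 + (a ^ 3 * L ^ 2) ^ 2 := by
      rw [hr, a2]
      have : (a ^ 2 * L) ^ 2 * Y ^ 2 = (a * Y ^ 2) * (a ^ 3 * L ^ 2) := by ring
      rw [this]
      nlinarith [sq_nonneg (a * Y ^ 2 - a ^ 3 * L ^ 2), sq_nonneg (a * Y ^ 2), sq_nonneg (a ^ 3 * L ^ 2)]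
    have e6 : Y ^ 4 ≤ a ^ 2 * Y ^ 4 := le_mul_of_one_le_left (by positivity) (one_le_pow₀ a1)
    have e7 : a ^ 2 * Y ^ 4 ≤ a ^ 2 * (8 * (X ^ 4 + (A * b * B) ^ 4)) := mul_le_mul_of_nonneg_left t2 (by positivity)
    have e8 : (A * b * B) ^ 4 = A ^ 4 * b ^ 4 * B ^ 4 := by ring
    rw [e8] at e7
    have e9 : 0 ≤ a ^ 2 * (X ^ 4 + A ^ 4 * b ^ 4 * B ^ 4) := by positivity
    have e10 : 0 ≤ (a ^ 3 * L ^ 2) ^ 2 := by positivity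
    nlinarith
  have ak : Adm K (fun x : E n => (‖x‖ ^ 2 - n * L ^ 2) ^ 2) := Adm.ofCont hK (by fun_prop)
  have h3 := ex_mono hK (Adm.const 1) (fun _ _ => zero_le_one) ak (((aX.pow 4).smul (96 * a ^ 2)).add (Adm.const _)) (fun x _ => key x)
  rw [ex_add hK (Adm.const 1) ((aX.pow 4).smul (96 * a ^ 2)) (Adm.const _), ex_smul, hLC.ex_const] at h3
  have h4 := mul_le_mul_of_nonneg_left h2 (show 0 ≤ 96 * a ^ 2 by positivity)
  refine (h3.trans (add_le_add_left h4 _)).trans (le_of_eq ?_)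
  rw [hb]; ring


section
variable {K : Set (E n)} {L : ℝ}

theorem body_neg (hB : IsConvexBody K) {x : E n} (hx : x ∈ K) : -x ∈ K := by
  have h := hB.2.2.2
  rw [h] at hx
  exact hx

theorem body_nhds (hB : IsConvexBody K) : K ∈ nhds (0 : E n) := by
  obtain ⟨x, hx⟩ := hB.2.2.1
  have h1 : -x ∈ interior K := by
    have : interior K = -interior K := by
      have h2 : interior (-K) = -interior K := ((Homeomorph.neg (E n)).preimage_interior K).symm
      rw [← h2, ← hB.2.2.2]
    rw [this]; simpa using hx
  have h3 := hB.2.1.interior hx h1 (a := 1 / 2) (b := 1 / 2) (by norm_num) (by norm_num) (by norm_num)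
  have : (1 / 2 : ℝ) • x + (1 / 2 : ℝ) • -x = 0 := by rw [smul_neg, add_neg_cancel]
  rw [this] at h3
  exact mem_interior_iff_mem_nhds.1 h3

theorem body_gauge (hB : IsConvexBody K) (x : E n) : gauge K x ≤ 1 ↔ x ∈ K := by
  rw [gauge_le_one_iff_mem_closure hB.2.1 (body_nhds hB), hB.1.isClosed.closure_eq]

theorem inner_le_gauge (hB : IsConvexBody K) (θ : E n) (h : ℝ) (hh : ∀ x ∈ K, ⟪x, θ⟫ ≤ h) (z : E n) :
    ⟪z, θ⟫ ≤ h * gauge K z := by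
  have habs : Absorbent ℝ K := absorbent_nhds_zero (body_nhds hB)
  have h0 : 0 ≤ h := by
    have := hh 0 (mem_of_mem_nhds (body_nhds hB))
    simpa using this
  apply le_of_forall_pos_le_add
  intro e he
  have : gauge K z < gauge K z + e / (h + 1) := by
    have : 0 < e / (h + 1) := by positivity
    linarith
  obtain ⟨b, b0, b1, w, hw, rfl⟩ := exists_lt_of_gauge_lt habs this
  simp only [] at *
  rw [inner_smul_left]
  have h2 := mul_le_mul_of_nonneg_left (hh w hw) b0.le
  have h3 : h * b ≤ h * (gauge K (b • w) + e / (h + 1)) := mul_le_mul_of_nonneg_left b1.le h0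
  have h4 : h * (e / (h + 1)) ≤ e := by
    rw [mul_div_assoc', div_le_iff₀ (by linarith)]
    nlinarith
  simp
  nlinarith

theorem slab (hB : IsConvexBody K) (hI : IsIsotropic K L) {p α : ℝ} (hα : 0 < α)
    (hP : ∀ ε : ℝ, 0 < ε → ε ≤ 2 → α * ε ^ p ≤ modConv K ε) (θ : E n) (h : ℝ) (h0 : 0 < h)
    (hh : ∀ x ∈ K, ⟪x, θ⟫ ≤ h) (u : ℝ) (hu : 0 < u) (huh : u ≤ h) :
    pr K {x | u ≤ ⟪x, θ⟫} ≤ Real.exp (-(n * (α * (2 * u / h) ^ p))) := by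
  have hK := hB.1
  set ε := 2 * u / h with hε
  have ε0 : 0 < ε := by positivity
  have ε2 : ε ≤ 2 := by rw [hε, div_le_iff₀ h0]; linarith
  have hp := hP ε ε0 ε2
  set η := Real.exp (-(α * ε ^ p)) with hη
  have η0 : 0 < η := Real.exp_pos _
  have cg : Continuous (gauge K) := continuous_gauge hB.2.1 (body_nhds hB)
  have ci : Continuous (fun x : E n => ⟪x, θ⟫) := by fun_prop
  set A : Set (E n) := {x | u ≤ ⟪x, θ⟫} with hA
  have mA : MeasurableSet A := measurableSet_le measurable_const ci.measurable
  set B : Set (E n) := {x | u ≤ -⟪x, θ⟫} with hBd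
  have mB : MeasurableSet B := measurableSet_le measurable_const ci.neg.measurable
  set C : Set (E n) := {x | gauge K x ≤ η} with hC
  have mC : MeasurableSet C := measurableSet_le cg.measurable measurable_const
  have key := pl_ex hK (w := fun _ => 1) continuous_const (fun _ _ => zero_le_one) mA mB mC (1 / 2) 1
    (by norm_num) (by norm_num) zero_le_one (by
      intro x hx hxK y hy hyK
      refine ⟨?_, hB.2.1 hxK hyK (by norm_num) (by norm_num) (by norm_num), by simp⟩
      have hx' : u ≤ ⟪x, θ⟫ := hx
      have hy' : u ≤ -⟪y, θ⟫ := hy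
      have e : (1 - 1 / 2 : ℝ) • x + (1 / 2 : ℝ) • y = (2⁻¹ : ℝ) • (x + y) := by
        rw [smul_add]; norm_num
      rw [e]
      show gauge K _ ≤ η
      have g1 : ε ≤ gauge K (x - y) := by
        have := inner_le_gauge hB θ h hh (x - y)
        rw [inner_sub_left] at this
        rw [hε, div_le_iff₀ h0]
        linarith
      have m1 : modConv K ε ≤ 1 - gauge K ((2⁻¹ : ℝ) • (x + y)) := by
        apply csInf_le
        · refine ⟨0, ?_⟩
          rintro d ⟨x, y, hx, hy, _, rfl⟩
          rw [body_gauge hB] at hx hy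
          have : (2⁻¹ : ℝ) • (x + y) ∈ K := by
            rw [smul_add]
            exact hB.2.1 hx hy (by norm_num) (by norm_num) (by norm_num)
          have := (body_gauge hB _).2 this
          linarith
        · exact ⟨x, y, (body_gauge hB _).2 hxK, (body_gauge hB _).2 hyK, g1, rfl⟩
      have := Real.one_sub_le_exp_neg (α * ε ^ p)
      linarith)
  have eAB : ex K (fun _ => 1) (ind B) = ex K (fun _ => 1) (ind A) := by
    have := odd_zero hB.2.2.2 hK (fun x => ind B x - ind A x) (by
      intro x
      have e1 : ind B (-x) = ind A x := by
        have : -x ∈ B ↔ x ∈ A := by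
          show u ≤ -⟪-x, θ⟫ ↔ u ≤ ⟪x, θ⟫
          rw [inner_neg_left, neg_neg]
        unfold ind; by_cases h : x ∈ A
        · rw [indicator_of_mem h, indicator_of_mem (this.2 h)]
        · rw [indicator_of_notMem h, indicator_of_notMem (fun h' => h (this.1 h'))]
      have e2 : ind A (-x) = ind B x := by
        have : -x ∈ A ↔ x ∈ B := by
          show u ≤ ⟪-x, θ⟫ ↔ u ≤ -⟪x, θ⟫
          rw [inner_neg_left]
        unfold ind; by_cases h : x ∈ B
        · rw [indicator_of_mem h, indicator_of_mem (this.2 h)]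
        · rw [indicator_of_notMem h, indicator_of_notMem (fun h' => h (this.1 h'))]
      rw [e1, e2]; ring)
    rw [ex_sub hK (Adm.const 1) (Adm.ind mB) (Adm.ind mA)] at this
    linarith
  have pA := pr_nonneg hK A
  unfold pr at pA ⊢
  rw [eAB] at key
  have h12 : (1 : ℝ) - 1 / 2 = 1 / 2 := by norm_num
  rw [h12, ← Real.mul_rpow pA pA, ← Real.sqrt_eq_rpow, Real.sqrt_mul_self pA, one_mul] at key
  refine key.trans ?_
  have hCK : C ⊆ η • K := by
    intro z hz
    have hz' : gauge K z ≤ η := hz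
    refine ⟨η⁻¹ • z, ?_, by simp [smul_smul, η0.ne']⟩
    rw [← body_gauge hB, gauge_smul_of_nonneg (by positivity)]
    rw [smul_eq_mul, inv_mul_le_iff₀ η0]; linarith
  have e1 := pr_eq hK mC
  unfold pr at e1
  rw [e1]
  apply ENNReal.toReal_le_of_le_ofReal (Real.exp_pos _).le
  calc volume.restrict K C ≤ volume C := Measure.restrict_apply_le _ _
    _ ≤ volume (η • K) := measure_mono hCK
    _ = ENNReal.ofReal |η ^ n| := by rw [Measure.addHaar_smul, hI.1]; simp
    _ ≤ _ := by
      apply ENNReal.ofReal_le_ofReal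
      rw [abs_of_pos (by positivity), hη, ← Real.exp_nat_mul]
      apply le_of_eq; congr 1; ring

def c0 : ℝ := 1 / (4 * 55296 ^ 2)

theorem pz (hB : IsConvexBody K) (hI : IsIsotropic K L) (hL : 0 < L) (θ : E n) (hθ : ‖θ‖ = 1) :
    c0 ≤ pr K {x | L / 2 ≤ |⟪x, θ⟫|} := by
  have hK := hB.1
  have hLC := iso_LC hI
  have ci : Continuous (fun x : E n => |⟪x, θ⟫|) := by fun_prop
  set A : Set (E n) := {x | L / 2 ≤ |⟪x, θ⟫|} with hA
  have mA : MeasurableSet A := measurableSet_le measurable_const ci.measurable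
  have aZ : Adm K (fun x : E n => |⟪x, θ⟫|) := Adm.ofCont hK ci
  have hθ2 := hI.2 θ hθ
  have Z2 : ex K (fun _ => 1) (fun x => |⟪x, θ⟫| ^ 2) = L ^ 2 := by
    rw [← hθ2]; unfold ex; congr 1; ext x; simp only [sq_abs, one_mul]
  have elin : ∀ x, linSem (fun i => θ i) (x - 0) = |⟪x, θ⟫| := by
    intro x
    rw [sub_zero, linSem_apply]
    congr 1
  have Z3 : ex K (fun _ => 1) (fun x => |⟪x, θ⟫| ^ 3) ≤ 27648 * L ^ 3 := by
    have := borell_cube hK hB.2.1 hLC (linSem (fun i => θ i)) (linSem_cont _) 0 L hL.le (by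
      simp only [elin]; exact Z2.le)
    simpa only [elin] using this
  have key : ex K (fun _ => 1) (fun x => |⟪x, θ⟫| ^ 2) ≤ ex K (fun _ => 1) (fun x =>
      (L ^ 2 / 4 + (1 / (55296 * L)) * |⟪x, θ⟫| ^ 3) + (55296 ^ 2 * L ^ 2) * ind A x) := by
    apply ex_mono hK (Adm.const 1) (fun _ _ => zero_le_one) (aZ.pow 2)
      (((Adm.const _).add ((aZ.pow 3).smul _)).add ((Adm.ind mA).smul _))
    intro x _
    set z := |⟪x, θ⟫| with hz
    have z0 : 0 ≤ z := abs_nonneg _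
    by_cases h1 : L / 2 ≤ z
    · have : ind A x = 1 := by unfold ind; rw [indicator_of_mem]; exact h1
      rw [this, mul_one]
      by_cases h2 : z ≤ 55296 * L
      · have : z ^ 2 ≤ (55296 * L) ^ 2 := pow_le_pow_left₀ z0 h2 2
        have : 0 ≤ 1 / (55296 * L) * z ^ 3 := by positivity
        nlinarith [sq_nonneg L]
      · push Not at h2
        have : z ^ 2 ≤ 1 / (55296 * L) * z ^ 3 := by
          rw [one_div, inv_mul_eq_div, le_div_iff₀ (by positivity)]
          nlinarith [sq_nonneg z]
        nlinarith [sq_nonneg L]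
    · push Not at h1
      have : 0 ≤ 1 / (55296 * L) * z ^ 3 := by positivity
      have : 0 ≤ (55296 ^ 2 * L ^ 2) * ind A x := mul_nonneg (by positivity) (ind_nonneg _ _)
      have : z ^ 2 ≤ (L / 2) ^ 2 := pow_le_pow_left₀ z0 h1.le 2
      nlinarith
  rw [ex_add hK (Adm.const 1) ((Adm.const _).add ((aZ.pow 3).smul _)) ((Adm.ind mA).smul _),
    ex_add hK (Adm.const 1) (Adm.const _) ((aZ.pow 3).smul _), ex_smul, ex_smul, hLC.ex_const, Z2] at key
  have h4 := mul_le_mul_of_nonneg_left Z3 (show 0 ≤ 1 / (55296 * L) by positivity)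
  have e : 1 / (55296 * L) * (27648 * L ^ 3) = L ^ 2 / 2 := by field_simp; norm_num
  rw [e] at h4
  have h5 : L ^ 2 * (1 / 4) ≤ L ^ 2 * (55296 ^ 2 * pr K A) := by
    unfold pr; linarith
  have h6 := le_of_mul_le_mul_left h5 (by positivity)
  unfold c0
  rw [div_le_iff₀ (by norm_num)]
  linarith

def Lam : ℝ := Real.log (2 / c0)

theorem Lam_ge : 1 ≤ Lam := by
  unfold Lam c0
  rw [Real.le_log_iff_exp_le (by norm_num)]
  have := Real.exp_one_lt_d9
  norm_num
  linarith

theorem width (hn : 0 < n) (hB : IsConvexBody K) (hI : IsIsotropic K L) (hL : 0 < L) {p α : ℝ} (hp : 2 ≤ p) (hα : 0 < α)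
    (hP : ∀ ε : ℝ, 0 < ε → ε ≤ 2 → α * ε ^ p ≤ modConv K ε) (θ : E n) (hθ : ‖θ‖ = 1) (h : ℝ) (h0 : 0 < h)
    (hh : ∀ x ∈ K, |⟪x, θ⟫| ≤ h) : (n : ℝ) ^ (1 / p) * α ^ (1 / p) * L ≤ Lam * h := by
  have hK := hB.1
  have hn' : (0 : ℝ) < n := by positivity
  have pzθ := pz hB hI hL θ hθ
  have cpos : 0 < c0 := by unfold c0; positivity
  have ci : Continuous (fun x : E n => ⟪x, θ⟫) := by fun_prop
  have m1 : MeasurableSet {x : E n | L / 2 ≤ ⟪x, θ⟫} := measurableSet_le measurable_const ci.measurable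
  have m2 : MeasurableSet {x : E n | L / 2 ≤ ⟪x, -θ⟫} := measurableSet_le measurable_const (by fun_prop)
  have m3 : MeasurableSet {x : E n | L / 2 ≤ |⟪x, θ⟫|} := measurableSet_le measurable_const (by fun_prop)
  have hle : L / 2 ≤ h := by
    by_contra hc
    push Not at hc
    have : pr K {x | L / 2 ≤ |⟪x, θ⟫|} = 0 := by
      have : pr K {x | L / 2 ≤ |⟪x, θ⟫|} = ex K (fun _ => 1) (fun _ => 0) := by
        apply ex_congr hK
        intro x hx
        have : ¬ (L / 2 ≤ |⟪x, θ⟫|) := by have := hh x hx; linarith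
        unfold ind; rw [indicator_of_notMem]; exact this
      rw [this]; simp [ex]
    linarith
  have s1 := slab hB hI hα hP θ h h0 (fun x hx => (le_abs_self _).trans (hh x hx)) (L / 2) (by positivity) hle
  have s2 := slab hB hI hα hP (-θ) h h0 (fun x hx => by
    rw [inner_neg_right]; exact (neg_le_abs _).trans (hh x hx)) (L / 2) (by positivity) hle
  have un : pr K {x | L / 2 ≤ |⟪x, θ⟫|} ≤ pr K {x | L / 2 ≤ ⟪x, θ⟫} + pr K {x | L / 2 ≤ ⟪x, -θ⟫} := by
    unfold pr
    rw [← ex_add hK (Adm.const 1) (Adm.ind m1) (Adm.ind m2)]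
    apply ex_mono hK (Adm.const 1) (fun _ _ => zero_le_one) (Adm.ind m3) ((Adm.ind m1).add (Adm.ind m2))
    intro x _
    have p1 := ind_nonneg {x : E n | L / 2 ≤ ⟪x, θ⟫} x
    have p2 := ind_nonneg {x : E n | L / 2 ≤ ⟪x, -θ⟫} x
    have p3 := ind_le_one {x : E n | L / 2 ≤ |⟪x, θ⟫|} x
    by_cases hx : L / 2 ≤ |⟪x, θ⟫|
    · rcases le_abs.1 hx with h | h
      · have : ind {x : E n | L / 2 ≤ ⟪x, θ⟫} x = 1 := by
          unfold ind; rw [indicator_of_mem]; exact h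
        linarith
      · have : ind {x : E n | L / 2 ≤ ⟪x, -θ⟫} x = 1 := by
          unfold ind; rw [indicator_of_mem]
          show L / 2 ≤ ⟪x, -θ⟫
          rw [inner_neg_right]; exact h
        linarith
    · have : ind {x : E n | L / 2 ≤ |⟪x, θ⟫|} x = 0 := by
        unfold ind; rw [indicator_of_notMem]; exact hx
      linarith
  have e : 2 * (L / 2) / h = L / h := by ring
  rw [e] at s1 s2
  have f1 : c0 / 2 ≤ Real.exp (-(n * (α * (L / h) ^ p))) := by linarith
  have f2 : n * (α * (L / h) ^ p) ≤ Lam := by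
    have := Real.log_le_log (by positivity) f1
    rw [Real.log_exp] at this
    unfold Lam
    rw [← inv_div c0 2, Real.log_inv]
    linarith
  have f3 : (n * (α * (L / h) ^ p)) ^ (1 / p) ≤ Lam ^ (1 / p) :=
    Real.rpow_le_rpow (by positivity) f2 (by positivity)
  have f4 : Lam ^ (1 / p) ≤ Lam := by
    calc Lam ^ (1 / p) ≤ Lam ^ (1 : ℝ) := Real.rpow_le_rpow_of_exponent_le Lam_ge (by
          rw [div_le_one (by linarith)]; linarith)
      _ = Lam := Real.rpow_one _
  have f5 : (n * (α * (L / h) ^ p)) ^ (1 / p) = (n : ℝ) ^ (1 / p) * α ^ (1 / p) * L / h := by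
    rw [Real.mul_rpow hn'.le (by positivity), Real.mul_rpow hα.le (by positivity), ← Real.rpow_mul (by positivity)]
    rw [mul_one_div_cancel (by linarith), Real.rpow_one]; ring
  rw [f5] at f3
  have := f3.trans f4
  rwa [div_le_iff₀ h0] at this

theorem pconv_bound (hn : 0 < n) (hB : IsConvexBody K) (hI : IsIsotropic K L) (hL : 0 < L) {p α : ℝ} (hp : 2 ≤ p) (hα : 0 < α)
    (hP : ∀ ε : ℝ, 0 < ε → ε ≤ 2 → α * ε ^ p ≤ modConv K ε) :
    (n : ℝ) ^ (1 / p) * α ^ (1 / p) * L ≤ Lam * √n := by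
  have hK := hB.1
  have hn' : (0 : ℝ) < n := by positivity
  have Lp : 0 < Lam := by linarith [Lam_ge]
  set r := (n : ℝ) ^ (1 / p) * α ^ (1 / p) * L / Lam with hr
  have r0 : 0 < r := by positivity
  have ball : ∀ x : E n, ‖x‖ < r → x ∈ K := by
    intro x hx
    by_contra hxK
    obtain ⟨f, u, hf, hu⟩ := geometric_hahn_banach_closed_point hB.2.1 hK.isClosed hxK
    obtain ⟨v, rfl⟩ := (InnerProductSpace.toDual ℝ (E n)).surjective f
    simp only [InnerProductSpace.toDual_apply_apply] at hf hu
    have u0 : 0 < u := by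
      have := hf 0 (mem_of_mem_nhds (body_nhds hB))
      simpa using this
    have v0 : 0 < ‖v‖ := by
      rw [norm_pos_iff]
      rintro rfl
      simp at hu; linarith
    have hw := width hn hB hI hL hp hα hP (‖v‖⁻¹ • v) (by
      rw [norm_smul, norm_inv, norm_norm]; field_simp) (u / ‖v‖) (by positivity) (by
        intro z hz
        rw [inner_smul_right, abs_mul, abs_of_pos (by positivity), inv_mul_eq_div]
        apply div_le_div_of_nonneg_right _ v0.le
        rw [real_inner_comm]
        apply abs_le.2 ⟨_, (hf z hz).le⟩
        have := hf (-z) (body_neg hB hz)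
        rw [inner_neg_right] at this
        linarith)
    have h1 : r ≤ u / ‖v‖ := by rw [hr, div_le_iff₀ Lp]; linarith
    have h2 : ⟪v, x⟫ ≤ ‖v‖ * ‖x‖ := real_inner_le_norm _ _
    rw [le_div_iff₀ v0] at h1
    nlinarith
  set e := r / √n with he
  have sn : 0 < √(n : ℝ) := Real.sqrt_pos.2 hn'
  have e0 : 0 < e := by positivity
  have sub : (WithLp.ofLp : E n → (Fin n → ℝ)) ⁻¹' (Metric.ball 0 e) ⊆ K := by
    intro x hx
    apply ball
    have hx' : ∀ i, |x i| < e := by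
      have : WithLp.ofLp x ∈ Metric.ball (0 : Fin n → ℝ) e := hx
      rw [mem_ball_zero_iff, pi_norm_lt_iff e0] at this
      exact this
    have : ‖x‖ ^ 2 < r ^ 2 := by
      rw [EuclideanSpace.norm_sq_eq]
      calc ∑ i, ‖x i‖ ^ 2 < ∑ i : Fin n, e ^ 2 := by
            apply Finset.sum_lt_sum_of_nonempty
            · exact ⟨⟨0, hn⟩, Finset.mem_univ _⟩
            · intro i _
              exact pow_lt_pow_left₀ (hx' i) (abs_nonneg _) (by norm_num)
        _ = n * e ^ 2 := by simp
        _ = r ^ 2 := by rw [he, div_pow, Real.sq_sqrt hn'.le]; field_simp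
    exact lt_of_pow_lt_pow_left₀ 2 r0.le this
  have vol : ENNReal.ofReal ((2 * e) ^ n) ≤ 1 := by
    rw [← hI.1]
    refine le_trans (le_of_eq ?_) (measure_mono sub)
    rw [(PiLp.volume_preserving_ofLp (Fin n)).measure_preimage Metric.isOpen_ball.measurableSet.nullMeasurableSet,
      Real.volume_pi_ball _ e0]
    simp
  have h2 : (2 * e) ^ n ≤ 1 := by
    rwa [ENNReal.ofReal_le_one] at vol
  have h3 : 2 * e ≤ 1 := by
    by_contra hc
    push Not at hc
    have := one_lt_pow₀ hc hn.ne'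
    linarith
  have h4 : e ≤ 1 := by linarith
  rw [he, div_le_one sn, hr, div_le_iff₀ Lp] at h4
  linarith

end


theorem dim_pos {K : Set (E n)} {p α : ℝ} (hα : 0 < α)
    (hP : ∀ ε : ℝ, 0 < ε → ε ≤ 2 → α * ε ^ p ≤ modConv K ε) : 0 < n := by
  rcases Nat.eq_zero_or_pos n with h | h
  · subst h
    have h1 := hP 1 one_pos (by norm_num)
    have : {d | ∃ x y : E 0, gauge K x ≤ 1 ∧ gauge K y ≤ 1 ∧ 1 ≤ gauge K (x - y) ∧
        d = 1 - gauge K ((2⁻¹ : ℝ) • (x + y))} = ∅ := by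
      rw [eq_empty_iff_forall_notMem]
      rintro d ⟨x, y, _, _, h3, _⟩
      have : x - y = 0 := Subsingleton.elim _ _
      rw [this, gauge_zero] at h3
      linarith
    unfold modConv at h1
    rw [this, Real.sInf_empty, Real.one_rpow] at h1
    linarith
  · exact h

theorem varq_le {K : Set (E n)} {L : ℝ} (hB : IsConvexBody K) (hI : IsIsotropic K L)
    (q σ : ℝ) (hq : 1 ≤ q) (hq2 : q ≤ 2) (hσ : 0 < σ)
    (h : ex K (fun _ => 1) (fun x => (‖x‖ ^ 2 - n * L ^ 2) ^ 2) ≤ σ ^ 2) :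
    varq K q (fun x => ‖x‖ ^ 2) ^ ((1 : ℝ) / q) ≤ 2 * σ := by
  have hK := hB.1
  have hLC := iso_LC hI
  have hq0 : 0 < q := by linarith
  have e1 : (∫ y in K, ‖y‖ ^ 2) = n * L ^ 2 := by
    rw [← iso_norm hK hI]; unfold ex; simp
  have e2 : varq K q (fun x => ‖x‖ ^ 2) = ex K (fun _ => 1) (fun x => |‖x‖ ^ 2 - n * L ^ 2| ^ q) := by
    unfold varq ex; rw [e1]; simp
  have a1 : Adm K (fun x : E n => |‖x‖ ^ 2 - n * L ^ 2| ^ q) := by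
    apply Adm.ofCont hK
    apply Continuous.rpow_const (by fun_prop)
    intro x; right; exact hq0.le
  have a2 : Adm K (fun x : E n => (‖x‖ ^ 2 - n * L ^ 2) ^ 2) := Adm.ofCont hK (by fun_prop)
  have h1 : varq K q (fun x => ‖x‖ ^ 2) ≤ σ ^ q * 2 := by
    rw [e2]
    have h2 : ex K (fun _ => 1) (fun x => |‖x‖ ^ 2 - n * L ^ 2| ^ q) ≤
        ex K (fun _ => 1) (fun x => σ ^ q + (σ ^ q / σ ^ 2) * (‖x‖ ^ 2 - n * L ^ 2) ^ 2) := by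
      apply ex_mono hK (Adm.const 1) (fun _ _ => zero_le_one) a1 ((Adm.const _).add (a2.smul _))
      intro x _
      set z := ‖x‖ ^ 2 - n * L ^ 2
      have z0 := abs_nonneg z
      have sq : 0 < σ ^ q := by positivity
      have key : (|z| / σ) ^ q ≤ 1 + (|z| / σ) ^ 2 := by
        have t0 : 0 ≤ |z| / σ := by positivity
        by_cases ht : |z| / σ ≤ 1
        · have := Real.rpow_le_one t0 ht hq0.le
          have := sq_nonneg (|z| / σ)
          linarith
        · push Not at ht
          have := Real.rpow_le_rpow_of_exponent_le ht.le hq2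
          rw [Real.rpow_two] at this
          linarith
      rw [Real.div_rpow z0 hσ.le, div_pow, sq_abs, div_le_iff₀ sq] at key
      calc |z| ^ q ≤ _ := key
        _ = _ := by ring
    rw [ex_add hK (Adm.const 1) (Adm.const _) (a2.smul _), ex_smul, hLC.ex_const] at h2
    have h3 := mul_le_mul_of_nonneg_left h (show 0 ≤ σ ^ q / σ ^ 2 by positivity)
    have e3 : σ ^ q / σ ^ 2 * σ ^ 2 = σ ^ q := by field_simp
    rw [e3] at h3
    linarith
  have v0 : 0 ≤ varq K q (fun x => ‖x‖ ^ 2) := by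
    rw [e2]; exact ex_nonneg hK (fun _ _ => zero_le_one) (fun x _ => by positivity)
  calc varq K q (fun x => ‖x‖ ^ 2) ^ ((1 : ℝ) / q) ≤ (σ ^ q * 2) ^ ((1 : ℝ) / q) :=
        Real.rpow_le_rpow v0 h1 (by positivity)
    _ = σ * 2 ^ ((1 : ℝ) / q) := by
        rw [Real.mul_rpow (by positivity) (by norm_num), ← Real.rpow_mul hσ.le, mul_one_div_cancel hq0.ne', Real.rpow_one]
    _ ≤ σ * 2 := by
        apply mul_le_mul_of_nonneg_left _ hσ.le
        calc (2 : ℝ) ^ ((1 : ℝ) / q) ≤ 2 ^ (1 : ℝ) := Real.rpow_le_rpow_of_exponent_le (by norm_num) (by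
              rw [div_le_one hq0]; exact hq)
          _ = 2 := Real.rpow_one _
    _ = 2 * σ := mul_comm _ _

/-- concentration position for `p`-convex bodies, `2 ≤ p < 4`. -/
theorem p_convex_variance_position :
    ∃ c > (0 : ℝ), ∃ C > (0 : ℝ), ∃ f : ℝ → ℝ → ℝ,
      (∀ p α : ℝ, 0 < α → 0 < f p α) ∧
      ∀ (p : ℝ), 2 ≤ p → p < 4 →
        ∀ q : ℝ, q = p / (p - 1) →
          ∀ (n : ℕ) (K : Set (E n)) (α L : ℝ), 0 < α → 0 < L →
            IsPConvexBody K p α → IsIsotropic K L →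
            ∃ T : E n →ₗ[ℝ] E n, LinearMap.det T = 1 ∧
              opNorm T ≤ C * (n : ℝ) ^ (1 / (2 * q)) * α ^ (-(1 / (2 * p))) *
                L ^ (-(1 : ℝ) / 2) * (min (f p α) (Real.log (1 + n))) ^ ((1 : ℝ) / 2) ∧
              varq (T '' K) q (fun x => ‖x‖ ^ 2) ^ ((1 : ℝ) / q) ≤
                C * (n : ℝ) ^ ((1 : ℝ) / 4 + 1 / q) * α ^ (-(1 / p)) * L *
                  min (f p α) (Real.log (1 + n)) ∧
              ∀ ρ : ℝ, ρ = Real.sqrt ((n : ℝ)⁻¹ * ∫ x in T '' K, ‖x‖ ^ 2) →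
                ∀ t : ℝ, 0 < t →
                  volume {x : E n | x ∈ T '' K ∧ t * ρ ≤ |‖x‖ / Real.sqrt n - ρ|} ≤
                    ENNReal.ofReal (2 * Real.exp (-(c * L ^ ((1 : ℝ) / 2) *
                      α ^ (1 / (2 * p)) * (n : ℝ) ^ ((3 : ℝ) / 8 - 1 / (2 * q)) *
                      t ^ ((1 : ℝ) / 2) /
                      (min (f p α) (Real.log (1 + n))) ^ ((1 : ℝ) / 2)))) := by
  obtain ⟨c1, c1p, htail⟩ := conc_tail
  obtain ⟨C1, C1p, hvar⟩ := conc_var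
  have Lp : 0 < Lam := by linarith [Lam_ge]
  have L1 := Lam_ge
  have sq2 : 0 < √(2 * Lam) := Real.sqrt_pos.2 (by positivity)
  have sC : 0 < √C1 := Real.sqrt_pos.2 C1p
  refine ⟨c1 / √(2 * Lam), by positivity, √(2 * Lam) + 4 * √C1 * Lam, by positivity, fun _ _ => 1,
    fun _ _ _ => one_pos, ?_⟩
  intro p hp hp4 q hq n K α L hα hL hPK hI
  obtain ⟨hB, hP⟩ := hPK
  have hK := hB.1
  have hn := dim_pos hα hP
  have hn1 : (1 : ℝ) ≤ n := by exact_mod_cast hn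
  have hn' : (0 : ℝ) < n := by linarith
  have bound := pconv_bound hn hB hI hL hp hα hP
  have p0 : 0 < p := by linarith
  have p1 : 0 < p - 1 := by linarith
  have q0 : 0 < q := by rw [hq]; positivity
  have q1 : 1 ≤ q := by rw [hq, le_div_iff₀ p1]; linarith
  have q2 : q ≤ 2 := by rw [hq, div_le_iff₀ p1]; linarith
  set s := 1 / p with hs
  have iq : 1 / q = 1 - s := by rw [hq, hs]; field_simp
  have iq2 : 1 / (2 * q) = (1 - s) * (1 / 2) := by rw [← iq]; field_simp
  have ip2 : 1 / (2 * p) = s * (1 / 2) := by rw [hs]; field_simp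
  set m := min (1 : ℝ) (Real.log (1 + n)) with hm
  have m1 : 1 / 2 ≤ m := by
    apply le_min (by norm_num)
    have h2 : Real.log 2 ≤ Real.log (1 + n) := Real.log_le_log (by norm_num) (by linarith)
    linarith [Real.log_two_gt_d9]
  have m0 : 0 < m := by linarith
  set β := α ^ s with hβ
  have β0 : 0 < β := by positivity
  set N := (n : ℝ) with hN
  have LB : L * β * N ^ s ≤ Lam * N ^ (1 / 2 : ℝ) := by
    rw [← Real.sqrt_eq_rpow]; linarith
  have αneg : α ^ (-s) = β⁻¹ := Real.rpow_neg hα.le s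
  refine ⟨LinearMap.id, LinearMap.det_id, ?_, ?_, ?_⟩
  · have h1 : opNorm (LinearMap.id : E n →ₗ[ℝ] E n) ≤ 1 := by
      unfold opNorm
      apply ContinuousLinearMap.opNorm_le_bound _ zero_le_one
      intro x; simp
    refine h1.trans ?_
    have e1 : N ^ (1 / (2 * q)) * α ^ (-(1 / (2 * p))) * L ^ (-(1 : ℝ) / 2) * m ^ ((1 : ℝ) / 2) =
        √(N ^ (1 - s) * β⁻¹ * L⁻¹ * m) := by
      rw [Real.sqrt_eq_rpow, Real.mul_rpow (by positivity) m0.le, Real.mul_rpow (by positivity) (by positivity),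
        Real.mul_rpow (by positivity) (by positivity), ← αneg, ← Real.rpow_neg_one L, ← Real.rpow_mul hn'.le,
        ← Real.rpow_mul hα.le, ← Real.rpow_mul hL.le, iq2, ip2]
      congr 4
      · ring
      · ring
    have e2 : 1 ≤ √(2 * Lam) * √(N ^ (1 - s) * β⁻¹ * L⁻¹ * m) := by
      rw [← Real.sqrt_mul (by positivity), Real.one_le_sqrt]
      have h2 : N ^ (1 / 2 : ℝ) ≤ N ^ (1 : ℝ) := Real.rpow_le_rpow_of_exponent_le hn1 (by norm_num)
      have h3 : N ^ (1 : ℝ) = N ^ (1 - s) * N ^ s := by rw [← Real.rpow_add hn']; congr 1; ring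
      have Ns : 0 < N ^ s := by positivity
      have h4 : (L * β) * N ^ s ≤ (Lam * N ^ (1 - s)) * N ^ s := by
        have := mul_le_mul_of_nonneg_left h2 Lp.le
        rw [h3] at this
        linarith
      have h5 := le_of_mul_le_mul_right h4 Ns
      have h6 : 2 * Lam * (N ^ (1 - s) * β⁻¹ * L⁻¹ * m) = (Lam * N ^ (1 - s)) * (2 * m) / (L * β) := by
        field_simp
      rw [h6, le_div_iff₀ (by positivity), one_mul]
      refine h5.trans (le_mul_of_one_le_right (by positivity) (by linarith))
    calc (1 : ℝ) ≤ √(2 * Lam) * √(N ^ (1 - s) * β⁻¹ * L⁻¹ * m) := e2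
      _ ≤ (√(2 * Lam) + 4 * √C1 * Lam) * √(N ^ (1 - s) * β⁻¹ * L⁻¹ * m) := by
          apply mul_le_mul_of_nonneg_right _ (Real.sqrt_nonneg _)
          have : 0 ≤ 4 * √C1 * Lam := by positivity
          linarith
      _ = _ := by rw [← e1]; ring
  · have hid : (LinearMap.id : E n →ₗ[ℝ] E n) '' K = K := by simp
    rw [hid]
    set σ := √C1 * (√√N ^ 3 * L ^ 2) with hσ
    have a0 : 0 < √√N := by positivity
    have σ0 : 0 < σ := by positivity
    have hv := hvar n hn K L hB hI hL
    have h1 := varq_le hB hI q σ q1 q2 σ0 (by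
      rw [hσ, mul_pow √C1, Real.sq_sqrt C1p.le]; exact hv)
    refine h1.trans ?_
    have e1 : √√N ^ 3 = N ^ (3 / 4 : ℝ) := by
      rw [Real.sqrt_eq_rpow, Real.sqrt_eq_rpow, ← Real.rpow_mul hn'.le, ← Real.rpow_natCast, ← Real.rpow_mul hn'.le]
      norm_num
    have e2 : N ^ ((1 : ℝ) / 4 + 1 / q) * N ^ s = N ^ (3 / 4 : ℝ) * N ^ (1 / 2 : ℝ) := by
      rw [iq, ← Real.rpow_add hn', ← Real.rpow_add hn']; congr 1; ring
    have Ns : 0 < N ^ s := by positivity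
    set Y := N ^ ((1 : ℝ) / 4 + 1 / q) with hY
    have Y0 : 0 < Y := by positivity
    have h3 : N ^ (3 / 4 : ℝ) * (L * β) * N ^ s ≤ (Lam * Y) * N ^ s := by
      have := mul_le_mul_of_nonneg_left LB (show 0 ≤ N ^ (3 / 4 : ℝ) by positivity)
      calc _ = N ^ (3 / 4 : ℝ) * (L * β * N ^ s) := by ring
        _ ≤ _ := this
        _ = Lam * (N ^ (3 / 4 : ℝ) * N ^ (1 / 2 : ℝ)) := by ring
        _ = _ := by rw [← e2]; ring
    have h4 := le_of_mul_le_mul_right h3 Ns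
    have h5 : N ^ (3 / 4 : ℝ) * L ≤ Lam * Y * β⁻¹ := by
      rw [← div_eq_mul_inv, le_div_iff₀ β0]; linarith
    rw [αneg]
    calc 2 * σ = 2 * √C1 * L * (N ^ (3 / 4 : ℝ) * L) := by rw [hσ, e1]; ring
      _ ≤ 2 * √C1 * L * (Lam * Y * β⁻¹) := mul_le_mul_of_nonneg_left h5 (by positivity)
      _ = (4 * √C1 * Lam) * Y * β⁻¹ * L * (1 / 2) := by ring
      _ ≤ (√(2 * Lam) + 4 * √C1 * Lam) * Y * β⁻¹ * L * m := by
          gcongr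
          linarith
  · have hid : (LinearMap.id : E n →ₗ[ℝ] E n) '' K = K := by simp
    rw [hid]
    intro ρ hρ t ht
    have e1 : (∫ y in K, ‖y‖ ^ 2) = n * L ^ 2 := by
      rw [← iso_norm hK hI]; unfold ex; simp
    have eρ : ρ = L := by
      rw [hρ, e1, ← mul_assoc, inv_mul_cancel₀ hn'.ne', one_mul, Real.sqrt_sq hL.le]
    rw [eρ]
    set a := √√N with ha
    have a0 : 0 < a := by positivity
    have a2 : a * a = √N := Real.mul_self_sqrt (Real.sqrt_nonneg _)
    have sN : 0 < √N := Real.sqrt_pos.2 hn'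
    have cY : Continuous (fun x : E n => |‖x‖ - √N * L|) := by fun_prop
    set M : Set (E n) := {x | t * a * a * L ≤ |‖x‖ - √N * L|} with hM
    have mM : MeasurableSet M := measurableSet_le measurable_const cY.measurable
    have h1 := htail n hn K L hB hI hL (t * a) (by positivity)
    have sub : {x : E n | x ∈ K ∧ t * L ≤ |‖x‖ / √N - L|} ⊆ M ∩ K := by
      rintro x ⟨hx, hx2⟩
      refine ⟨?_, hx⟩
      show t * a * a * L ≤ |‖x‖ - √N * L|
      have : |‖x‖ / √N - L| = |‖x‖ - √N * L| / √N := by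
        rw [← abs_of_pos sN, ← abs_div, abs_of_pos sN]
        congr 1; field_simp
      rw [this, le_div_iff₀ sN] at hx2
      have e9 : t * a * a * L = t * L * √N := by rw [← a2]; ring
      rw [e9]; exact hx2
    have h2 : volume (M ∩ K) = ENNReal.ofReal (pr K M) := by
      rw [pr_eq hK mM, ENNReal.ofReal_toReal, Measure.restrict_apply mM]
      have : IsFiniteMeasure (volume.restrict K) := ⟨by simpa using hK.measure_lt_top⟩
      exact measure_ne_top _ _
    refine (measure_mono sub).trans ?_
    rw [h2]
    apply ENNReal.ofReal_le_ofReal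
    refine h1.trans ?_
    apply mul_le_mul_of_nonneg_left _ (by norm_num)
    apply Real.exp_le_exp.2
    apply neg_le_neg
    have e3 : L ^ ((1 : ℝ) / 2) * α ^ (1 / (2 * p)) * N ^ ((3 : ℝ) / 8 - 1 / (2 * q)) * t ^ ((1 : ℝ) / 2) /
        m ^ ((1 : ℝ) / 2) = √(L * β * N ^ (s - 1 / 4) * t / m) := by
      rw [Real.sqrt_eq_rpow, Real.div_rpow (by positivity) m0.le, Real.mul_rpow (by positivity) ht.le,
        Real.mul_rpow (by positivity) (by positivity), Real.mul_rpow hL.le β0.le, hβ,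
        ← Real.rpow_mul hn'.le, ← Real.rpow_mul hα.le, iq2, ip2]
      congr 4
      ring
    have e4 : L * β * N ^ (s - 1 / 4) * t / m ≤ 2 * Lam * (t * a) := by
      have ea : a = N ^ (1 / 4 : ℝ) := by
        rw [ha, Real.sqrt_eq_rpow, Real.sqrt_eq_rpow, ← Real.rpow_mul hn'.le]; norm_num
      have e5 : N ^ s * N ^ (-(1 / 4) : ℝ) = N ^ (s - 1 / 4) := by
        rw [← Real.rpow_add hn']; congr 1
      have e6 : N ^ (1 / 2 : ℝ) * N ^ (-(1 / 4) : ℝ) = a := by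
        rw [← Real.rpow_add hn', ea]; norm_num
      have h3 := mul_le_mul_of_nonneg_right LB (show 0 ≤ N ^ (-(1 / 4) : ℝ) by positivity)
      have h4 : L * β * N ^ (s - 1 / 4) ≤ Lam * a := by
        rw [← e5, ← e6]; linarith
      rw [div_le_iff₀ m0]
      calc L * β * N ^ (s - 1 / 4) * t ≤ Lam * a * t := mul_le_mul_of_nonneg_right h4 ht.le
        _ ≤ Lam * a * t * (2 * m) := le_mul_of_one_le_right (by positivity) (by linarith)
        _ = _ := by ring
    have e7 := Real.sqrt_le_sqrt e4
    rw [← e3, Real.sqrt_mul (by positivity)] at e7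
    calc _ = c1 / √(2 * Lam) * (L ^ ((1 : ℝ) / 2) * α ^ (1 / (2 * p)) * N ^ ((3 : ℝ) / 8 - 1 / (2 * q)) * t ^ ((1 : ℝ) / 2) /
        m ^ ((1 : ℝ) / 2)) := by ring
      _ ≤ c1 / √(2 * Lam) * (√(2 * Lam) * √(t * a)) := mul_le_mul_of_nonneg_left e7 (by positivity)
      _ = c1 * √(t * a) := by field_simp

end GM
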